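/- arXiv:2102.07479 — 4 statements merged into one kernel-verified Lean document; each statement's English description precedes it below -/
import Mathlib

section
/- Let g be a complex-valued function holomorphic on the open strip S = {z ∈ ℂ : 0 < Re z < 1/2}, continuous and uniformly bounded on the closed strip. Then for every θ ∈ (0,1/2), log|g(θ)| ≤ ∫_ℝ ( 2θ·β_θ(t)·log|g(1/2+it)| + (1−2θ)·α_θ(t)·log|g(it)| ) dt, where the right-hand side is a well-defined integral with values in [−∞, ∞) (the integrand is bounded above since g is bounded). -/
/-!
STATEMENT 0: Hirschman's improvement of the Hadamard three-lines theorem on the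
strip {z : 0 < Re z < 1/2}.  Since `log |g|` can be `-∞`, we work with `EReal`-valued
logarithms and an `EReal`-valued (signed) integral: the integral is well defined with
values in `[-∞, ∞)` because the integrand is bounded above.
-/

open MeasureTheory Complex
open scoped ENNReal NNReal

/-- The density `α_θ(t) = sin(2πθ)/((1−2θ)(cosh(2πt) − cos(2πθ)))`. -/
noncomputable def alphaD (θ t : ℝ) : ℝ :=
  Real.sin (2 * Real.pi * θ) /
    ((1 - 2 * θ) * (Real.cosh (2 * Real.pi * t) - Real.cos (2 * Real.pi * θ)))

/-- The density `β_θ(t) = sin(2πθ)/(2θ(cosh(2πt) + cos(2πθ)))`. -/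
noncomputable def betaD (θ t : ℝ) : ℝ :=
  Real.sin (2 * Real.pi * θ) /
    (2 * θ * (Real.cosh (2 * Real.pi * t) + Real.cos (2 * Real.pi * θ)))

/-- `EReal`-valued logarithm of a (nonnegative) real number: `elog 0 = ⊥ = -∞`. -/
noncomputable def elog (x : ℝ) : EReal := ENNReal.log (ENNReal.ofReal x)

/-- The positive part of an extended real, as an extended nonnegative real. -/
noncomputable def erealPosPart (x : EReal) : ℝ≥0∞ :=
  if x = ⊤ then ⊤ else ENNReal.ofReal x.toReal

/-- Signed integral of an `EReal`-valued function: the difference of the lower integrals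
of the positive and negative parts.  When the positive part is integrable (e.g. when the
integrand is bounded above by an integrable function) this takes values in `[-∞, ∞)`. -/
noncomputable def erealIntegral {α : Type*} [MeasurableSpace α] (μ : Measure α)
    (f : α → EReal) : EReal :=
  ((∫⁻ x, erealPosPart (f x) ∂μ : ℝ≥0∞) : EReal) -
    ((∫⁻ x, erealPosPart (-(f x)) ∂μ : ℝ≥0∞) : EReal)

/-- The extended nonnegative real `-log x`, truncated at `0`. -/
noncomputable def negLog (x : ℝ) : ℝ≥0∞ := (-(elog x)).toENNReal

lemma continuous_negLog : Continuous negLog :=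
  EReal.continuous_toENNReal.comp <| continuous_neg.comp <|
    ENNReal.continuous_log.comp ENNReal.continuous_ofReal

lemma negLog_zero : negLog 0 = ⊤ := by simp [negLog, elog]

lemma negLog_of_pos {x : ℝ} (hx : 0 < x) : negLog x = ENNReal.ofReal (-Real.log x) := by
  rw [negLog, elog, ENNReal.log_ofReal_of_pos hx, ← EReal.coe_neg,
    EReal.toENNReal_of_ne_top (EReal.coe_ne_top _), EReal.toReal_coe]

lemma log_norm_le_circleAverage_log_norm {F : ℂ → ℂ} {c : ℂ} {r : ℝ} (hr : 0 < r)
    (hF : AnalyticOnNhd ℂ F (Metric.closedBall c r)) (hc : F c ≠ 0) :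
    Real.log ‖F c‖ ≤ Real.circleAverage (fun z => Real.log ‖F z‖) c r := by
  rw [← abs_of_pos hr] at hF
  rw [hF.circleAverage_log_norm hr.ne' hc]
  refine le_add_of_nonneg_left (finsum_nonneg fun u => ?_)
  by_cases hu : u ∈ Metric.closedBall c |r|
  · refine mul_nonneg ?_ ?_
    · exact_mod_cast (MeromorphicOn.AnalyticOnNhd.divisor_nonneg hF) u
    · rcases eq_or_ne c u with rfl | hcu
      · simp
      · have h0 : 0 < ‖c - u‖ := norm_pos_iff.2 (sub_ne_zero.2 hcu)
        refine Real.log_nonneg ?_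
        rw [← div_eq_mul_inv, one_le_div h0, ← dist_eq_norm, dist_comm]
        simpa [abs_of_pos hr] using hu
  · simp [hu]

/-- The super-mean value property of `-log ‖F‖` on circles. -/
lemma lintegral_negLog_norm_circleMap_le {F : ℂ → ℂ} {r : ℝ} (hr : 0 < r)
    (hF : AnalyticOnNhd ℂ F (Metric.closedBall 0 r))
    (hle : ∀ z ∈ Metric.closedBall (0 : ℂ) r, ‖F z‖ ≤ 1) :
    ∫⁻ s in Set.Ioo (-Real.pi) Real.pi, negLog ‖F (circleMap 0 r s)‖ ≤
      ENNReal.ofReal (2 * Real.pi) * negLog ‖F 0‖ := by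
  have hpi := Real.pi_pos
  by_cases h0 : F 0 = 0
  · rw [h0, norm_zero, negLog_zero, ENNReal.mul_top]
    · exact le_top
    · simpa using hpi
  have hmem : ∀ s, circleMap 0 r s ∈ Metric.closedBall (0 : ℂ) r := fun s =>
    circleMap_mem_closedBall 0 hr.le s
  have hint : CircleIntegrable (fun z => Real.log ‖F z‖) 0 r :=
    MeromorphicOn.circleIntegrable_log_norm <| (hF.mono <| by
      rw [abs_of_pos hr]; exact Metric.sphere_subset_closedBall).meromorphicOn
  have hper : Function.Periodic (fun s => Real.log ‖F (circleMap 0 r s)‖) (2 * Real.pi) :=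
    fun s => by simp [periodic_circleMap 0 r s]
  have hint' : IntegrableOn (fun s => Real.log ‖F (circleMap 0 r s)‖)
      (Set.Ioo (-Real.pi) Real.pi) := by
    have h1 : IntervalIntegrable (fun s => Real.log ‖F (circleMap 0 r s)‖) volume
        (-Real.pi) Real.pi := by
      have := hper.intervalIntegrable₀ Real.two_pi_pos.ne' hint (-Real.pi) Real.pi
      exact this
    exact (intervalIntegrable_iff_integrableOn_Ioo_of_le (by linarith)).1 h1
  have hJ := log_norm_le_circleAverage_log_norm hr hF h0
  have hshift : ∫ s in Set.Ioo (-Real.pi) Real.pi, Real.log ‖F (circleMap 0 r s)‖ =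
      ∫ s in (0 : ℝ)..2 * Real.pi, Real.log ‖F (circleMap 0 r s)‖ := by
    have := hper.intervalIntegral_add_eq (-Real.pi) 0
    rw [show -Real.pi + 2 * Real.pi = Real.pi by ring, zero_add] at this
    rw [← this, intervalIntegral.integral_of_le (by linarith), integral_Ioc_eq_integral_Ioo]
  have hne : ∀ᵐ s ∂volume.restrict (Set.Ioo (-Real.pi) Real.pi), F (circleMap 0 r s) ≠ 0 := by
    have h1 := hF.preimage_zero_mem_codiscreteWithin h0 (by simp [hr.le])
      ((convex_closedBall (0 : ℂ) r).isConnected ⟨0, by simp [hr.le]⟩)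
    have h2 := Filter.codiscreteWithin_mono (Metric.sphere_subset_closedBall) h1
    rw [← abs_of_pos hr] at h2
    have h3 := circleMap_preimage_codiscrete hr.ne' (by simpa [abs_of_pos hr] using h2)
    have h4 := ae_restrict_le_codiscreteWithin (μ := volume)
      (measurableSet_Ioo (a := -Real.pi) (b := Real.pi))
      (Filter.codiscreteWithin_mono (Set.subset_univ _) h3)
    filter_upwards [h4] with s hs
    simpa using hs
  calc ∫⁻ s in Set.Ioo (-Real.pi) Real.pi, negLog ‖F (circleMap 0 r s)‖
      = ∫⁻ s in Set.Ioo (-Real.pi) Real.pi,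
          ENNReal.ofReal (-Real.log ‖F (circleMap 0 r s)‖) :=
        lintegral_congr_ae (hne.mono fun s hs => negLog_of_pos (norm_pos_iff.2 hs))
    _ = ENNReal.ofReal (∫ s in Set.Ioo (-Real.pi) Real.pi,
          -Real.log ‖F (circleMap 0 r s)‖) :=
        (ofReal_integral_eq_lintegral_ofReal hint'.neg (Filter.Eventually.of_forall fun s =>
          neg_nonneg.2 (Real.log_nonpos (norm_nonneg _) (hle _ (hmem s))))).symm
    _ ≤ ENNReal.ofReal (2 * Real.pi * -Real.log ‖F 0‖) := by
        refine ENNReal.ofReal_le_ofReal ?_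
        rw [integral_neg, hshift]
        rw [Real.circleAverage_def, smul_eq_mul, inv_mul_eq_div, le_div_iff₀ (by positivity)] at hJ
        linarith
    _ = ENNReal.ofReal (2 * Real.pi) * negLog ‖F 0‖ := by
        rw [ENNReal.ofReal_mul (by positivity), negLog_of_pos (norm_pos_iff.2 h0)]

/-- Super-mean value property of `-log ‖F‖` on the boundary of the unit disc, for functions with
radial limits almost everywhere. -/
lemma lintegral_negLog_norm_unit_circle_le {F : ℂ → ℂ}
    (hF : DifferentiableOn ℂ F (Metric.ball 0 1))
    (hle : ∀ z ∈ Metric.ball (0 : ℂ) 1, ‖F z‖ ≤ 1)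
    (hlim : ∀ᵐ s ∂volume.restrict (Set.Ioo (-Real.pi) Real.pi),
      Filter.Tendsto (fun r : ℝ => F (circleMap 0 r s)) (nhdsWithin 1 (Set.Iio 1))
        (nhds (F (circleMap 0 1 s)))) :
    ∫⁻ s in Set.Ioo (-Real.pi) Real.pi, negLog ‖F (circleMap 0 1 s)‖ ≤
      ENNReal.ofReal (2 * Real.pi) * negLog ‖F 0‖ := by
  have hr : ∀ n : ℕ, 0 < 1 - 1 / ((n : ℝ) + 2) ∧ 1 - 1 / ((n : ℝ) + 2) < 1 := fun n => by
    have h2 : (0 : ℝ) < (n : ℝ) + 2 := by positivity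
    refine ⟨sub_pos.2 ((div_lt_one h2).2 ?_), sub_lt_self _ (by positivity)⟩
    have : (0 : ℝ) ≤ n := n.cast_nonneg
    linarith
  have htend : Filter.Tendsto (fun n : ℕ => 1 - 1 / ((n : ℝ) + 2)) Filter.atTop
      (nhdsWithin 1 (Set.Iio 1)) := by
    refine tendsto_nhdsWithin_iff.2 ⟨?_, Filter.Eventually.of_forall fun n => (hr n).2⟩
    have h : Filter.Tendsto (fun n : ℕ => 1 / ((n : ℝ) + 2)) Filter.atTop (nhds 0) :=
      tendsto_const_nhds.div_atTop
        (Filter.tendsto_atTop_add_const_right _ _ tendsto_natCast_atTop_atTop)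
    simpa using h.const_sub 1
  have hsub : ∀ n : ℕ, Metric.closedBall (0 : ℂ) (1 - 1 / ((n : ℝ) + 2)) ⊆ Metric.ball 0 1 :=
    fun n => Metric.closedBall_subset_ball (hr n).2
  have hA : AnalyticOnNhd ℂ F (Metric.ball 0 1) := hF.analyticOnNhd Metric.isOpen_ball
  calc ∫⁻ s in Set.Ioo (-Real.pi) Real.pi, negLog ‖F (circleMap 0 1 s)‖
      = ∫⁻ s in Set.Ioo (-Real.pi) Real.pi, Filter.liminf
          (fun n : ℕ => negLog ‖F (circleMap 0 (1 - 1 / ((n : ℝ) + 2)) s)‖) Filter.atTop :=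
        lintegral_congr_ae (hlim.mono fun s hs =>
          ((continuous_negLog.tendsto _).comp (hs.comp htend).norm).liminf_eq.symm)
    _ ≤ Filter.liminf (fun n : ℕ => ∫⁻ s in Set.Ioo (-Real.pi) Real.pi,
          negLog ‖F (circleMap 0 (1 - 1 / ((n : ℝ) + 2)) s)‖) Filter.atTop := by
        refine lintegral_liminf_le fun n => Continuous.measurable ?_
        refine continuous_negLog.comp (ContinuousOn.comp_continuous hF.continuousOn
          (continuous_circleMap 0 _) fun s => hsub n ?_).norm
        exact circleMap_mem_closedBall 0 (hr n).1.le s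
    _ ≤ ENNReal.ofReal (2 * Real.pi) * negLog ‖F 0‖ :=
        Filter.liminf_le_of_frequently_le' <| Filter.Frequently.of_forall fun n =>
          lintegral_negLog_norm_circleMap_le (hr n).1 (hA.mono (hsub n))
            fun z hz => hle z (hsub n hz)

/-- The conformal map from the unit disc to the upper half plane that sends `0` to `exp (a * I)`. -/
noncomputable def discToHalfPlane (a : ℝ) (ζ : ℂ) : ℂ :=
  Real.cos a + Real.sin a * (I * (1 - ζ) / (1 + ζ))

/-- The conformal map from the unit disc to the strip `0 < Re z < 1 / 2` that sends `0` to
`a / (2 * π)`. -/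
noncomputable def discToStrip (a : ℝ) (ζ : ℂ) : ℂ :=
  log (discToHalfPlane a ζ) / (2 * Real.pi * I)

lemma one_add_ne_zero_of_norm_lt_one {ζ : ℂ} (hζ : ‖ζ‖ < 1) : 1 + ζ ≠ 0 := fun h => by
  rw [eq_neg_of_add_eq_zero_right h] at hζ
  simp at hζ

lemma discToHalfPlane_im_pos {a : ℝ} (ha : 0 < Real.sin a) {ζ : ℂ} (hζ : ‖ζ‖ < 1) :
    0 < (discToHalfPlane a ζ).im := by
  have h1 : 0 < normSq (1 + ζ) := normSq_pos.2 (one_add_ne_zero_of_norm_lt_one hζ)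
  have h2 : ζ.re * ζ.re + ζ.im * ζ.im < 1 := by
    rw [← normSq_apply, normSq_eq_norm_sq]
    nlinarith [norm_nonneg ζ]
  have h3 : (discToHalfPlane a ζ).im =
      Real.sin a * ((1 - (ζ.re * ζ.re + ζ.im * ζ.im)) / normSq (1 + ζ)) := by
    simp [discToHalfPlane, div_im, -ofReal_sin, -ofReal_cos]
    field_simp
    ring_nf
    simp
  rw [h3]
  exact mul_pos ha (div_pos (by linarith) h1)

lemma differentiableAt_discToHalfPlane (a : ℝ) {ζ : ℂ} (hζ : 1 + ζ ≠ 0) :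
    DifferentiableAt ℂ (discToHalfPlane a) ζ := by
  unfold discToHalfPlane
  fun_prop (disch := assumption)

lemma differentiableAt_discToStrip {a : ℝ} (ha : 0 < Real.sin a) {ζ : ℂ} (hζ : ‖ζ‖ < 1) :
    DifferentiableAt ℂ (discToStrip a) ζ :=
  ((differentiableAt_discToHalfPlane a (one_add_ne_zero_of_norm_lt_one hζ)).clog
    (Or.inr (discToHalfPlane_im_pos ha hζ).ne')).div_const _

lemma div_two_pi_I_re (w : ℂ) : (w / (2 * Real.pi * I)).re = w.im / (2 * Real.pi) := by
  have h : w / (2 * Real.pi * I) = (-w * I) / ((2 * Real.pi : ℝ) : ℂ) := by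
    have := Real.pi_ne_zero
    push_cast
    field_simp
    simp
  rw [h, div_ofReal_re]
  simp

lemma discToStrip_re (a : ℝ) (ζ : ℂ) :
    (discToStrip a ζ).re = arg (discToHalfPlane a ζ) / (2 * Real.pi) := by
  rw [discToStrip, div_two_pi_I_re, log_im]

lemma discToStrip_mem {a : ℝ} (ha : 0 < Real.sin a) {ζ : ℂ} (hζ : ‖ζ‖ < 1) :
    0 < (discToStrip a ζ).re ∧ (discToStrip a ζ).re < 1 / 2 := by
  have him := discToHalfPlane_im_pos ha hζ
  have hpi := Real.pi_pos
  have h0 : 0 < arg (discToHalfPlane a ζ) :=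
    (arg_nonneg_iff.2 him.le).lt_of_ne' fun h => him.ne' (arg_eq_zero_iff.1 h).2
  have h1 : arg (discToHalfPlane a ζ) < Real.pi :=
    (arg_le_pi _).lt_of_ne fun h => him.ne' (arg_eq_pi_iff.1 h).2
  rw [discToStrip_re]
  refine ⟨by positivity, ?_⟩
  rw [div_lt_div_iff₀ (by positivity) (by positivity)]
  linarith

lemma discToStrip_zero {a : ℝ} (h0 : 0 < a) (h1 : a < Real.pi) :
    discToStrip a 0 = ((a / (2 * Real.pi) : ℝ) : ℂ) := by
  have h : discToHalfPlane a 0 = exp (a * I) := by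
    simp [discToHalfPlane, exp_mul_I]
  have hpi := Real.pi_ne_zero
  rw [discToStrip, h, log_exp (by simp; linarith) (by simp; linarith)]
  push_cast
  field_simp

lemma one_add_circleMap_ne_zero {s : ℝ} (hs : s ∈ Set.Ioo (-Real.pi) Real.pi) :
    1 + circleMap 0 1 s ≠ 0 := by
  have hc : 0 < Real.cos (s / 2) :=
    Real.cos_pos_of_mem_Ioo ⟨by linarith [hs.1], by linarith [hs.2]⟩
  intro h
  have h2 := congrArg re h
  simp [circleMap, exp_ofReal_mul_I_re] at h2
  have h3 := Real.cos_sq (s / 2)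
  rw [mul_div_cancel₀ s two_ne_zero] at h3
  nlinarith

lemma discToHalfPlane_circleMap (a : ℝ) {s : ℝ} (hs : s ∈ Set.Ioo (-Real.pi) Real.pi) :
    discToHalfPlane a (circleMap 0 1 s) =
      ((Real.cos a + Real.sin a * Real.tan (s / 2) : ℝ) : ℂ) := by
  have hc : 0 < Real.cos (s / 2) :=
    Real.cos_pos_of_mem_Ioo ⟨by linarith [hs.1], by linarith [hs.2]⟩
  have hc' : (Real.cos (s / 2) : ℂ) ≠ 0 := ofReal_ne_zero.2 hc.ne'
  have hne := one_add_circleMap_ne_zero hs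
  have he : circleMap 0 1 s = (Real.cos (s / 2) + Real.sin (s / 2) * I) ^ 2 := by
    rw [circleMap, zero_add, ofReal_one, one_mul, ofReal_cos, ofReal_sin, ← exp_mul_I, ← exp_nat_mul]
    push_cast
    ring_nf
  have hcs : (Real.sin (s / 2) : ℂ) ^ 2 = 1 - (Real.cos (s / 2) : ℂ) ^ 2 := by
    have := Real.sin_sq (s / 2)
    exact_mod_cast this
  have hI : I * (1 - circleMap 0 1 s) / (1 + circleMap 0 1 s) = (Real.tan (s / 2) : ℂ) := by
    rw [div_eq_iff hne, Real.tan_eq_sin_div_cos, ofReal_div, he]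
    field_simp
    generalize (Real.sin (s / 2) : ℂ) = S at *
    generalize (Real.cos (s / 2) : ℂ) = K at *
    ring_nf
    simp only [I_sq, show I ^ 3 = -I by rw [pow_succ, I_sq]; ring]
    linear_combination (S - I * K) * hcs
  rw [discToHalfPlane, hI]
  push_cast
  ring

lemma tendsto_discToStrip_circleMap {a : ℝ} (ha : 0 < Real.sin a) {s : ℝ}
    (hs : s ∈ Set.Ioo (-Real.pi) Real.pi) (hne : Real.cos a + Real.sin a * Real.tan (s / 2) ≠ 0) :
    Filter.Tendsto (fun r : ℝ => discToStrip a (circleMap 0 r s)) (nhdsWithin 1 (Set.Iio 1))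
      (nhds (discToStrip a (circleMap 0 1 s))) := by
  refine Filter.Tendsto.div_const ?_ _
  have hcirc : Filter.Tendsto (fun r : ℝ => circleMap 0 r s) (nhdsWithin 1 (Set.Iio 1))
      (nhds (circleMap 0 1 s)) := by
    refine (Continuous.tendsto ?_ 1).mono_left nhdsWithin_le_nhds
    unfold circleMap
    fun_prop
  have h1 := ((differentiableAt_discToHalfPlane a
    (one_add_circleMap_ne_zero hs)).continuousAt.tendsto.comp hcirc)
  have hlt : ∀ᶠ r : ℝ in nhdsWithin 1 (Set.Iio 1), ‖circleMap 0 r s‖ < 1 := by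
    filter_upwards [Ioo_mem_nhdsLT (show (0 : ℝ) < 1 by norm_num)] with r hr
    rw [norm_circleMap_zero, abs_of_pos hr.1]
    exact hr.2
  have h2 : Filter.Tendsto (fun r : ℝ => discToHalfPlane a (circleMap 0 r s))
      (nhdsWithin 1 (Set.Iio 1))
      (nhdsWithin (discToHalfPlane a (circleMap 0 1 s)) {z : ℂ | 0 ≤ z.im}) :=
    tendsto_nhdsWithin_iff.2 ⟨h1, hlt.mono fun r hr => (discToHalfPlane_im_pos ha hr).le⟩
  have hre : (discToHalfPlane a (circleMap 0 1 s)).re =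
      Real.cos a + Real.sin a * Real.tan (s / 2) := by
    rw [discToHalfPlane_circleMap a hs, ofReal_re]
  have him : (discToHalfPlane a (circleMap 0 1 s)).im = 0 := by
    rw [discToHalfPlane_circleMap a hs, ofReal_im]
  rcases hne.lt_or_gt with h | h
  · exact (continuousWithinAt_log_of_re_neg_of_im_zero (hre ▸ h) him).tendsto.comp h2
  · exact (continuousAt_clog (Or.inl (hre ▸ h))).tendsto.comp h1

/-- The angular coordinate on the unit circle of the boundary point of the upper half plane `x`,
under the conformal map `discToHalfPlane a`. -/
noncomputable def boundaryAngle (a x : ℝ) : ℝ :=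
  2 * Real.arctan ((x - Real.cos a) / Real.sin a)

lemma boundaryAngle_mem (a x : ℝ) : boundaryAngle a x ∈ Set.Ioo (-Real.pi) Real.pi := by
  have h1 := Real.neg_pi_div_two_lt_arctan ((x - Real.cos a) / Real.sin a)
  have h2 := Real.arctan_lt_pi_div_two ((x - Real.cos a) / Real.sin a)
  constructor <;> unfold boundaryAngle <;> linarith

lemma cos_add_sin_mul_tan_boundaryAngle {a : ℝ} (ha : 0 < Real.sin a) (x : ℝ) :
    Real.cos a + Real.sin a * Real.tan (boundaryAngle a x / 2) = x := by
  rw [boundaryAngle, mul_div_cancel_left₀ _ two_ne_zero, Real.tan_arctan]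
  field_simp
  ring

lemma boundaryAngle_cos_add_sin_mul_tan {a : ℝ} (ha : 0 < Real.sin a) {s : ℝ}
    (hs : s ∈ Set.Ioo (-Real.pi) Real.pi) :
    boundaryAngle a (Real.cos a + Real.sin a * Real.tan (s / 2)) = s := by
  rw [boundaryAngle, add_sub_cancel_left, mul_div_cancel_left₀ _ ha.ne',
    Real.arctan_tan (by linarith [hs.1]) (by linarith [hs.2])]
  ring

lemma discToStrip_boundaryAngle_exp {a : ℝ} (ha : 0 < Real.sin a) (t : ℝ) :
    discToStrip a (circleMap 0 1 (boundaryAngle a (Real.exp (-(2 * Real.pi * t))))) = t * I := by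
  rw [discToStrip, discToHalfPlane_circleMap a (boundaryAngle_mem a _),
    cos_add_sin_mul_tan_boundaryAngle ha, ← ofReal_log (Real.exp_pos _).le, Real.log_exp]
  have := Real.pi_ne_zero
  push_cast
  field_simp
  simp

lemma discToStrip_boundaryAngle_neg_exp {a : ℝ} (ha : 0 < Real.sin a) (t : ℝ) :
    discToStrip a (circleMap 0 1 (boundaryAngle a (-Real.exp (-(2 * Real.pi * t))))) =
      1 / 2 + t * I := by
  have hlog : log ((-Real.exp (-(2 * Real.pi * t)) : ℝ) : ℂ) =
      ((-(2 * Real.pi * t) : ℝ) : ℂ) + Real.pi * I := by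
    apply Complex.ext
    · rw [log_re, norm_real]
      simp
    · rw [log_im, arg_ofReal_of_neg (neg_neg_of_pos (Real.exp_pos _))]
      simp
  rw [discToStrip, discToHalfPlane_circleMap a (boundaryAngle_mem a _),
    cos_add_sin_mul_tan_boundaryAngle ha, hlog]
  have := Real.pi_ne_zero
  push_cast
  field_simp
  ring_nf
  simp

lemma boundaryAngle_injective {a : ℝ} (ha : 0 < Real.sin a) :
    Function.Injective (boundaryAngle a) := fun x y h => by
  rw [← cos_add_sin_mul_tan_boundaryAngle ha x, h, cos_add_sin_mul_tan_boundaryAngle ha y]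

lemma hasDerivAt_boundaryAngle {a : ℝ} (ha : 0 < Real.sin a) (x : ℝ) :
    HasDerivAt (boundaryAngle a) (2 * Real.sin a / (x ^ 2 - 2 * x * Real.cos a + 1)) x := by
  have h := ((((hasDerivAt_id x).sub_const (Real.cos a)).div_const (Real.sin a)).arctan).const_mul 2
  refine h.congr_deriv ?_
  have hD : 0 < x ^ 2 - 2 * x * Real.cos a + 1 := by
    nlinarith [Real.sin_sq_add_cos_sq a, sq_nonneg (x - Real.cos a)]
  have hD' : Real.sin a ^ 2 + (x - Real.cos a) ^ 2 = x ^ 2 - 2 * x * Real.cos a + 1 := by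
    linear_combination Real.sin_sq_add_cos_sq a
  have e : 1 + ((x - Real.cos a) / Real.sin a) ^ 2 =
      (x ^ 2 - 2 * x * Real.cos a + 1) / Real.sin a ^ 2 := by
    rw [← hD']
    field_simp
  simp only [id]
  rw [e]
  field_simp

lemma abs_deriv_boundaryAngle_exp {a : ℝ} (ha : 0 < Real.sin a) (t σ : ℝ) (hσ : σ ^ 2 = 1) :
    |2 * Real.sin a / ((σ * Real.exp (-(2 * Real.pi * t))) ^ 2 -
      2 * (σ * Real.exp (-(2 * Real.pi * t))) * Real.cos a + 1) *
      (σ * (Real.exp (-(2 * Real.pi * t)) * -(2 * Real.pi)))| =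
    2 * Real.pi * (Real.sin a / (Real.cosh (2 * Real.pi * t) - σ * Real.cos a)) := by
  have hpi := Real.pi_pos
  set E := Real.exp (-(2 * Real.pi * t)) with hE
  have hEpos : 0 < E := Real.exp_pos _
  have hch : Real.cosh (2 * Real.pi * t) = (E⁻¹ + E) / 2 := by
    rw [Real.cosh_eq, hE, Real.exp_neg, inv_inv]
  have hden : 0 < (σ * E) ^ 2 - 2 * (σ * E) * Real.cos a + 1 := by
    nlinarith [Real.sin_sq_add_cos_sq a, sq_nonneg (σ * E - Real.cos a), sq_pos_of_pos ha]
  have hcosh : Real.cosh (2 * Real.pi * t) - σ * Real.cos a =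
      ((σ * E) ^ 2 - 2 * (σ * E) * Real.cos a + 1) / (2 * E) := by
    rw [hch, mul_pow, hσ]
    field_simp
    ring
  have habs : |σ| = 1 := by
    rcases mul_self_eq_one_iff.1 (sq σ ▸ hσ) with h | h <;> simp [h]
  rw [hcosh, abs_mul, abs_mul, abs_mul, habs, abs_of_pos (div_pos (by positivity) hden),
    abs_of_pos hEpos, abs_neg, abs_of_pos (by positivity : 0 < 2 * Real.pi)]
  field_simp

/-- Change of variables from one of the boundary lines of the strip to the arc of the unit circle
that corresponds to it under `discToStrip a`; the sign `σ` selects the line. -/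
lemma lintegral_image_boundaryAngle {a : ℝ} (ha : 0 < Real.sin a) {σ : ℝ} (hσ : σ ^ 2 = 1)
    (G : ℝ → ℝ≥0∞) :
    ∫⁻ s in Set.range (fun t => boundaryAngle a (σ * Real.exp (-(2 * Real.pi * t)))), G s =
      ∫⁻ t, ENNReal.ofReal (2 * Real.pi) *
        (ENNReal.ofReal (Real.sin a / (Real.cosh (2 * Real.pi * t) - σ * Real.cos a)) *
          G (boundaryAngle a (σ * Real.exp (-(2 * Real.pi * t))))) := by
  have hσ0 : σ ≠ 0 := by rintro rfl; norm_num at hσ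
  have hinj : Function.Injective fun t => boundaryAngle a (σ * Real.exp (-(2 * Real.pi * t))) :=
    (boundaryAngle_injective ha).comp fun t u h => by
      have := Real.exp_injective (mul_left_cancel₀ hσ0 h)
      have hpi := Real.pi_pos
      nlinarith
  have hder : ∀ t ∈ (Set.univ : Set ℝ), HasDerivWithinAt
      (fun t => boundaryAngle a (σ * Real.exp (-(2 * Real.pi * t)))) _ Set.univ t := fun t _ =>
    ((hasDerivAt_boundaryAngle ha _).comp t
      ((((hasDerivAt_id t).const_mul (2 * Real.pi)).neg.exp).const_mul σ)).hasDerivWithinAt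
  rw [← Set.image_univ, lintegral_image_eq_lintegral_abs_deriv_mul MeasurableSet.univ hder
    hinj.injOn, Measure.restrict_univ]
  refine lintegral_congr fun t => ?_
  rw [← mul_assoc (ENNReal.ofReal (2 * Real.pi)), ← ENNReal.ofReal_mul (by positivity),
    ← abs_deriv_boundaryAngle_exp ha t σ hσ]
  simp

/-- The circle integral as an integral over the two boundary lines of the strip. -/
lemma lintegral_Ioo_eq_add_lintegral {a : ℝ} (ha : 0 < Real.sin a) (G : ℝ → ℝ≥0∞) :
    ∫⁻ s in Set.Ioo (-Real.pi) Real.pi, G s = ENNReal.ofReal (2 * Real.pi) *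
      ((∫⁻ t, ENNReal.ofReal (Real.sin a / (Real.cosh (2 * Real.pi * t) + Real.cos a)) *
          G (boundaryAngle a (-Real.exp (-(2 * Real.pi * t))))) +
       ∫⁻ t, ENNReal.ofReal (Real.sin a / (Real.cosh (2 * Real.pi * t) - Real.cos a)) *
          G (boundaryAngle a (Real.exp (-(2 * Real.pi * t))))) := by
  have hpi := Real.pi_pos
  set q : ℝ → ℝ := fun s => Real.cos a + Real.sin a * Real.tan (s / 2) with hq
  have hrange : ∀ σ : ℝ, σ ^ 2 = 1 →
      Set.range (fun t => boundaryAngle a (σ * Real.exp (-(2 * Real.pi * t)))) =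
        {s ∈ Set.Ioo (-Real.pi) Real.pi | 0 < σ * q s} := by
    intro σ hσ
    ext s
    constructor
    · rintro ⟨t, rfl⟩
      refine ⟨boundaryAngle_mem _ _, ?_⟩
      simp only [hq]
      rw [cos_add_sin_mul_tan_boundaryAngle ha, ← mul_assoc, ← sq, hσ, one_mul]
      exact Real.exp_pos _
    · rintro ⟨hs, hpos⟩
      refine ⟨-(Real.log (σ * q s) / (2 * Real.pi)), ?_⟩
      have h : -(2 * Real.pi * -(Real.log (σ * q s) / (2 * Real.pi))) = Real.log (σ * q s) := by
        field_simp
      simp only [h, Real.exp_log hpos]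
      rw [← mul_assoc, ← sq, hσ, one_mul]
      exact boundaryAngle_cos_add_sin_mul_tan ha hs
  have hmeas : Measurable q := by
    have : Measurable Real.tan := by
      simp_rw [funext Real.tan_eq_sin_div_cos]
      exact Real.measurable_sin.div Real.measurable_cos
    fun_prop
  have hms : ∀ σ : ℝ, MeasurableSet {s ∈ Set.Ioo (-Real.pi) Real.pi | 0 < σ * q s} := fun σ =>
    measurableSet_Ioo.inter (measurableSet_lt measurable_const (hmeas.const_mul σ))
  have hae : Set.Ioo (-Real.pi) Real.pi =ᵐ[volume]
      ({s ∈ Set.Ioo (-Real.pi) Real.pi | 0 < (-1) * q s} ∪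
        {s ∈ Set.Ioo (-Real.pi) Real.pi | 0 < 1 * q s} : Set ℝ) := by
    have h : ∀ᵐ s : ℝ, s ≠ boundaryAngle a 0 := by simp [ae_iff]
    refine Filter.eventuallyEq_set.2 (h.mono fun s hs => ?_)
    simp only [Set.mem_union, Set.mem_ofPred_eq, ← and_or_left, neg_one_mul, one_mul, neg_pos,
      iff_self_and]
    intro hsI
    refine lt_or_gt_of_ne fun h0 => hs ?_
    rw [← h0]
    exact (boundaryAngle_cos_add_sin_mul_tan ha hsI).symm
  rw [setLIntegral_congr hae, lintegral_union (hms 1), ← hrange (-1) (by norm_num),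
    ← hrange 1 (by norm_num), lintegral_image_boundaryAngle ha (by norm_num),
    lintegral_image_boundaryAngle ha (by norm_num), mul_add,
    lintegral_const_mul' _ _ ENNReal.ofReal_ne_top, lintegral_const_mul' _ _ ENNReal.ofReal_ne_top]
  · simp only [neg_one_mul, one_mul, sub_neg_eq_add]
  · rw [Set.disjoint_left]
    rintro s ⟨-, h1⟩ ⟨-, h2⟩
    linarith

lemma lintegral_kernel_add_lintegral_kernel {a : ℝ} (ha : 0 < Real.sin a) :
    (∫⁻ t, ENNReal.ofReal (Real.sin a / (Real.cosh (2 * Real.pi * t) + Real.cos a))) +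
      ∫⁻ t, ENNReal.ofReal (Real.sin a / (Real.cosh (2 * Real.pi * t) - Real.cos a)) = 1 := by
  have h := lintegral_Ioo_eq_add_lintegral ha 1
  have hpi := Real.pi_pos
  simp only [Pi.one_apply, mul_one, lintegral_one, Measure.restrict_apply_univ,
    Real.volume_Ioo] at h
  rw [show Real.pi - -Real.pi = 2 * Real.pi by ring] at h
  refine (ENNReal.mul_right_inj (a := ENNReal.ofReal (2 * Real.pi)) ?_
    ENNReal.ofReal_ne_top).1 ?_
  · simpa using hpi
  · rw [← h, mul_one]

/-- Super-mean value property of `-log ‖G‖` on the strip `0 < Re z < 1 / 2`. -/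
lemma lintegral_negLog_norm_strip_le {G : ℂ → ℂ}
    (hd : DifferentiableOn ℂ G {z : ℂ | 0 < z.re ∧ z.re < 1 / 2})
    (hc : ContinuousOn G {z : ℂ | 0 ≤ z.re ∧ z.re ≤ 1 / 2})
    (hle : ∀ z : ℂ, 0 ≤ z.re → z.re ≤ 1 / 2 → ‖G z‖ ≤ 1)
    {a : ℝ} (h0 : 0 < a) (h1 : a < Real.pi) :
    (∫⁻ t : ℝ, ENNReal.ofReal (Real.sin a / (Real.cosh (2 * Real.pi * t) + Real.cos a)) *
        negLog ‖G (1 / 2 + t * I)‖) +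
      (∫⁻ t : ℝ, ENNReal.ofReal (Real.sin a / (Real.cosh (2 * Real.pi * t) - Real.cos a)) *
        negLog ‖G (t * I)‖) ≤
      negLog ‖G ((a / (2 * Real.pi) : ℝ) : ℂ)‖ := by
  have ha : 0 < Real.sin a := Real.sin_pos_of_pos_of_lt_pi h0 h1
  have hpi := Real.pi_pos
  have hopen : IsOpen {z : ℂ | 0 < z.re ∧ z.re < 1 / 2} :=
    (isOpen_lt continuous_const continuous_re).inter (isOpen_lt continuous_re continuous_const)
  have hball : ∀ z ∈ Metric.ball (0 : ℂ) 1, ‖z‖ < 1 := fun z hz => by simpa using hz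
  have hclosed : ∀ ζ : ℂ, 0 ≤ (discToHalfPlane a ζ).im →
      0 ≤ (discToStrip a ζ).re ∧ (discToStrip a ζ).re ≤ 1 / 2 := fun ζ hζ => by
    rw [discToStrip_re]
    refine ⟨div_nonneg (arg_nonneg_iff.2 hζ) (by positivity), ?_⟩
    rw [div_le_div_iff₀ (by positivity) (by positivity)]
    linarith [arg_le_pi (discToHalfPlane a ζ)]
  have key := lintegral_negLog_norm_unit_circle_le (F := fun ζ => G (discToStrip a ζ))
    (fun z hz => (((hd.differentiableAt (hopen.mem_nhds (discToStrip_mem ha (hball z hz)))).comp z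
      (differentiableAt_discToStrip ha (hball z hz)))).differentiableWithinAt)
    (fun z hz => hle _ (discToStrip_mem ha (hball z hz)).1.le
      (discToStrip_mem ha (hball z hz)).2.le) ?_
  · simp only [discToStrip_zero h0 h1] at key
    rw [lintegral_Ioo_eq_add_lintegral ha] at key
    simp only [discToStrip_boundaryAngle_exp ha, discToStrip_boundaryAngle_neg_exp ha] at key
    exact (ENNReal.mul_le_mul_iff_right (by simpa using hpi) ENNReal.ofReal_ne_top).1 key
  · have h : ∀ᵐ s : ℝ, s ≠ boundaryAngle a 0 := by simp [ae_iff]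
    filter_upwards [ae_restrict_mem measurableSet_Ioo, ae_restrict_of_ae h] with s hs hs0
    have hq : Real.cos a + Real.sin a * Real.tan (s / 2) ≠ 0 := fun hq => hs0 <| by
      rw [← hq, boundaryAngle_cos_add_sin_mul_tan ha hs]
    have hmem := hclosed (circleMap 0 1 s) (by
      rw [discToHalfPlane_circleMap a hs, ofReal_im])
    refine (hc _ hmem).tendsto.comp (tendsto_nhdsWithin_iff.2
      ⟨tendsto_discToStrip_circleMap ha hs hq, ?_⟩)
    filter_upwards [Ioo_mem_nhdsLT (show (0 : ℝ) < 1 by norm_num)] with r hr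
    have hr1 : ‖circleMap 0 r s‖ < 1 := by
      rw [norm_circleMap_zero, abs_of_pos hr.1]
      exact hr.2
    exact hclosed _ (discToHalfPlane_im_pos ha hr1).le

lemma erealIntegral_coe_sub_coe {α : Type*} [MeasurableSpace α] {μ : Measure α} {c N : α → ℝ≥0∞}
    (hc : Measurable c) (hN : Measurable N) (hct : ∀ x, c x ≠ ⊤) (hci : ∫⁻ x, c x ∂μ ≠ ⊤) :
    erealIntegral μ (fun x => (c x : EReal) - (N x : EReal)) =
      ((∫⁻ x, c x ∂μ : ℝ≥0∞) : EReal) - ((∫⁻ x, N x ∂μ : ℝ≥0∞) : EReal) := by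
  have hpos : ∀ x, erealPosPart ((c x : EReal) - (N x : EReal)) = c x - N x := fun x => by
    have h := EReal.toENNReal_sub (x := (c x : EReal)) (EReal.coe_ennreal_nonneg (N x))
    rw [EReal.toENNReal_coe, EReal.toENNReal_coe] at h
    exact h
  have hneg : ∀ x, erealPosPart (-((c x : EReal) - (N x : EReal))) = N x - c x := fun x => by
    have h := EReal.toENNReal_sub (x := (N x : EReal)) (EReal.coe_ennreal_nonneg (c x))
    rw [EReal.toENNReal_coe, EReal.toENNReal_coe] at h
    rw [EReal.neg_sub (Or.inl (EReal.coe_ennreal_ne_bot _)) (Or.inl (by simpa using hct x)),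
      add_comm, ← sub_eq_add_neg]
    exact h
  have hsum : (∫⁻ x, (c x - N x) ∂μ) + ∫⁻ x, N x ∂μ =
      (∫⁻ x, c x ∂μ) + ∫⁻ x, (N x - c x) ∂μ := by
    rw [← lintegral_add_right _ hN, ← lintegral_add_left hc]
    refine lintegral_congr fun x => ?_
    rw [tsub_add_eq_max, add_tsub_eq_max]
  have hP : ∫⁻ x, (c x - N x) ∂μ ≠ ⊤ :=
    ne_top_of_le_ne_top hci (lintegral_mono fun x => tsub_le_self)
  simp only [erealIntegral, hpos, hneg]
  generalize (∫⁻ x, (c x - N x) ∂μ) = P at *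
  generalize (∫⁻ x, (N x - c x) ∂μ) = Q at *
  generalize (∫⁻ x, c x ∂μ) = A at *
  generalize (∫⁻ x, N x ∂μ) = B at *
  lift P to ℝ≥0 using hP
  lift A to ℝ≥0 using hci
  induction B with
  | top =>
    have hQ : Q = ⊤ := by simpa using hsum.symm
    simp [hQ]
  | coe B =>
    have hQ : Q ≠ ⊤ := by
      rintro rfl
      simp at hsum
    lift Q to ℝ≥0 using hQ
    have h : (P : ℝ) + B = A + Q := by exact_mod_cast hsum
    have h' : (P : ℝ) - Q = A - B := by linarith
    simp only [EReal.coe_nnreal_eq_coe_real]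
    exact_mod_cast h'

lemma coe_mul_elog {k C x : ℝ} (hk : 0 < k) (hC : 1 ≤ C) (hx : 0 ≤ x) (hxC : x ≤ C) :
    (k : EReal) * elog x = ((ENNReal.ofReal k * ENNReal.ofReal (Real.log C) : ℝ≥0∞) : EReal) -
      ((ENNReal.ofReal k * negLog (x / C) : ℝ≥0∞) : EReal) := by
  have hC0 : 0 < C := one_pos.trans_le hC
  have hlog : 0 ≤ Real.log C := Real.log_nonneg hC
  rw [← ENNReal.ofReal_mul hk.le]
  rcases hx.eq_or_lt with rfl | hx
  · rw [zero_div, negLog_zero, ENNReal.mul_top (by simpa using hk)]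
    simp [elog, EReal.coe_mul_bot_of_pos hk]
  · have hxC' : Real.log x ≤ Real.log C := Real.log_le_log hx hxC
    rw [negLog_of_pos (div_pos hx hC0), Real.log_div hx.ne' hC0.ne', ← ENNReal.ofReal_mul hk.le,
      elog, ENNReal.log_ofReal_of_pos hx, EReal.coe_ennreal_ofReal, EReal.coe_ennreal_ofReal,
      max_eq_left (mul_nonneg hk.le hlog), max_eq_left (mul_nonneg hk.le (by linarith)),
      ← EReal.coe_mul, ← EReal.coe_sub]
    congr 1
    ring

lemma coe_sub_coe_add_coe_sub_coe {a b c d : ℝ≥0∞} (ha : a ≠ ⊤) (hc : c ≠ ⊤) :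
    ((a : EReal) - (b : EReal)) + ((c : EReal) - (d : EReal)) =
      ((a + c : ℝ≥0∞) : EReal) - ((b + d : ℝ≥0∞) : EReal) := by
  lift a to ℝ≥0 using ha
  lift c to ℝ≥0 using hc
  induction b with
  | top => simp
  | coe b =>
    induction d with
    | top => simp
    | coe d =>
      simp only [← ENNReal.coe_add, EReal.coe_nnreal_eq_coe_real]
      norm_cast
      push_cast
      ring

/-- **Hirschman's improvement of the Hadamard three-lines theorem.**
If `g` is holomorphic on the open strip `{0 < Re z < 1/2}`, continuous and uniformly
bounded on the closed strip, then for `θ ∈ (0, 1/2)`,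
`log |g(θ)| ≤ ∫ (2θ β_θ(t) log|g(1/2+it)| + (1−2θ) α_θ(t) log|g(it)|) dt`. -/
theorem hirschman_three_lines (g : ℂ → ℂ)
    (hd : DifferentiableOn ℂ g {z : ℂ | 0 < z.re ∧ z.re < 1 / 2})
    (hc : ContinuousOn g {z : ℂ | 0 ≤ z.re ∧ z.re ≤ 1 / 2})
    (hb : ∃ C : ℝ, ∀ z : ℂ, 0 ≤ z.re → z.re ≤ 1 / 2 → ‖g z‖ ≤ C)
    (θ : ℝ) (hθ0 : 0 < θ) (hθ1 : θ < 1 / 2) :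
    elog ‖g (θ : ℂ)‖ ≤ erealIntegral volume (fun t : ℝ =>
      ((2 * θ * betaD θ t : ℝ) : EReal) * elog ‖g (1 / 2 + t * Complex.I)‖ +
      (((1 - 2 * θ) * alphaD θ t : ℝ) : EReal) * elog ‖g (t * Complex.I)‖) := by
  obtain ⟨C₀, hC₀⟩ := hb
  set C := max C₀ 1 with hC
  have hC1 : 1 ≤ C := le_max_right _ _
  have hCpos : 0 < C := one_pos.trans_le hC1
  have hbC : ∀ z : ℂ, 0 ≤ z.re → z.re ≤ 1 / 2 → ‖g z‖ ≤ C := fun z h0 h1 =>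
    (hC₀ z h0 h1).trans (le_max_left _ _)
  have hpi := Real.pi_pos
  set a := 2 * Real.pi * θ with ha_def
  have ha0 : 0 < a := by positivity
  have ha1 : a < Real.pi := by rw [ha_def]; nlinarith
  have ha : 0 < Real.sin a := Real.sin_pos_of_pos_of_lt_pi ha0 ha1
  have hcos : |Real.cos a| < 1 := by
    rw [← sq_lt_one_iff_abs_lt_one]
    nlinarith [Real.sin_sq_add_cos_sq a]
  rw [abs_lt] at hcos
  have hden : ∀ t : ℝ, 0 < Real.cosh (2 * Real.pi * t) + Real.cos a ∧
      0 < Real.cosh (2 * Real.pi * t) - Real.cos a := fun t => by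
    have := Real.one_le_cosh (2 * Real.pi * t)
    constructor <;> linarith
  set kβ : ℝ → ℝ := fun t => Real.sin a / (Real.cosh (2 * Real.pi * t) + Real.cos a) with hkβ
  set kα : ℝ → ℝ := fun t => Real.sin a / (Real.cosh (2 * Real.pi * t) - Real.cos a) with hkα
  have hβ : ∀ t, 2 * θ * betaD θ t = kβ t := fun t => by
    have := (hden t).1.ne'
    simp only [betaD, hkβ, ← ha_def]
    field_simp
  have hα : ∀ t, (1 - 2 * θ) * alphaD θ t = kα t := fun t => by
    have := (hden t).2.ne'
    have h2 : 1 - 2 * θ ≠ 0 := by linarith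
    simp only [alphaD, hkα, ← ha_def]
    field_simp
  have hkβpos : ∀ t, 0 < kβ t := fun t => div_pos ha (hden t).1
  have hkαpos : ∀ t, 0 < kα t := fun t => div_pos ha (hden t).2
  have hkβm : Measurable kβ := by fun_prop
  have hkαm : Measurable kα := by fun_prop
  have hnorm : ∀ z, ‖g z / C‖ = ‖g z‖ / C := fun z => by
    rw [norm_div, norm_real, Real.norm_of_nonneg hCpos.le]
  have hmain := lintegral_negLog_norm_strip_le (G := fun z => g z / C) (hd.div_const _)
    (hc.div_const _) (fun z h0 h1 => by
      rw [hnorm]; exact (div_le_one hCpos).2 (hbC z h0 h1)) ha0 ha1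
  rw [show a / (2 * Real.pi) = θ by rw [ha_def]; field_simp] at hmain
  simp only [hnorm] at hmain
  have hline₀ : ∀ t : ℝ, 0 ≤ ((t : ℂ) * I).re ∧ ((t : ℂ) * I).re ≤ 1 / 2 := fun t => by simp
  have hline₁ : ∀ t : ℝ, 0 ≤ (1 / 2 + (t : ℂ) * I).re ∧ (1 / 2 + (t : ℂ) * I).re ≤ 1 / 2 :=
    fun t => by simp
  have hm₀ : Measurable fun t : ℝ => negLog (‖g (t * I)‖ / C) :=
    (continuous_negLog.comp ((hc.comp_continuous (by fun_prop) hline₀).norm.div_const C)).measurable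
  have hm₁ : Measurable fun t : ℝ => negLog (‖g (1 / 2 + t * I)‖ / C) :=
    (continuous_negLog.comp ((hc.comp_continuous (by fun_prop) hline₁).norm.div_const C)).measurable
  have hmass : ∫⁻ t, (ENNReal.ofReal (kβ t) * ENNReal.ofReal (Real.log C) +
      ENNReal.ofReal (kα t) * ENNReal.ofReal (Real.log C)) = ENNReal.ofReal (Real.log C) := by
    simp_rw [← add_mul]
    rw [lintegral_mul_const' _ _ ENNReal.ofReal_ne_top, lintegral_add_left (by fun_prop),
      lintegral_kernel_add_lintegral_kernel ha, one_mul]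
  have hsplit : ∀ t : ℝ, ((2 * θ * betaD θ t : ℝ) : EReal) * elog ‖g (1 / 2 + t * I)‖ +
      (((1 - 2 * θ) * alphaD θ t : ℝ) : EReal) * elog ‖g (t * I)‖ =
      ((ENNReal.ofReal (kβ t) * ENNReal.ofReal (Real.log C) +
        ENNReal.ofReal (kα t) * ENNReal.ofReal (Real.log C) : ℝ≥0∞) : EReal) -
      ((ENNReal.ofReal (kβ t) * negLog (‖g (1 / 2 + t * I)‖ / C) +
        ENNReal.ofReal (kα t) * negLog (‖g (t * I)‖ / C) : ℝ≥0∞) : EReal) := fun t => by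
    rw [hβ, hα, coe_mul_elog (hkβpos t) hC1 (norm_nonneg _) (hbC _ (hline₁ t).1 (hline₁ t).2),
      coe_mul_elog (hkαpos t) hC1 (norm_nonneg _) (hbC _ (hline₀ t).1 (hline₀ t).2)]
    exact coe_sub_coe_add_coe_sub_coe (ENNReal.mul_ne_top ENNReal.ofReal_ne_top
      ENNReal.ofReal_ne_top) (ENNReal.mul_ne_top ENNReal.ofReal_ne_top ENNReal.ofReal_ne_top)
  have hθ := coe_mul_elog one_pos hC1 (norm_nonneg (g θ))
    (hbC θ (by simpa using hθ0.le) (by simpa using hθ1.le))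
  simp only [EReal.coe_one, one_mul, ENNReal.ofReal_one] at hθ
  simp_rw [hsplit]
  rw [erealIntegral_coe_sub_coe (by fun_prop) (by fun_prop) (fun t => by finiteness)
    (by rw [hmass]; exact ENNReal.ofReal_ne_top), hmass, hθ,
    lintegral_add_left (by fun_prop)]
  exact EReal.sub_le_sub le_rfl (EReal.coe_ennreal_le_coe_ennreal_iff.2 hmain)
end

section
/- Let A and B be positive semidefinite n×n complex matrices, let r ∈ (0,1] and p ≥ 2. Then Tr |A^r B^r|^{p/r} ≤ Tr |A B|^p. -/
/-!
STATEMENT 4: The Araki–Lieb–Thirring inequality for positive semidefinite matrices: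
for r ∈ (0,1] and p ≥ 2, Tr |A^r B^r|^{p/r} ≤ Tr |A B|^p.
-/

open Matrix Complex
open scoped ComplexOrder

/-- Complex power `A^z` of a Hermitian matrix `A`, via the spectral functional
calculus (junk value `0` if `A` is not Hermitian); for eigenvalue `0` and `Re z > 0`
this uses `(0 : ℂ) ^ z = 0`. -/
noncomputable def mcpow {n : ℕ} (A : Matrix (Fin n) (Fin n) ℂ) (z : ℂ) :
    Matrix (Fin n) (Fin n) ℂ :=
  if hA : A.IsHermitian then
    (hA.eigenvectorUnitary : Matrix (Fin n) (Fin n) ℂ) *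
      Matrix.diagonal (fun i => (hA.eigenvalues i : ℂ) ^ z) *
      (hA.eigenvectorUnitary : Matrix (Fin n) (Fin n) ℂ)ᴴ
  else 0

/-- `Tr |M|^q`, where `|M| = (M* M)^{1/2}`; computed as `Tr ((M* M)^{q/2})`. -/
noncomputable def trAbsPow {n : ℕ} (M : Matrix (Fin n) (Fin n) ℂ) (q : ℝ) : ℝ :=
  ((mcpow (Mᴴ * M) ((q / 2 : ℝ) : ℂ)).trace).re

/-- Hölder's inequality for sums weighted by a doubly substochastic matrix. -/
lemma sum_mul_mul_le_of_substochastic {n : Type*} [Fintype n] {w : n → n → ℝ} (hw : ∀ i j, 0 ≤ w i j)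
    (hrow : ∀ i, ∑ j, w i j ≤ 1) (hcol : ∀ j, ∑ i, w i j ≤ 1) {p q : ℝ}
    (hpq : p.HolderConjugate q) {x y : n → ℝ} (hx : ∀ j, 0 ≤ x j) (hy : ∀ i, 0 ≤ y i) :
    ∑ i, ∑ j, w i j * (x j * y i) ≤
      (∑ j, x j ^ p) ^ (1 / p) * (∑ i, y i ^ q) ^ (1 / q) := by
  have hp := hpq.pos
  have hq := hpq.symm.pos
  have key := Real.inner_le_Lp_mul_Lq_of_nonneg (s := (Finset.univ : Finset (n × n)))
    (f := fun k => w k.1 k.2 ^ (1 / p) * x k.2) (g := fun k => w k.1 k.2 ^ (1 / q) * y k.1) hpq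
    (fun k _ => mul_nonneg (Real.rpow_nonneg (hw _ _) _) (hx _))
    (fun k _ => mul_nonneg (Real.rpow_nonneg (hw _ _) _) (hy _))
  have hroot : ∀ (i j : n) {s c : ℝ}, 0 < s → 0 ≤ c →
      (w i j ^ (1 / s) * c) ^ s = w i j * c ^ s := by
    intro i j s c hs hc
    rw [Real.mul_rpow (Real.rpow_nonneg (hw i j) _) hc, ← Real.rpow_mul (hw i j),
      one_div_mul_cancel hs.ne', Real.rpow_one]
  simp only [hroot _ _ hp (hx _), hroot _ _ hq (hy _)] at key
  have hl : ∑ k : n × n, w k.1 k.2 ^ (1 / p) * x k.2 * (w k.1 k.2 ^ (1 / q) * y k.1) =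
      ∑ i, ∑ j, w i j * (x j * y i) := by
    rw [Fintype.sum_prod_type]
    refine Finset.sum_congr rfl fun i _ => Finset.sum_congr rfl fun j _ => ?_
    have : w i j ^ (1 / p) * w i j ^ (1 / q) = w i j := by
      have h1 : 1 / p + 1 / q = 1 := by simpa using hpq.inv_add_inv_eq_one
      rw [← Real.rpow_add' (hw i j) (by rw [h1]; exact one_ne_zero), h1, Real.rpow_one]
    linear_combination (x j * y i) * this
  rw [hl] at key
  refine key.trans ?_
  have hxp : ∀ j, 0 ≤ x j ^ p := fun j => Real.rpow_nonneg (hx j) p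
  have hyq : ∀ j, 0 ≤ y j ^ q := fun j => Real.rpow_nonneg (hy j) q
  gcongr
  · exact Real.rpow_nonneg (Finset.sum_nonneg fun k _ => mul_nonneg (hw _ _) (hyq _)) _
  · exact Real.rpow_nonneg (Finset.sum_nonneg fun j _ => hxp j) _
  · exact Finset.sum_nonneg fun k _ => mul_nonneg (hw _ _) (hxp _)
  · rw [Fintype.sum_prod_type_right]
    refine Finset.sum_le_sum fun j _ => ?_
    simp only [← Finset.sum_mul]
    exact mul_le_of_le_one_left (hxp j) (hcol j)
  · exact Finset.sum_nonneg fun k _ => mul_nonneg (hw _ _) (hyq _)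
  · rw [Fintype.sum_prod_type]
    refine Finset.sum_le_sum fun i _ => ?_
    simp only [← Finset.sum_mul]
    exact mul_le_of_le_one_left (hyq i) (hrow i)

section SpectralMap

open scoped Matrix.Norms.L2Operator

variable {n : Type*} [Fintype n] [DecidableEq n]

/-- The functional calculus of a Hermitian matrix, for complex-valued functions. -/
noncomputable def spectralMap {A : Matrix n n ℂ} (hA : A.IsHermitian) (f : ℝ → ℂ) :
    Matrix n n ℂ :=
  (hA.eigenvectorUnitary : Matrix n n ℂ) * diagonal (fun i => f (hA.eigenvalues i)) *
    (hA.eigenvectorUnitary : Matrix n n ℂ)ᴴ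

lemma unitary_conjTranspose_mul_self (U : unitaryGroup n ℂ) :
    (U : Matrix n n ℂ)ᴴ * (U : Matrix n n ℂ) = 1 := by
  rw [← star_eq_conjTranspose]; exact Unitary.coe_star_mul_self U

lemma unitary_mul_conjTranspose_self (U : unitaryGroup n ℂ) :
    (U : Matrix n n ℂ) * (U : Matrix n n ℂ)ᴴ = 1 := by
  rw [← star_eq_conjTranspose]; exact Unitary.coe_mul_star_self U

lemma norm_conjTranspose_mul_mul_unitary (U V : unitaryGroup n ℂ) (M : Matrix n n ℂ) :
    ‖(U : Matrix n n ℂ)ᴴ * M * (V : Matrix n n ℂ)‖ = ‖M‖ := by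
  rw [← star_eq_conjTranspose, CStarRing.norm_mul_coe_unitary, ← Unitary.coe_star,
    CStarRing.norm_coe_unitary_mul]

lemma spectralMap_mul {A : Matrix n n ℂ} (hA : A.IsHermitian) (f g : ℝ → ℂ) :
    spectralMap hA f * spectralMap hA g = spectralMap hA (fun x => f x * g x) := by
  have h := unitary_conjTranspose_mul_self hA.eigenvectorUnitary
  simp only [spectralMap]
  rw [← diagonal_mul_diagonal]
  simp only [Matrix.mul_assoc]
  rw [← Matrix.mul_assoc (_ᴴ) (hA.eigenvectorUnitary : Matrix n n ℂ), h, Matrix.one_mul]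

lemma spectralMap_congr {A : Matrix n n ℂ} (hA : A.IsHermitian) {f g : ℝ → ℂ}
    (h : ∀ i, f (hA.eigenvalues i) = g (hA.eigenvalues i)) :
    spectralMap hA f = spectralMap hA g := by
  simp only [spectralMap, h]

lemma spectralMap_ofReal {A : Matrix n n ℂ} (hA : A.IsHermitian) :
    spectralMap hA (fun x => (x : ℂ)) = A := by
  conv_rhs => rw [hA.spectral_theorem]
  simp [spectralMap, Unitary.conjStarAlgAut_apply, star_eq_conjTranspose, Function.comp_def]

lemma spectralMap_mul_self {A : Matrix n n ℂ} (hA : A.IsHermitian) (f : ℝ → ℂ) :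
    spectralMap hA f * A = spectralMap hA (fun x => f x * x) := by
  rw [← spectralMap_mul, spectralMap_ofReal]

lemma self_mul_spectralMap {A : Matrix n n ℂ} (hA : A.IsHermitian) (f : ℝ → ℂ) :
    A * spectralMap hA f = spectralMap hA (fun x => x * f x) := by
  rw [← spectralMap_mul hA (fun x => (x : ℂ)), spectralMap_ofReal]

lemma spectralMap_one {A : Matrix n n ℂ} (hA : A.IsHermitian) :
    spectralMap hA (fun _ => 1) = 1 := by
  simp [spectralMap, unitary_mul_conjTranspose_self]

lemma spectralMap_sub {A : Matrix n n ℂ} (hA : A.IsHermitian) (f g : ℝ → ℂ) :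
    spectralMap hA (fun x => f x - g x) = spectralMap hA f - spectralMap hA g := by
  simp only [spectralMap]
  rw [← diagonal_sub, Matrix.mul_sub, Matrix.sub_mul]

lemma conjTranspose_spectralMap {A : Matrix n n ℂ} (hA : A.IsHermitian) (f : ℝ → ℂ) :
    (spectralMap hA f)ᴴ = spectralMap hA (fun x => star (f x)) := by
  simp [spectralMap, Matrix.mul_assoc, diagonal_conjTranspose, Pi.star_def]

lemma trace_spectralMap {A : Matrix n n ℂ} (hA : A.IsHermitian) (f : ℝ → ℂ) :
    (spectralMap hA f).trace = ∑ i, f (hA.eigenvalues i) := by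
  rw [spectralMap, trace_mul_comm, ← Matrix.mul_assoc, unitary_conjTranspose_mul_self,
    Matrix.one_mul, trace_diagonal]

lemma norm_spectralMap_le {A : Matrix n n ℂ} (hA : A.IsHermitian) {f : ℝ → ℂ} {c : ℝ}
    (hc : 0 ≤ c) (h : ∀ i, ‖f (hA.eigenvalues i)‖ ≤ c) : ‖spectralMap hA f‖ ≤ c := by
  rw [spectralMap, ← star_eq_conjTranspose, ← Unitary.coe_star, CStarRing.norm_mul_coe_unitary,
    CStarRing.norm_coe_unitary_mul, l2_opNorm_diagonal]
  exact (pi_norm_le_iff_of_nonneg hc).2 h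

lemma differentiable_spectralMap {A : Matrix n n ℂ} (hA : A.IsHermitian) {f : ℂ → ℝ → ℂ}
    (h : ∀ i, Differentiable ℂ (fun z => f z (hA.eigenvalues i))) :
    Differentiable ℂ (fun z => spectralMap hA (f z)) := by
  have hd : Differentiable ℂ (fun z => diagonal (fun i => f z (hA.eigenvalues i))) :=
    (LinearMap.toContinuousLinearMap (diagonalLinearMap n ℂ ℂ)).differentiable.comp
      (differentiable_pi.2 h)
  exact (hd.const_mul _).mul_const _

lemma sum_norm_sq_col_le (G : Matrix n n ℂ) (j : n) : ∑ i, ‖G i j‖ ^ 2 ≤ ‖G‖ ^ 2 := by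
  have h := l2_opNorm_mulVec G (EuclideanSpace.single j 1)
  have h2 := pow_le_pow_left₀ (norm_nonneg _) h 2
  simpa [EuclideanSpace.norm_sq_eq] using h2

lemma sum_norm_sq_row_le (G : Matrix n n ℂ) (i : n) : ∑ j, ‖G i j‖ ^ 2 ≤ ‖G‖ ^ 2 := by
  have h := sum_norm_sq_col_le Gᴴ i
  rw [l2_opNorm_conjTranspose] at h
  simpa using h

lemma norm_apply_le_l2_opNorm (G : Matrix n n ℂ) (i j : n) : ‖G i j‖ ≤ ‖G‖ := by
  refine (sq_le_sq₀ (norm_nonneg _) (norm_nonneg _)).1 ?_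
  exact (Finset.single_le_sum (f := fun i => ‖G i j‖ ^ 2) (fun _ _ => by positivity)
    (Finset.mem_univ i)).trans (sum_norm_sq_col_le G j)

lemma norm_trace_mul_spectralMap_le {P : Matrix n n ℂ} (hP : P.IsHermitian) (K : Matrix n n ℂ)
    (g : ℝ → ℂ) :
    ‖(K * spectralMap hP g).trace‖ ≤ ‖K‖ * ∑ i, ‖g (hP.eigenvalues i)‖ := by
  set U := hP.eigenvectorUnitary
  have h : (K * spectralMap hP g).trace =
      ((U : Matrix n n ℂ)ᴴ * K * (U : Matrix n n ℂ) *
        diagonal (fun i => g (hP.eigenvalues i))).trace := by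
    rw [spectralMap, ← Matrix.mul_assoc, trace_mul_comm]
    simp only [Matrix.mul_assoc, U]
  rw [h, trace, Finset.mul_sum]
  refine (norm_sum_le _ _).trans (Finset.sum_le_sum fun i _ => ?_)
  rw [diag_apply, mul_diagonal, norm_mul]
  gcongr
  exact (norm_apply_le_l2_opNorm _ _ _).trans_eq (norm_conjTranspose_mul_mul_unitary U U K)

/-- Hölder's inequality for the trace, with contractions inserted between the factors. -/
lemma norm_trace_mul_spectralMap_mul_le {P Q : Matrix n n ℂ} (hP : P.IsHermitian)
    (hQ : Q.IsHermitian) {K L : Matrix n n ℂ} (hK : ‖K‖ ≤ 1) (hL : ‖L‖ ≤ 1) (f g : ℝ → ℂ)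
    {p q : ℝ} (hpq : p.HolderConjugate q) :
    ‖(K * spectralMap hQ f * L * spectralMap hP g).trace‖ ≤
      (∑ j, ‖f (hQ.eigenvalues j)‖ ^ p) ^ (1 / p) *
        (∑ i, ‖g (hP.eigenvalues i)‖ ^ q) ^ (1 / q) := by
  set X := hP.eigenvectorUnitary
  set Y := hQ.eigenvectorUnitary
  set G := (X : Matrix n n ℂ)ᴴ * K * (Y : Matrix n n ℂ)
  set H := (Y : Matrix n n ℂ)ᴴ * L * (X : Matrix n n ℂ)
  have hG : ‖G‖ ^ 2 ≤ 1 :=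
    pow_le_one₀ (norm_nonneg _) ((norm_conjTranspose_mul_mul_unitary X Y K).trans_le hK)
  have hH : ‖H‖ ^ 2 ≤ 1 :=
    pow_le_one₀ (norm_nonneg _) ((norm_conjTranspose_mul_mul_unitary Y X L).trans_le hL)
  have htr : (K * spectralMap hQ f * L * spectralMap hP g).trace =
      (G * diagonal (fun j => f (hQ.eigenvalues j)) *
        (H * diagonal (fun i => g (hP.eigenvalues i)))).trace := by
    rw [spectralMap.eq_1 hP, ← Matrix.mul_assoc, trace_mul_comm]
    simp only [spectralMap, Matrix.mul_assoc, G, H, X, Y]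
  have hsum : (G * diagonal (fun j => f (hQ.eigenvalues j)) *
        (H * diagonal (fun i => g (hP.eigenvalues i)))).trace =
      ∑ i, ∑ j, G i j * f (hQ.eigenvalues j) * (H j i * g (hP.eigenvalues i)) := by
    simp only [trace, diag_apply, Matrix.mul_apply (M := G * _), mul_diagonal]
  rw [htr, hsum]
  refine le_trans ?_ (sum_mul_mul_le_of_substochastic
    (w := fun i j => (‖G i j‖ ^ 2 + ‖H j i‖ ^ 2) / 2) (fun i j => by positivity) ?_ ?_ hpq
    (fun j => norm_nonneg (f (hQ.eigenvalues j))) (fun i => norm_nonneg (g (hP.eigenvalues i))))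
  · refine (norm_sum_le _ _).trans (Finset.sum_le_sum fun i _ => ?_)
    refine (norm_sum_le _ _).trans (Finset.sum_le_sum fun j _ => ?_)
    simp only [norm_mul]
    have h := two_mul_le_add_sq ‖G i j‖ ‖H j i‖
    calc ‖G i j‖ * ‖f (hQ.eigenvalues j)‖ * (‖H j i‖ * ‖g (hP.eigenvalues i)‖)
        = ‖G i j‖ * ‖H j i‖ * (‖f (hQ.eigenvalues j)‖ * ‖g (hP.eigenvalues i)‖) := by ring
      _ ≤ _ := by gcongr; linarith
  · intro i
    rw [← Finset.sum_div, Finset.sum_add_distrib]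
    linarith [sum_norm_sq_row_le G i, sum_norm_sq_col_le H i]
  · intro j
    rw [← Finset.sum_div, Finset.sum_add_distrib]
    linarith [sum_norm_sq_col_le G j, sum_norm_sq_row_le H j]

/-- Polar decomposition with a contraction in place of the partial isometry. -/
lemma exists_contraction_polar (M : Matrix n n ℂ) :
    ∃ W : Matrix n n ℂ, ‖W‖ ≤ 1 ∧
      W * spectralMap (isHermitian_conjTranspose_mul_self M) (fun x => (√x : ℝ)) = M ∧
      Wᴴ * M = spectralMap (isHermitian_conjTranspose_mul_self M) (fun x => (√x : ℝ)) := by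
  set hM := isHermitian_conjTranspose_mul_self M
  have hpos : ∀ i, 0 ≤ hM.eigenvalues i := (posSemidef_conjTranspose_mul_self M).eigenvalues_nonneg
  have hself : ∀ x : ℝ, star (((√x : ℝ) : ℂ)⁻¹) = ((√x : ℝ) : ℂ)⁻¹ := by
    intro x; rw [star_inv₀, Complex.star_def, Complex.conj_ofReal]
  have hsqrt : ∀ i, ((√(hM.eigenvalues i) : ℝ) : ℂ) * (√(hM.eigenvalues i) : ℝ) =
      hM.eigenvalues i := by
    intro i; rw [← Complex.ofReal_mul, Real.mul_self_sqrt (hpos i)]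
  have hadj : (M * spectralMap hM (fun x => ((√x : ℝ) : ℂ)⁻¹))ᴴ * M =
      spectralMap hM (fun x => (√x : ℝ)) := by
    rw [conjTranspose_mul, conjTranspose_spectralMap, Matrix.mul_assoc,
      spectralMap_mul_self hM]
    refine spectralMap_congr hM fun i => ?_
    rw [hself, ← hsqrt i]
    by_cases h : ((√(hM.eigenvalues i) : ℝ) : ℂ) = 0
    · simp [h]
    · field_simp
  refine ⟨M * spectralMap hM (fun x => ((√x : ℝ) : ℂ)⁻¹), ?_, ?_, hadj⟩
  · refine (sq_le_sq₀ (norm_nonneg _) zero_le_one).1 ?_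
    rw [sq, ← l2_opNorm_conjTranspose_mul_self, ← Matrix.mul_assoc, hadj, spectralMap_mul, one_pow]
    refine norm_spectralMap_le hM zero_le_one fun i => ?_
    by_cases h : ((√(hM.eigenvalues i) : ℝ) : ℂ) = 0
    · simp [h]
    · rw [mul_inv_cancel₀ h, norm_one]
  · rw [Matrix.mul_assoc, spectralMap_mul]
    set R := spectralMap hM (fun x => ((√x : ℝ) : ℂ)⁻¹ * (√x : ℝ))
    have hR : M - M * R = M * spectralMap hM (fun x => 1 - ((√x : ℝ) : ℂ)⁻¹ * (√x : ℝ)) := by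
      rw [spectralMap_sub, spectralMap_one, Matrix.mul_sub, Matrix.mul_one]
    have hz : M * spectralMap hM (fun x => 1 - ((√x : ℝ) : ℂ)⁻¹ * (√x : ℝ)) = 0 := by
      rw [← conjTranspose_mul_self_eq_zero, conjTranspose_mul, Matrix.mul_assoc,
        ← Matrix.mul_assoc Mᴴ,
        self_mul_spectralMap hM]
      have h0 : spectralMap hM (fun x => (x : ℂ) * (1 - ((√x : ℝ) : ℂ)⁻¹ * (√x : ℝ))) = 0 := by
        rw [spectralMap_congr hM (g := fun _ => 0) fun i => ?_]
        · simp [spectralMap]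
        · rw [← hsqrt i]
          by_cases h : ((√(hM.eigenvalues i) : ℝ) : ℂ) = 0
          · simp [h]
          · field_simp; simp
      rw [h0, Matrix.mul_zero]
    exact (sub_eq_zero.1 (hR.trans hz)).symm

/-- The power `x ^ z`, with value `0` at `x = 0` for every exponent; it is entire in `z`. -/
noncomputable def cpowOrZero (z : ℂ) (x : ℝ) : ℂ := if x = 0 then 0 else (x : ℂ) ^ z

lemma differentiable_cpowOrZero (x : ℝ) : Differentiable ℂ (fun z => cpowOrZero z x) := by
  by_cases hx : x = 0
  · simp [cpowOrZero, hx]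
  · simp only [cpowOrZero, hx, if_false]
    exact differentiable_id.const_cpow (Or.inl (Complex.ofReal_ne_zero.2 hx))

lemma norm_cpowOrZero_le {x : ℝ} (hx : 0 ≤ x) (z : ℂ) : ‖cpowOrZero z x‖ ≤ x ^ z.re := by
  rcases hx.eq_or_lt with rfl | hx
  · simpa [cpowOrZero] using Real.rpow_nonneg le_rfl z.re
  · simp [cpowOrZero, hx.ne', Complex.norm_cpow_eq_rpow_re_of_pos hx]

lemma cpowOrZero_mul (z w : ℂ) (x : ℝ) :
    cpowOrZero z x * cpowOrZero w x = cpowOrZero (z + w) x := by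
  by_cases hx : x = 0
  · simp [cpowOrZero, hx]
  · simp [cpowOrZero, hx, Complex.cpow_add _ _ (Complex.ofReal_ne_zero.2 hx)]

lemma cpowOrZero_one (x : ℝ) : cpowOrZero 1 x = x := by
  by_cases hx : x = 0 <;> simp [cpowOrZero, hx]

lemma cpowOrZero_ofReal {s x : ℝ} (hs : s ≠ 0) (hx : 0 ≤ x) :
    cpowOrZero (s : ℂ) x = (x ^ s : ℝ) := by
  by_cases h : x = 0
  · simp [cpowOrZero, h, Real.zero_rpow hs]
  · simp [cpowOrZero, h, Complex.ofReal_cpow hx]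

lemma rpow_le_max_one_rpow {x s t : ℝ} (hx : 0 ≤ x) (hs : 0 ≤ s) (hst : s ≤ t) :
    x ^ s ≤ max 1 (x ^ t) := by
  rcases le_total x 1 with h | h
  · exact (Real.rpow_le_one hx h hs).trans (le_max_left _ _)
  · exact (Real.rpow_le_rpow_of_exponent_le h hst).trans (le_max_right _ _)

lemma norm_spectralMap_cpowOrZero_le_one {A : Matrix n n ℂ} (hA : A.PosSemidef) {z : ℂ}
    (hz : z.re = 0) : ‖spectralMap hA.1 (cpowOrZero z)‖ ≤ 1 :=
  norm_spectralMap_le hA.1 zero_le_one fun i =>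
    (norm_cpowOrZero_le (hA.eigenvalues_nonneg i) z).trans_eq (by rw [hz, Real.rpow_zero])

lemma exists_norm_spectralMap_cpowOrZero_le {A : Matrix n n ℂ} (hA : A.PosSemidef) (t : ℝ) :
    ∃ C : ℝ, ∀ z : ℂ, 0 ≤ z.re → z.re ≤ t → ‖spectralMap hA.1 (cpowOrZero z)‖ ≤ C := by
  refine ⟨∑ i, max 1 (hA.1.eigenvalues i ^ t), fun z h0 ht => ?_⟩
  have hnn : ∀ i ∈ Finset.univ, 0 ≤ max 1 (hA.1.eigenvalues i ^ t) :=
    fun i _ => zero_le_one.trans (le_max_left _ _)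
  exact norm_spectralMap_le hA.1 (Finset.sum_nonneg hnn) fun i =>
    ((norm_cpowOrZero_le (hA.eigenvalues_nonneg i) z).trans
      (rpow_le_max_one_rpow (hA.eigenvalues_nonneg i) h0 ht)).trans
      (Finset.single_le_sum hnn (Finset.mem_univ i))

lemma norm_trace_le_card_mul (M : Matrix n n ℂ) : ‖M.trace‖ ≤ Fintype.card n * ‖M‖ := by
  refine (norm_sum_le _ _).trans ?_
  refine (Finset.sum_le_card_nsmul _ _ ‖M‖ fun i _ => norm_apply_le_l2_opNorm M i i).trans_eq ?_
  simp

lemma norm_mul_mul_le_one {K L M : Matrix n n ℂ} (hK : ‖K‖ ≤ 1) (hL : ‖L‖ ≤ 1) (hM : ‖M‖ ≤ 1) :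
    ‖K * L * M‖ ≤ 1 :=
  (norm_mul_le _ _).trans <| mul_le_one₀
    ((norm_mul_le _ _).trans (mul_le_one₀ hK (norm_nonneg _) hL)) (norm_nonneg _) hM

/-- The estimate on the line `re z = 1` used in the interpolation. -/
lemma norm_trace_cpowOrZero_le_of_re_eq_one {A B P W : Matrix n n ℂ} (hA : A.PosSemidef)
    (hB : B.PosSemidef) (hP : P.PosSemidef) (hW : ‖W‖ ≤ 1) {z w : ℂ} (hz : z.re = 1) {p s : ℝ}
    (hp : 1 < p) (hw : w.re = s * (1 - 1 / p)) :
    ‖(W * spectralMap hA.1 (cpowOrZero z) * spectralMap hB.1 (cpowOrZero z) *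
        spectralMap hP.1 (cpowOrZero w)).trace‖ ≤
      (∑ j, (isHermitian_conjTranspose_mul_self (A * B)).eigenvalues j ^ (p / 2)) ^ (1 / p) *
        (∑ i, hP.1.eigenvalues i ^ s) ^ (1 - 1 / p) := by
  obtain ⟨V, hV, hVAB, -⟩ := exists_contraction_polar (A * B)
  set hN := isHermitian_conjTranspose_mul_self (A * B)
  have hN0 : ∀ i, 0 ≤ hN.eigenvalues i :=
    (posSemidef_conjTranspose_mul_self (A * B)).eigenvalues_nonneg
  have hz0 : (z - 1).re = 0 := by simp [hz]
  have hAz : spectralMap hA.1 (cpowOrZero z) = spectralMap hA.1 (cpowOrZero (z - 1)) * A := by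
    rw [spectralMap_mul_self]
    exact spectralMap_congr _ fun i => by
      rw [← cpowOrZero_one, cpowOrZero_mul, sub_add_cancel]
  have hBz : spectralMap hB.1 (cpowOrZero z) = B * spectralMap hB.1 (cpowOrZero (z - 1)) := by
    rw [self_mul_spectralMap]
    exact spectralMap_congr _ fun i => by
      rw [← cpowOrZero_one, cpowOrZero_mul, add_sub_cancel]
  have heq : W * spectralMap hA.1 (cpowOrZero z) * spectralMap hB.1 (cpowOrZero z) =
      W * spectralMap hA.1 (cpowOrZero (z - 1)) * V * spectralMap hN (fun x => (√x : ℝ)) *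
        spectralMap hB.1 (cpowOrZero (z - 1)) := by
    rw [Matrix.mul_assoc _ V, hVAB, hAz, hBz]
    simp only [Matrix.mul_assoc]
  have hpq := Real.HolderConjugate.conjExponent hp
  have hconj : 1 / p.conjExponent = 1 - 1 / p := by
    have := hpq.inv_add_inv_eq_one
    simp only [one_div]; linarith
  have hexp : s * (1 - 1 / p) * p.conjExponent = s := by
    rw [← hconj, mul_assoc, one_div_mul_cancel hpq.symm.pos.ne', mul_one]
  have hp1 : 0 ≤ 1 - 1 / p := by
    rw [← hconj]; exact one_div_nonneg.2 hpq.symm.pos.le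
  rw [heq]
  refine (norm_trace_mul_spectralMap_mul_le hP.1 hN
    (norm_mul_mul_le_one hW (norm_spectralMap_cpowOrZero_le_one hA hz0) hV)
    (norm_spectralMap_cpowOrZero_le_one hB hz0) _ _ hpq).trans ?_
  rw [hconj]
  refine mul_le_mul (le_of_eq ?_) ?_ ?_ ?_
  · congr 1
    refine Finset.sum_congr rfl fun j _ => ?_
    rw [Complex.norm_real, Real.norm_of_nonneg (Real.sqrt_nonneg _), Real.sqrt_eq_rpow,
      ← Real.rpow_mul (hN0 j)]
    congr 1
    ring
  · refine Real.rpow_le_rpow (Finset.sum_nonneg fun i _ => by positivity)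
      (Finset.sum_le_sum fun i _ => ?_) hp1
    refine (Real.rpow_le_rpow (norm_nonneg _) (norm_cpowOrZero_le (hP.eigenvalues_nonneg i) w)
      hpq.symm.pos.le).trans_eq ?_
    rw [← Real.rpow_mul (hP.eigenvalues_nonneg i), hw, hexp]
  · exact Real.rpow_nonneg (Finset.sum_nonneg fun i _ => by positivity) _
  · exact Real.rpow_nonneg (Finset.sum_nonneg fun i _ => Real.rpow_nonneg (hN0 i) _) _

lemma le_of_le_rpow_mul_rpow {T N r p : ℝ} (hT : 0 ≤ T) (hN : 0 ≤ N) (hr : 0 < r) (hp : 0 < p)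
    (h : T ≤ T ^ (1 - r) * (N ^ (1 / p) * T ^ (1 - 1 / p)) ^ r) : T ≤ N := by
  rcases hT.eq_or_lt with rfl | hT0
  · exact hN
  have hrp : 0 < r / p := div_pos hr hp
  have h1 : T ^ (1 - r) * (N ^ (1 / p) * T ^ (1 - 1 / p)) ^ r = N ^ (r / p) * T ^ (1 - r / p) := by
    rw [Real.mul_rpow (by positivity) (by positivity), ← Real.rpow_mul hN, ← Real.rpow_mul hT,
      mul_left_comm, ← Real.rpow_add hT0]
    congr 2 <;> ring
  rw [h1] at h
  have h2 : T ^ (r / p) * T ^ (1 - r / p) ≤ N ^ (r / p) * T ^ (1 - r / p) := by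
    rwa [← Real.rpow_add hT0, add_sub_cancel, Real.rpow_one]
  exact (Real.rpow_le_rpow_iff hT hN hrp).1
    (le_of_mul_le_mul_right h2 (Real.rpow_pos_of_pos hT0 _))

/-- The Araki–Lieb–Thirring inequality in terms of eigenvalues. -/
lemma sum_eigenvalues_rpow_le_of_posSemidef {A B : Matrix n n ℂ} (hA : A.PosSemidef)
    (hB : B.PosSemidef) {r p : ℝ} (hr0 : 0 < r) (hr1 : r ≤ 1) (hp : 1 < p) :
    ∑ i, (isHermitian_conjTranspose_mul_self
        (spectralMap hA.1 (cpowOrZero r) * spectralMap hB.1 (cpowOrZero r))).eigenvalues i ^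
          (p / r / 2) ≤
      ∑ i, (isHermitian_conjTranspose_mul_self (A * B)).eigenvalues i ^ (p / 2) := by
  set M := spectralMap hA.1 (cpowOrZero r) * spectralMap hB.1 (cpowOrZero r) with hMdef
  obtain ⟨W, hW, -, hWM⟩ := exists_contraction_polar M
  have hP := posSemidef_conjTranspose_mul_self M
  have hN0 := (posSemidef_conjTranspose_mul_self (A * B)).eigenvalues_nonneg
  have hP0 := hP.eigenvalues_nonneg
  have hp0 : 0 < p := by linarith
  have hWs : ‖Wᴴ‖ ≤ 1 := (l2_opNorm_conjTranspose W).trans_le hW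
  set T := ∑ i, hP.1.eigenvalues i ^ (p / r / 2) with hTdef
  have hT : 0 ≤ T := Finset.sum_nonneg fun i _ => Real.rpow_nonneg (hP0 i) _
  let e : ℂ → ℂ := fun z => ((p / r / 2 : ℝ) : ℂ) - z * ((1 / (2 * r) : ℝ) : ℂ)
  have he : ∀ z, (e z).re = p / r / 2 - z.re * (1 / (2 * r)) := by
    intro z; simp only [e, Complex.sub_re, Complex.ofReal_re, Complex.re_mul_ofReal]
  let h : ℂ → ℂ := fun z => (Wᴴ * spectralMap hA.1 (cpowOrZero z) *
    spectralMap hB.1 (cpowOrZero z) * spectralMap hP.1 (cpowOrZero (e z))).trace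
  have hdiff : Differentiable ℂ h := by
    have hc : ∀ {C : Matrix n n ℂ} (hC : C.IsHermitian),
        Differentiable ℂ (fun z => spectralMap hC (cpowOrZero z)) :=
      fun hC => differentiable_spectralMap hC fun i => differentiable_cpowOrZero _
    have hed : Differentiable ℂ e := by fun_prop
    exact (LinearMap.toContinuousLinearMap (traceLinearMap n ℂ ℂ)).differentiable.comp
      ((((hc hA.1).const_mul _).mul (hc hB.1)).mul ((hc hP.1).comp hed))
  have hbdd : BddAbove ((norm ∘ h) '' Complex.HadamardThreeLines.verticalClosedStrip 0 1) := by
    obtain ⟨a, ha⟩ := exists_norm_spectralMap_cpowOrZero_le hA 1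
    obtain ⟨b, hb⟩ := exists_norm_spectralMap_cpowOrZero_le hB 1
    obtain ⟨c, hc⟩ := exists_norm_spectralMap_cpowOrZero_le hP (p / r / 2)
    refine ⟨Fintype.card n * (1 * a * b * c), ?_⟩
    rintro _ ⟨z, ⟨hz0, hz1⟩, rfl⟩
    have hez : z.re * (1 / (2 * r)) ≤ p / r / 2 :=
      (mul_le_mul_of_nonneg_right (hz1.trans hp.le) (by positivity)).trans_eq (by field_simp)
    have ha' := ha z hz0 hz1
    have hb' := hb z hz0 hz1
    have hc' := hc (e z) (by rw [he]; linarith)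
      (by rw [he]; linarith [mul_nonneg hz0 (by positivity : 0 ≤ 1 / (2 * r))])
    have ha0 := (norm_nonneg _).trans ha'
    have hb0 := (norm_nonneg _).trans hb'
    refine (norm_trace_le_card_mul _).trans ?_
    gcongr
    exact norm_mul_le_of_le (norm_mul_le_of_le (norm_mul_le_of_le hWs ha') hb') hc'
  have hleft : ∀ z ∈ Complex.re ⁻¹' {0}, ‖h z‖ ≤ T := by
    intro z hz
    have hz : z.re = 0 := hz
    refine (norm_trace_mul_spectralMap_le hP.1 _ _).trans ?_
    refine (mul_le_of_le_one_left (Finset.sum_nonneg fun _ _ => norm_nonneg _)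
      (norm_mul_mul_le_one hWs (norm_spectralMap_cpowOrZero_le_one hA hz)
        (norm_spectralMap_cpowOrZero_le_one hB hz))).trans (Finset.sum_le_sum fun i _ => ?_)
    refine (norm_cpowOrZero_le (hP0 i) _).trans_eq ?_
    rw [he, hz, zero_mul, sub_zero]
  have hright : ∀ z ∈ Complex.re ⁻¹' {1}, ‖h z‖ ≤
      (∑ i, (isHermitian_conjTranspose_mul_self (A * B)).eigenvalues i ^ (p / 2)) ^ (1 / p) *
        T ^ (1 - 1 / p) := by
    intro z hz
    have hz : z.re = 1 := hz
    refine norm_trace_cpowOrZero_le_of_re_eq_one hA hB hP hWs hz hp ?_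
    rw [he, hz]
    field_simp
  have hval : h r = T := by
    have her : (1 / 2 : ℝ) + e r = ((p / r / 2 : ℝ) : ℂ) := by
      simp only [e]
      rw [← Complex.ofReal_mul, ← Complex.ofReal_sub, ← Complex.ofReal_add]
      congr 1
      field_simp
      ring
    have : Wᴴ * spectralMap hA.1 (cpowOrZero r) * spectralMap hB.1 (cpowOrZero r) =
        spectralMap hP.1 (fun x => (√x : ℝ)) := by
      rw [Matrix.mul_assoc, ← hMdef, hWM]
    simp only [h]
    rw [this, spectralMap_mul, trace_spectralMap, hTdef, Complex.ofReal_sum]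
    refine Finset.sum_congr rfl fun i _ => ?_
    rw [Real.sqrt_eq_rpow, ← cpowOrZero_ofReal (by norm_num) (hP0 i), cpowOrZero_mul, her,
      cpowOrZero_ofReal (by positivity) (hP0 i)]
  have hmain := Complex.HadamardThreeLines.norm_le_interp_of_mem_verticalClosedStrip₀₁' h
    (z := (r : ℂ)) ⟨hr0.le, hr1⟩ hdiff.diffContOnCl hbdd hleft hright
  rw [hval, Complex.norm_real, Real.norm_of_nonneg hT, Complex.ofReal_re] at hmain
  exact le_of_le_rpow_mul_rpow hT
    (Finset.sum_nonneg fun i _ => Real.rpow_nonneg (hN0 i) _) hr0 hp0 hmain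

end SpectralMap

lemma mcpow_eq_spectralMap {n : ℕ} {A : Matrix (Fin n) (Fin n) ℂ} (hA : A.IsHermitian) {z : ℂ}
    (hz : z ≠ 0) : mcpow A z = spectralMap hA (cpowOrZero z) := by
  rw [mcpow, dif_pos hA, spectralMap]
  congr 3
  funext i
  by_cases h : hA.eigenvalues i = 0 <;> simp [cpowOrZero, h, hz]

lemma trAbsPow_eq_sum {n : ℕ} (M : Matrix (Fin n) (Fin n) ℂ) {q : ℝ} (hq : 0 < q) :
    trAbsPow M q = ∑ i, (isHermitian_conjTranspose_mul_self M).eigenvalues i ^ (q / 2) := by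
  have hM := posSemidef_conjTranspose_mul_self M
  rw [trAbsPow, mcpow_eq_spectralMap hM.1 (Complex.ofReal_ne_zero.2 (by positivity)),
    trace_spectralMap, Complex.re_sum]
  refine Finset.sum_congr rfl fun i _ => ?_
  rw [cpowOrZero_ofReal (by positivity) (hM.eigenvalues_nonneg i), Complex.ofReal_re]

/-- **Araki–Lieb–Thirring inequality.** -/
theorem araki_lieb_thirring {n : ℕ} (A B : Matrix (Fin n) (Fin n) ℂ)
    (hA : A.PosSemidef) (hB : B.PosSemidef)
    (r p : ℝ) (hr0 : 0 < r) (hr1 : r ≤ 1) (hp : 2 ≤ p) :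
    trAbsPow (mcpow A ((r : ℝ) : ℂ) * mcpow B ((r : ℝ) : ℂ)) (p / r)
      ≤ trAbsPow (A * B) p := by
  have hp0 : 0 < p := by linarith
  have hr : ((r : ℝ) : ℂ) ≠ 0 := Complex.ofReal_ne_zero.2 hr0.ne'
  rw [mcpow_eq_spectralMap hA.1 hr, mcpow_eq_spectralMap hB.1 hr, trAbsPow_eq_sum _ hp0,
    trAbsPow_eq_sum _ (div_pos hp0 hr0)]
  exact sum_eigenvalues_rpow_le_of_posSemidef hA hB hr0 hr1 (by linarith)
end

section
/- Let ρ be a positive semidefinite n×n complex matrix, let ω be a positive definite n×n complex matrix, and let r ≥ 2. Then Tr (ρ^{1/2} ω^{2/r−1} ρ^{1/2})^{r/2} ≤ Tr (ρ^{r/2} ω^{1−r/2}). -/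
/-!
STATEMENT 5: For ρ positive semidefinite, ω positive definite and r ≥ 2,
Tr (ρ^{1/2} ω^{2/r−1} ρ^{1/2})^{r/2} ≤ Tr (ρ^{r/2} ω^{1−r/2}).
(The sandwiched Rényi trace functional is dominated by the Petz Rényi trace functional.)
-/

open Matrix Complex
open scoped ComplexOrder

section FrobeniusNorm

open scoped Matrix.Norms.Frobenius

variable {n : ℕ}

/-- The power `U diag(d^z) Uᴴ`, with the convention `0 ^ z = 0` for every `z`, including
imaginary `z`, so that `z ↦ spectralPow U d z` is entire and multiplicative. -/
noncomputable def spectralPow (U : Matrix.unitaryGroup (Fin n) ℂ) (d : Fin n → ℝ) (z : ℂ) :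
    Matrix (Fin n) (Fin n) ℂ :=
  (U : Matrix (Fin n) (Fin n) ℂ) *
    Matrix.diagonal (fun i => if d i = 0 then 0 else (d i : ℂ) ^ z) *
    (U : Matrix (Fin n) (Fin n) ℂ)ᴴ

lemma frobenius_norm_sq_eq_sum (M : Matrix (Fin n) (Fin n) ℂ) :
    ‖M‖ ^ 2 = ∑ i, ∑ j, ‖M i j‖ ^ 2 := by
  have h : 0 ≤ ∑ i, ∑ j, ‖M i j‖ ^ (2 : ℝ) := by positivity
  rw [Matrix.frobenius_norm_def, ← Real.rpow_natCast, ← Real.rpow_mul h]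
  simp

lemma frobenius_norm_sq_eq_trace (M : Matrix (Fin n) (Fin n) ℂ) :
    ‖M‖ ^ 2 = (Mᴴ * M).trace.re := by
  rw [frobenius_norm_sq_eq_sum, Finset.sum_comm]
  simp only [Matrix.trace, Matrix.diag, Matrix.mul_apply, Matrix.conjTranspose_apply,
    Complex.re_sum]
  refine Finset.sum_congr rfl fun i _ => Finset.sum_congr rfl fun j _ => ?_
  rw [← Complex.normSq_eq_norm_sq, Complex.normSq_apply]
  simp

lemma norm_trace_mul_le (A B : Matrix (Fin n) (Fin n) ℂ) : ‖(A * B).trace‖ ≤ ‖A‖ * ‖B‖ := by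
  have h1 : ‖(A * B).trace‖ ≤ ∑ p : Fin n × Fin n, ‖A p.1 p.2‖ * ‖B p.2 p.1‖ := by
    simp only [Fintype.sum_prod_type, Matrix.trace, Matrix.diag, Matrix.mul_apply]
    refine (norm_sum_le _ _).trans (Finset.sum_le_sum fun i _ => (norm_sum_le _ _).trans ?_)
    exact Finset.sum_le_sum fun j _ => (norm_mul _ _).le
  refine h1.trans ((Real.sum_mul_le_sqrt_mul_sqrt _ _ _).trans ?_)
  have hA : ∑ p : Fin n × Fin n, ‖A p.1 p.2‖ ^ 2 = ‖A‖ ^ 2 := by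
    rw [frobenius_norm_sq_eq_sum, ← Fintype.sum_prod_type' fun i j => ‖A i j‖ ^ 2]
  have hB : ∑ p : Fin n × Fin n, ‖B p.2 p.1‖ ^ 2 = ‖B‖ ^ 2 := by
    rw [frobenius_norm_sq_eq_sum, ← Fintype.sum_prod_type_right' fun j i => ‖B i j‖ ^ 2]
  rw [hA, hB, Real.sqrt_sq (norm_nonneg _), Real.sqrt_sq (norm_nonneg _)]

lemma norm_trace_mul_mul_mul_le {A B D : Matrix (Fin n) (Fin n) ℂ} {α β δ : ℝ}
    (hA : ‖A‖ ≤ α) (hB : ‖B‖ ≤ β) (hD : ‖D‖ ≤ δ) :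
    ‖(A * B * A * D).trace‖ ≤ α * β * α * δ := by
  have h0 : 0 ≤ α := (norm_nonneg A).trans hA
  have h1 : 0 ≤ β := (norm_nonneg B).trans hB
  have hAB : ‖A * B‖ ≤ α * β :=
    (Matrix.frobenius_norm_mul A B).trans (mul_le_mul hA hB (norm_nonneg B) h0)
  have hABA : ‖A * B * A‖ ≤ α * β * α :=
    (Matrix.frobenius_norm_mul (A * B) A).trans
      (mul_le_mul hAB hA (norm_nonneg A) (mul_nonneg h0 h1))
  exact (norm_trace_mul_le (A * B * A) D).trans
    (mul_le_mul hABA hD (norm_nonneg D) (mul_nonneg (mul_nonneg h0 h1) h0))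

lemma frobenius_norm_unitary_mul (U : Matrix (Fin n) (Fin n) ℂ) (hU : Uᴴ * U = 1)
    (M : Matrix (Fin n) (Fin n) ℂ) : ‖U * M‖ = ‖M‖ := by
  refine (sq_eq_sq₀ (norm_nonneg _) (norm_nonneg _)).1 ?_
  rw [frobenius_norm_sq_eq_trace, frobenius_norm_sq_eq_trace, Matrix.conjTranspose_mul,
    Matrix.mul_assoc, ← Matrix.mul_assoc Uᴴ, hU, Matrix.one_mul]

lemma frobenius_norm_diagonal_mul_le (c : Fin n → ℂ) (hc : ∀ i, ‖c i‖ ≤ 1)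
    (M : Matrix (Fin n) (Fin n) ℂ) : ‖Matrix.diagonal c * M‖ ≤ ‖M‖ := by
  refine (sq_le_sq₀ (norm_nonneg _) (norm_nonneg _)).1 ?_
  rw [frobenius_norm_sq_eq_sum, frobenius_norm_sq_eq_sum]
  refine Finset.sum_le_sum fun i _ => Finset.sum_le_sum fun j _ => ?_
  rw [Matrix.diagonal_mul, norm_mul]
  gcongr
  exact mul_le_of_le_one_left (norm_nonneg _) (hc i)

section spectralPow

variable (U : Matrix.unitaryGroup (Fin n) ℂ) {d : Fin n → ℝ}

lemma conjTranspose_mul_self_unitaryGroup :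
    (U : Matrix (Fin n) (Fin n) ℂ)ᴴ * (U : Matrix (Fin n) (Fin n) ℂ) = 1 :=
  Matrix.mem_unitaryGroup_iff'.1 U.2

lemma mul_conjTranspose_self_unitaryGroup :
    (U : Matrix (Fin n) (Fin n) ℂ) * (U : Matrix (Fin n) (Fin n) ℂ)ᴴ = 1 :=
  Matrix.mem_unitaryGroup_iff.1 U.2

lemma spectralPow_add (z w : ℂ) :
    spectralPow U d (z + w) = spectralPow U d z * spectralPow U d w := by
  have h : spectralPow U d z * spectralPow U d w = (U : Matrix (Fin n) (Fin n) ℂ) *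
      Matrix.diagonal (fun i => if d i = 0 then 0 else (d i : ℂ) ^ z) *
      ((U : Matrix (Fin n) (Fin n) ℂ)ᴴ * (U : Matrix (Fin n) (Fin n) ℂ)) *
      Matrix.diagonal (fun i => if d i = 0 then 0 else (d i : ℂ) ^ w) *
      (U : Matrix (Fin n) (Fin n) ℂ)ᴴ := by
    simp only [spectralPow, Matrix.mul_assoc]
  rw [h, conjTranspose_mul_self_unitaryGroup, Matrix.mul_one, Matrix.mul_assoc (U.1),
    Matrix.diagonal_mul_diagonal, spectralPow]
  congr 3
  ext i
  split_ifs with hi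
  · simp
  · exact Complex.cpow_add _ _ (by exact_mod_cast hi)

lemma spectralPow_conjTranspose (hd : ∀ i, 0 ≤ d i) (s : ℝ) :
    (spectralPow U d s)ᴴ = spectralPow U d s := by
  simp only [spectralPow, Matrix.conjTranspose_mul, Matrix.conjTranspose_conjTranspose,
    Matrix.diagonal_conjTranspose, Matrix.mul_assoc]
  congr 3
  ext i
  rw [Pi.star_apply]
  split_ifs with hi
  · simp
  · rw [← Complex.ofReal_cpow (hd i)]
    simp

lemma norm_spectralPow_mul_le (hd : ∀ i, 0 ≤ d i) {z : ℂ} (hz : z.re = 0)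
    (M : Matrix (Fin n) (Fin n) ℂ) : ‖spectralPow U d z * M‖ ≤ ‖M‖ := by
  rw [spectralPow, Matrix.mul_assoc, Matrix.mul_assoc,
    frobenius_norm_unitary_mul _ (conjTranspose_mul_self_unitaryGroup U)]
  refine (frobenius_norm_diagonal_mul_le _ (fun i => ?_) _).trans_eq
    (frobenius_norm_unitary_mul _ ?_ _)
  · split_ifs with hi
    · simp
    · rw [Complex.norm_cpow_eq_rpow_re_of_pos ((hd i).lt_of_ne' hi), hz, Real.rpow_zero]
  · rw [Matrix.conjTranspose_conjTranspose, mul_conjTranspose_self_unitaryGroup]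

lemma conjTranspose_spectralPow (hd : ∀ i, 0 ≤ d i) (z : ℂ) :
    (spectralPow U d z)ᴴ = spectralPow U d (star z) := by
  simp only [spectralPow, Matrix.conjTranspose_mul, Matrix.conjTranspose_conjTranspose,
    Matrix.diagonal_conjTranspose, Matrix.mul_assoc]
  congr 3
  ext i
  rw [Pi.star_apply]
  split_ifs with hi
  · simp
  · have := Complex.cpow_conj (d i : ℂ) z (by
      rw [Complex.arg_ofReal_of_nonneg (hd i)]; exact Real.pi_pos.ne)
    simpa using this.symm

lemma norm_mul_spectralPow_le (hd : ∀ i, 0 ≤ d i) {z : ℂ} (hz : z.re = 0)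
    (M : Matrix (Fin n) (Fin n) ℂ) : ‖M * spectralPow U d z‖ ≤ ‖M‖ := by
  rw [← Matrix.frobenius_norm_conjTranspose, Matrix.conjTranspose_mul,
    conjTranspose_spectralPow U hd, ← Matrix.frobenius_norm_conjTranspose M]
  exact norm_spectralPow_mul_le U hd (by simpa using hz) _

lemma norm_spectralPow_le (hd : ∀ i, 0 ≤ d i) (z : ℂ) :
    ‖spectralPow U d z‖ ≤ ‖spectralPow U d z.re‖ := by
  conv_lhs => rw [← Complex.re_add_im z, spectralPow_add]
  exact norm_mul_spectralPow_le U hd (by simp) _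

lemma differentiable_spectralPow : Differentiable ℂ (spectralPow U d) := by
  have h : Differentiable ℂ fun z : ℂ => fun i => if d i = 0 then 0 else (d i : ℂ) ^ z := by
    refine differentiable_pi.2 fun i => ?_
    by_cases hi : d i = 0
    · simp [hi]
    · simp only [hi, if_false]
      exact differentiable_id.const_cpow (Or.inl (by exact_mod_cast hi))
  have h2 : Differentiable ℂ fun z : ℂ =>
      Matrix.diagonal fun i => if d i = 0 then 0 else (d i : ℂ) ^ z :=
    (LinearMap.toContinuousLinearMap (Matrix.diagonalLinearMap (Fin n) ℂ ℂ)).differentiable.comp h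
  exact (h2.const_mul _).mul_const _

end spectralPow

/-- A form of the Araki–Lieb–Thirring inequality, by the three lines theorem applied to
`z ↦ Tr (ρ^{qz/2} ω^{(1-q)z} ρ^{qz/2} X^{q(1-z)})`. -/
theorem trace_spectralPow_le (U V W : Matrix.unitaryGroup (Fin n) ℂ) {a d x : Fin n → ℝ}
    (ha : ∀ i, 0 ≤ a i) (hd : ∀ i, 0 ≤ d i) (hx : ∀ i, 0 ≤ x i) {q : ℝ} (hq : 1 ≤ q)
    (hX : spectralPow U a ((1 / 2 : ℝ) : ℂ) * spectralPow V d ((1 / q - 1 : ℝ) : ℂ) *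
      spectralPow U a ((1 / 2 : ℝ) : ℂ) = spectralPow W x 1) :
    (spectralPow W x (q : ℂ)).trace.re ≤
      (spectralPow U a (q : ℂ) * spectralPow V d ((1 - q : ℝ) : ℂ)).trace.re := by
  have hq0 : 0 < q := by linarith
  set T := (spectralPow W x (q : ℂ)).trace.re with hT
  set R := (spectralPow U a (q : ℂ) * spectralPow V d ((1 - q : ℝ) : ℂ)).trace.re with hR
  set C := spectralPow V d (((1 - q) / 2 : ℝ) : ℂ) * spectralPow U a ((q / 2 : ℝ) : ℂ) with hC
  have hCH : Cᴴ = spectralPow U a ((q / 2 : ℝ) : ℂ) *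
      spectralPow V d (((1 - q) / 2 : ℝ) : ℂ) := by
    rw [hC, Matrix.conjTranspose_mul, spectralPow_conjTranspose V hd,
      spectralPow_conjTranspose U ha]
  have hTn : ‖spectralPow W x ((q / 2 : ℝ) : ℂ)‖ ^ 2 = T := by
    rw [frobenius_norm_sq_eq_trace, spectralPow_conjTranspose W hx, ← spectralPow_add, hT]
    congr 3
    push_cast
    ring
  have hRn : ‖C‖ ^ 2 = R := by
    rw [frobenius_norm_sq_eq_trace, hCH, hC, Matrix.mul_assoc, Matrix.trace_mul_comm,
      Matrix.mul_assoc, Matrix.mul_assoc, ← spectralPow_add, ← Matrix.mul_assoc,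
      ← spectralPow_add, Matrix.trace_mul_comm, hR]
    congr 4 <;> push_cast <;> ring
  let F : ℂ → ℂ := fun z =>
    (spectralPow U a (q * z / 2) * spectralPow V d ((1 - q) * z) *
      spectralPow U a (q * z / 2) * spectralPow W x (q * (1 - z))).trace
  have hFd : Differentiable ℂ F := by
    have h1 : Differentiable ℂ fun z : ℂ => spectralPow U a (q * z / 2) :=
      (differentiable_spectralPow U).comp (by fun_prop)
    have h2 : Differentiable ℂ fun z : ℂ => spectralPow V d ((1 - q) * z) :=
      (differentiable_spectralPow V).comp (by fun_prop)
    have h3 : Differentiable ℂ fun z : ℂ => spectralPow W x (q * (1 - z)) :=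
      (differentiable_spectralPow W).comp (by fun_prop)
    exact (LinearMap.toContinuousLinearMap
      (Matrix.traceLinearMap (Fin n) ℂ ℂ)).differentiable.comp (((h1.mul h2).mul h1).mul h3)
  have hFB : BddAbove ((norm ∘ F) '' Complex.HadamardThreeLines.verticalClosedStrip 0 1) := by
    let G : ℝ → ℝ := fun t => ‖spectralPow U a (q * t / 2)‖ * ‖spectralPow V d ((1 - q) * t)‖ *
      ‖spectralPow U a (q * t / 2)‖ * ‖spectralPow W x (q * (1 - t))‖
    have hG : Continuous G := by
      have hU := (differentiable_spectralPow U (d := a)).continuous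
      have hV := (differentiable_spectralPow V (d := d)).continuous
      have hW := (differentiable_spectralPow W (d := x)).continuous
      fun_prop
    obtain ⟨B, hB⟩ := (isCompact_Icc (a := (0 : ℝ)) (b := 1)).bddAbove_image hG.continuousOn
    refine ⟨B, ?_⟩
    rintro _ ⟨z, hz, rfl⟩
    refine le_trans ?_ (hB ⟨z.re, hz, rfl⟩)
    have h1 := norm_spectralPow_le U ha (q * z / 2)
    have h2 := norm_spectralPow_le V hd ((1 - q) * z)
    have h3 := norm_spectralPow_le W hx (q * (1 - z))
    have e1 : (((q * z / 2 : ℂ).re : ℝ) : ℂ) = q * z.re / 2 := by simp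
    have e2 : ((((1 - q) * z : ℂ).re : ℝ) : ℂ) = (1 - q) * z.re := by simp
    have e3 : (((q * (1 - z) : ℂ).re : ℝ) : ℂ) = q * (1 - z.re) := by simp
    rw [e1] at h1
    rw [e2] at h2
    rw [e3] at h3
    exact norm_trace_mul_mul_mul_le h1 h2 h3
  have hF0 : ∀ z ∈ Complex.re ⁻¹' {0}, ‖F z‖ ≤ T := by
    intro z hz
    have hz : z.re = 0 := hz
    have e : (q * (1 - z) : ℂ) = (((q / 2 : ℝ) : ℂ) + -(q * z)) + ((q / 2 : ℝ) : ℂ) := by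
      push_cast
      ring
    simp only [F]
    rw [e, spectralPow_add, ← Matrix.mul_assoc, Matrix.trace_mul_comm, ← hTn, sq]
    refine (norm_trace_mul_le _ _).trans ?_
    refine mul_le_mul_of_nonneg_left ?_ (norm_nonneg _)
    rw [spectralPow_add, Matrix.mul_assoc, Matrix.mul_assoc]
    refine (norm_spectralPow_mul_le U ha (by simp [hz]) _).trans ?_
    refine (norm_spectralPow_mul_le V hd (by simp [hz]) _).trans ?_
    refine (norm_spectralPow_mul_le U ha (by simp [hz]) _).trans ?_
    exact norm_mul_spectralPow_le W hx (by simp [hz]) _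
  have hF1 : ∀ z ∈ Complex.re ⁻¹' {1}, ‖F z‖ ≤ R := by
    intro z hz
    have hz : z.re = 1 := hz
    have e1 : (q * z / 2 : ℂ) = ((q / 2 : ℝ) : ℂ) + q * (z - 1) / 2 := by
      push_cast
      ring
    have e1' : (q * z / 2 : ℂ) = q * (z - 1) / 2 + ((q / 2 : ℝ) : ℂ) := by
      push_cast
      ring
    have e2 : ((1 - q) * z : ℂ) =
        (((1 - q) / 2 : ℝ) : ℂ) + ((1 - q) * (z - 1) + (((1 - q) / 2 : ℝ) : ℂ)) := by
      push_cast
      ring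
    have e : F z = ((spectralPow U a (q * (z - 1) / 2) * Cᴴ) *
        (spectralPow V d ((1 - q) * (z - 1)) *
          ((C * spectralPow U a (q * (z - 1) / 2)) * spectralPow W x (q * (1 - z))))).trace := by
      simp only [F]
      rw [e2, spectralPow_add, spectralPow_add]
      nth_rewrite 1 [e1']
      rw [e1, spectralPow_add, spectralPow_add, hCH, hC]
      simp only [Matrix.mul_assoc]
    rw [e, ← hRn, sq]
    refine (norm_trace_mul_le _ _).trans (mul_le_mul ?_ ?_ (norm_nonneg _) (norm_nonneg _))
    · exact (norm_spectralPow_mul_le U ha (by simp [hz]) _).trans_eq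
        (Matrix.frobenius_norm_conjTranspose C)
    · refine (norm_spectralPow_mul_le V hd (by simp [hz]) _).trans ?_
      refine (norm_mul_spectralPow_le W hx (by simp [hz]) _).trans ?_
      exact norm_mul_spectralPow_le U ha (by simp [hz]) _
  have hT0 : 0 ≤ T := hTn ▸ sq_nonneg _
  have hR0 : 0 ≤ R := hRn ▸ sq_nonneg _
  have hF : F ((1 / q : ℝ) : ℂ) = (spectralPow W x (q : ℂ)).trace := by
    simp only [F]
    have e1 : (q * ((1 / q : ℝ) : ℂ) / 2 : ℂ) = ((1 / 2 : ℝ) : ℂ) := by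
      push_cast
      field_simp
    have e2 : ((1 - q) * ((1 / q : ℝ) : ℂ) : ℂ) = ((1 / q - 1 : ℝ) : ℂ) := by
      push_cast
      field_simp
    rw [e1, e2, hX, ← spectralPow_add]
    congr 2
    push_cast
    field_simp
    ring
  have key := Complex.HadamardThreeLines.norm_le_interp_of_mem_verticalClosedStrip₀₁' F
    (z := ((1 / q : ℝ) : ℂ)) (a := T) (b := R)
    ⟨by simp only [Complex.ofReal_re]; positivity,
      by simp only [Complex.ofReal_re]; exact (div_le_one hq0).2 hq⟩ hFd.diffContOnCl hFB hF0 hF1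
  rw [hF, Complex.ofReal_re] at key
  replace key : T ≤ T ^ (1 - 1 / q) * R ^ (1 / q) := (Complex.re_le_norm _).trans key
  rcases hT0.eq_or_lt with h | h
  · exact h ▸ hR0
  · rw [Real.rpow_sub h, Real.rpow_one, div_mul_eq_mul_div, le_div_iff₀ (by positivity)] at key
    exact (Real.rpow_le_rpow_iff hT0 hR0 (by positivity)).1 (le_of_mul_le_mul_left key h)

lemma mcpow_eq_spectralPow {A : Matrix (Fin n) (Fin n) ℂ} (hA : A.IsHermitian) {z : ℂ}
    (h : z ≠ 0 ∨ ∀ i, hA.eigenvalues i ≠ 0) :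
    mcpow A z = spectralPow hA.eigenvectorUnitary hA.eigenvalues z := by
  rw [mcpow, dif_pos hA, spectralPow]
  congr 3
  ext i
  split_ifs with hi
  · rcases h with h | h
    · simp [hi, h]
    · exact absurd hi (h i)
  · rfl

lemma mcpow_one {A : Matrix (Fin n) (Fin n) ℂ} (hA : A.IsHermitian) : mcpow A 1 = A := by
  have h := hA.spectral_theorem
  rw [Unitary.conjStarAlgAut_apply] at h
  conv_rhs => rw [h]
  rw [mcpow, dif_pos hA]
  simp only [Complex.cpow_one]
  rfl

end FrobeniusNorm

/-- **Sandwiched ≤ Petz Rényi trace functional for r ≥ 2** (finite-dimensional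
instance of the Araki–Lieb–Thirring corollary for Araki–Masuda norms). -/
theorem sandwiched_le_petz {n : ℕ} (ρ ω : Matrix (Fin n) (Fin n) ℂ)
    (hρ : ρ.PosSemidef) (hω : ω.PosDef) (r : ℝ) (hr : 2 ≤ r) :
    ((mcpow (mcpow ρ ((1 / 2 : ℝ) : ℂ) * mcpow ω ((2 / r - 1 : ℝ) : ℂ) *
        mcpow ρ ((1 / 2 : ℝ) : ℂ)) ((r / 2 : ℝ) : ℂ)).trace).re
      ≤ ((mcpow ρ ((r / 2 : ℝ) : ℂ) * mcpow ω ((1 - r / 2 : ℝ) : ℂ)).trace).re := by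
  have hρH := hρ.isHermitian
  have hωH := hω.isHermitian
  have hω0 : ∀ i, hωH.eigenvalues i ≠ 0 := fun i => (hω.eigenvalues_pos i).ne'
  have hhalf : ((1 / 2 : ℝ) : ℂ) ≠ 0 := by norm_num
  have hr2 : ((r / 2 : ℝ) : ℂ) ≠ 0 := by
    have : r / 2 ≠ 0 := by positivity
    exact_mod_cast this
  set X := mcpow ρ ((1 / 2 : ℝ) : ℂ) * mcpow ω ((2 / r - 1 : ℝ) : ℂ) *
    mcpow ρ ((1 / 2 : ℝ) : ℂ) with hXdef
  have hX : X.PosSemidef := by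
    have e : (((2 / r - 1) : ℝ) : ℂ) =
        (((2 / r - 1) / 2 : ℝ) : ℂ) + (((2 / r - 1) / 2 : ℝ) : ℂ) := by
      push_cast
      ring
    have := Matrix.posSemidef_conjTranspose_mul_self
      (mcpow ω (((2 / r - 1) / 2 : ℝ) : ℂ) * mcpow ρ ((1 / 2 : ℝ) : ℂ))
    convert this using 1
    rw [hXdef, Matrix.conjTranspose_mul, mcpow_eq_spectralPow hρH (.inl hhalf),
      mcpow_eq_spectralPow hωH (.inr hω0), mcpow_eq_spectralPow hωH (.inr hω0),
      spectralPow_conjTranspose _ hρ.eigenvalues_nonneg,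
      spectralPow_conjTranspose _ hω.posSemidef.eigenvalues_nonneg, e, spectralPow_add]
    simp only [Matrix.mul_assoc]
  rw [mcpow_eq_spectralPow hX.isHermitian (.inl hr2), mcpow_eq_spectralPow hρH (.inl hr2),
    mcpow_eq_spectralPow hωH (.inr hω0)]
  refine trace_spectralPow_le _ _ _ hρ.eigenvalues_nonneg hω.posSemidef.eigenvalues_nonneg
    hX.eigenvalues_nonneg (by linarith) ?_
  rw [← mcpow_eq_spectralPow hX.isHermitian (.inl one_ne_zero), mcpow_one hX.isHermitian,
    ← mcpow_eq_spectralPow hρH (.inl hhalf), ← mcpow_eq_spectralPow hωH (.inr hω0), one_div_div]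
end

section
/- Let T̃ : M_n(ℂ) → M_m(ℂ) be a linear map that is trace-preserving and 2-positive, with Heisenberg dual T : M_m(ℂ) → M_n(ℂ) defined by Tr(T̃(X)Y) = Tr(X T(Y)) for all X, Y. Let σ be a positive definite density matrix on ℂⁿ such that σ_B := T̃(σ) is positive definite, and define the recovery channel R(Y) := ∫_ℝ β₀(t) · σ^{1/2−it} T( σ_B^{−1/2+it} Y σ_B^{−1/2−it} ) σ^{1/2+it} dt. Then for every density matrix ρ on ℂⁿ: S(ρ|σ) − S(T̃(ρ)|T̃(σ)) ≥ −2 log F( ρ | R(T̃(ρ)) ), where F(ρ|ω) := Tr|ρ^{1/2} ω^{1/2}| is the fidelity. -/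
/-!
STATEMENT 15: Improved data-processing inequality with fidelity lower bound:
S(ρ|σ) − S(T̃(ρ)|T̃(σ)) ≥ −2 log F(ρ | R(T̃(ρ))), where F(ρ|ω) = Tr|ρ^{1/2} ω^{1/2}|
is the fidelity and R is the rotated-Petz recovery channel
R(Y) = ∫ β₀(t) σ^{1/2−it} T(σ_B^{−1/2+it} Y σ_B^{−1/2−it}) σ^{1/2+it} dt, σ_B = T̃(σ).
-/

open MeasureTheory Matrix Complex
open scoped ComplexOrder

/-- The density `β₀(t) = π/(2 cosh(πt)²)`. -/
noncomputable def beta0 (t : ℝ) : ℝ := Real.pi / (2 * (Real.cosh (Real.pi * t)) ^ 2)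

/-- Matrix logarithm of a Hermitian matrix via the spectral functional calculus
(junk value `0` if the matrix is not Hermitian); with the convention `log 0 = 0` on
the kernel, so that `Tr(ρ log ρ)` uses `0 log 0 = 0`. -/
noncomputable def mlog {n : ℕ} (A : Matrix (Fin n) (Fin n) ℂ) :
    Matrix (Fin n) (Fin n) ℂ :=
  if hA : A.IsHermitian then
    (hA.eigenvectorUnitary : Matrix (Fin n) (Fin n) ℂ) *
      Matrix.diagonal (fun i => (Real.log (hA.eigenvalues i) : ℂ)) *
      (hA.eigenvectorUnitary : Matrix (Fin n) (Fin n) ℂ)ᴴ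
  else 0

/-- The relative entropy `S(ρ|σ) = Tr(ρ log ρ − ρ log σ)`. -/
noncomputable def Srel {n : ℕ} (ρ σ : Matrix (Fin n) (Fin n) ℂ) : ℝ :=
  ((ρ * mlog ρ - ρ * mlog σ).trace).re

/-- `Tr |M|`, where `|M| = (M* M)^{1/2}`. -/
noncomputable def trAbs {n : ℕ} (M : Matrix (Fin n) (Fin n) ℂ) : ℝ :=
  ((mcpow (Mᴴ * M) ((1 / 2 : ℝ) : ℂ)).trace).re

/-- The fidelity `F(ρ|ω) = Tr |ρ^{1/2} ω^{1/2}|`. -/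
noncomputable def fidelity {n : ℕ} (ρ ω : Matrix (Fin n) (Fin n) ℂ) : ℝ :=
  trAbs (mcpow ρ ((1 / 2 : ℝ) : ℂ) * mcpow ω ((1 / 2 : ℝ) : ℂ))

/-- The rotated Petz recovery channel
`R(Y) = ∫ β₀(t) σ^{1/2−it} T(σ_B^{−1/2+it} Y σ_B^{−1/2−it}) σ^{1/2+it} dt`,
defined entrywise as a Bochner integral over `t ∈ ℝ`. -/
noncomputable def petzRecovery {n m : ℕ}
    (T : Matrix (Fin m) (Fin m) ℂ → Matrix (Fin n) (Fin n) ℂ)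
    (σ : Matrix (Fin n) (Fin n) ℂ) (σB : Matrix (Fin m) (Fin m) ℂ)
    (Y : Matrix (Fin m) (Fin m) ℂ) : Matrix (Fin n) (Fin n) ℂ :=
  Matrix.of fun i j => ∫ t : ℝ, ((beta0 t : ℂ) *
    ((mcpow σ (1 / 2 - (t : ℂ) * Complex.I) *
      T (mcpow σB (-(1 / 2) + (t : ℂ) * Complex.I) * Y *
        mcpow σB (-(1 / 2) - (t : ℂ) * Complex.I)) *
      mcpow σ (1 / 2 + (t : ℂ) * Complex.I)) i j))

theorem beta0_eq_sigmoid (t : ℝ) :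
    beta0 t = 2 * Real.pi *
      (Real.sigmoid (2 * Real.pi * t) * (1 - Real.sigmoid (2 * Real.pi * t))) := by
  rw [← Real.sigmoid_neg, Real.sigmoid_def, Real.sigmoid_def, beta0, Real.cosh_eq]
  have h1 : Real.exp (-(2 * Real.pi * t)) = Real.exp (-(Real.pi * t)) ^ 2 := by
    rw [← Real.exp_nat_mul]; congr 1; push_cast; ring
  have h2 : Real.exp (- -(2 * Real.pi * t)) = Real.exp (Real.pi * t) ^ 2 := by
    rw [← Real.exp_nat_mul]; congr 1; push_cast; ring
  have h3 : Real.exp (Real.pi * t) * Real.exp (-(Real.pi * t)) = 1 := by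
    rw [← Real.exp_add]; simp
  rw [h1, h2]
  have ha := Real.exp_pos (Real.pi * t)
  have hb := Real.exp_pos (-(Real.pi * t))
  set a := Real.exp (Real.pi * t)
  set b := Real.exp (-(Real.pi * t))
  field_simp
  linear_combination (a * b - 1) * h3

theorem beta0_nonneg (t : ℝ) : 0 ≤ beta0 t := by
  unfold beta0; positivity

theorem beta0_continuous : Continuous beta0 := by
  unfold beta0
  refine Continuous.div (by fun_prop) (by fun_prop) fun t => ?_
  have := Real.cosh_pos (Real.pi * t)
  positivity

theorem hasDerivAt_sigmoid_two_pi (t : ℝ) :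
    HasDerivAt (fun t => Real.sigmoid (2 * Real.pi * t)) (beta0 t) t := by
  rw [beta0_eq_sigmoid]
  have := (Real.hasDerivAt_sigmoid (2 * Real.pi * t)).comp t
    ((hasDerivAt_id t).const_mul (2 * Real.pi))
  refine this.congr_deriv ?_
  simp; ring

theorem range_sigmoid_two_pi :
    (fun t => Real.sigmoid (2 * Real.pi * t)) '' Set.univ = Set.Ioo 0 1 := by
  rw [Set.image_univ, ← Real.range_sigmoid]
  refine Set.Subset.antisymm ?_ ?_
  · rintro _ ⟨x, rfl⟩; exact ⟨_, rfl⟩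
  · rintro _ ⟨x, rfl⟩
    exact ⟨x / (2 * Real.pi), by simp only; congr 1; field_simp⟩

theorem injOn_sigmoid_two_pi :
    Set.InjOn (fun t => Real.sigmoid (2 * Real.pi * t)) Set.univ := by
  intro x _ y _ h
  have := Real.sigmoid_injective h
  have hp := Real.pi_pos
  nlinarith [mul_left_cancel₀ (by positivity : (2 * Real.pi) ≠ 0) this]

theorem beta0_integrable : Integrable beta0 := by
  have := (integrableOn_image_iff_integrableOn_abs_deriv_smul MeasurableSet.univ
    (fun x _ => (hasDerivAt_sigmoid_two_pi x).hasDerivWithinAt) injOn_sigmoid_two_pi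
    (fun _ => (1 : ℝ))).1 (by rw [range_sigmoid_two_pi]; simp)
  simpa [abs_of_nonneg, beta0_nonneg] using this

theorem integral_comp_sigmoid_two_pi {E : Type*} [NormedAddCommGroup E] [NormedSpace ℝ E]
    (g : ℝ → E) :
    ∫ t, beta0 t • g (Real.sigmoid (2 * Real.pi * t)) = ∫ x in Set.Ioo (0 : ℝ) 1, g x := by
  have := integral_image_eq_integral_abs_deriv_smul MeasurableSet.univ
    (fun x _ => (hasDerivAt_sigmoid_two_pi x).hasDerivWithinAt) injOn_sigmoid_two_pi g
  rw [range_sigmoid_two_pi] at this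
  rw [this]
  simp [abs_of_nonneg, beta0_nonneg]

theorem integral_beta0 : ∫ t, beta0 t = 1 := by
  have := integral_comp_sigmoid_two_pi (fun _ => (1 : ℝ))
  simpa using this

theorem integral_beta0_mul_exp_beta (l : ℝ) :
    ∫ t, (beta0 t : ℂ) * Complex.exp (- l * t * I) =
      Complex.betaIntegral (1 - l / (2 * Real.pi) * I) (1 + l / (2 * Real.pi) * I) := by
  rw [Complex.betaIntegral, intervalIntegral.integral_of_le zero_le_one, integral_Ioc_eq_integral_Ioo,
    ← integral_comp_sigmoid_two_pi]
  congr 1; ext t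
  rw [Complex.real_smul]
  congr 1
  rw [← Complex.ofReal_one, ← Complex.ofReal_sub, ← Real.sigmoid_neg]
  have h1 := Real.sigmoid_pos (2 * Real.pi * t)
  have h2 := Real.sigmoid_pos (-(2 * Real.pi * t))
  rw [Complex.cpow_def_of_ne_zero (by exact_mod_cast h1.ne'),
    Complex.cpow_def_of_ne_zero (by exact_mod_cast h2.ne'), ← Complex.exp_add,
    ← Complex.ofReal_log h1.le, ← Complex.ofReal_log h2.le, ← Real.sigmoid_mul_rexp_neg,
    Real.log_mul h1.ne' (Real.exp_pos _).ne', Real.log_exp]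
  congr 1
  have hp : (Real.pi : ℂ) ≠ 0 := by exact_mod_cast Real.pi_ne_zero
  push_cast
  field_simp
  ring

/-- The Fourier transform of `beta0`. -/
theorem integral_beta0_mul_exp (l : ℝ) (hl : l ≠ 0) :
    ∫ t, (beta0 t : ℂ) * Complex.exp (l * (1 / 2 - t * I)) = l / (1 - Complex.exp (- l)) := by
  have e : ∀ t : ℝ, (beta0 t : ℂ) * Complex.exp (l * (1 / 2 - t * I)) =
      Complex.exp (l / 2) * ((beta0 t : ℂ) * Complex.exp (- l * t * I)) := by
    intro t
    rw [mul_left_comm, ← Complex.exp_add]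
    congr 2; ring
  simp_rw [e]
  rw [integral_const_mul, integral_beta0_mul_exp_beta]
  have hp : (Real.pi : ℂ) ≠ 0 := by exact_mod_cast Real.pi_ne_zero
  have hlc : (l : ℂ) ≠ 0 := by exact_mod_cast hl
  have h := Complex.Gamma_mul_Gamma_eq_betaIntegral
    (s := 1 - l / (2 * Real.pi) * I) (t := 1 + l / (2 * Real.pi) * I)
    (by norm_cast; simp [-ofReal_div]) (by norm_cast; simp [-ofReal_div])
  rw [show (1 - l / (2 * Real.pi) * I) + (1 + l / (2 * Real.pi) * I) = (1 : ℂ) + 1 by ring,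
    Complex.Gamma_add_one 1 one_ne_zero, Complex.Gamma_one, one_mul, one_mul,
    add_comm (1 : ℂ) (_ * I),
    Complex.Gamma_add_one _ (by simp [hp, hlc]), mul_left_comm,
    mul_comm (Complex.Gamma _) (Complex.Gamma _), Complex.Gamma_mul_Gamma_one_sub] at h
  rw [add_comm (1 : ℂ) (_ * I), ← h]
  have hs : (Real.pi : ℂ) * (l / (2 * Real.pi) * I) = (l / 2) * I := by field_simp
  rw [hs, Complex.sin_mul_I, Complex.sinh]
  have hx : Complex.exp (-l) = Complex.exp (-(l/2)) * Complex.exp (-(l/2)) := by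
    rw [← Complex.exp_add]; congr 1; ring
  have hy : Complex.exp (l/2) * Complex.exp (-(l/2)) = 1 := by
    rw [← Complex.exp_add]; simp
  have hne : (1 : ℂ) - Complex.exp (-l) ≠ 0 := by
    rw [sub_ne_zero]
    norm_cast
    intro h'
    exact hl (by simpa using h'.symm)
  have hE := Complex.exp_ne_zero (l/2)
  rw [hx, ← sq] at hne ⊢
  set a := Complex.exp (l/2)
  set b := Complex.exp (-(l/2))
  have hne2 : a - b ≠ 0 := by
    intro h'; apply hne
    have : a = b := sub_eq_zero.1 h'
    rw [← hy, this]; ring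
  field_simp
  linear_combination (-b) * hy

theorem hasSum_integral_beta0_mul_exp (l : ℝ) :
    HasSum (fun n : ℕ => 4 * (l : ℂ) ^ 2 / (l ^ 2 + ((2 * Real.pi * (n + 1) : ℝ) : ℂ) ^ 2))
      (2 * (∫ t, (beta0 t : ℂ) * Complex.exp (l * (1 / 2 - t * I))) - 2 - l) := by
  have hp : (Real.pi : ℂ) ≠ 0 := by exact_mod_cast Real.pi_ne_zero
  rcases eq_or_ne l 0 with rfl | hl
  · simp [integral_complex_ofReal, integral_beta0]
  have hlc : (l : ℂ) ≠ 0 := by exact_mod_cast hl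
  rw [integral_beta0_mul_exp l hl]
  set x : ℂ := l / (2 * Real.pi) * I with hx
  have hxm : x ∈ Complex.integerComplement := by
    rintro ⟨n, hn⟩
    have := congrArg Complex.im hn
    rw [hx] at this
    norm_cast at this
    simp [-ofReal_div] at this
    exact div_ne_zero hl (by positivity) this.symm
  have hsum : HasSum (fun n : ℕ => 1 / (x - (n + 1)) + 1 / (x + (n + 1)))
      (Real.pi * cot (Real.pi * x) - 1 / x) := by
    rw [cot_series_rep' hxm]
    exact (summable_cotTerm hxm).hasSum
  have := hsum.mul_left (l / Real.pi * I)
  convert! this using 1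
  · ext n
    have h1 : (l : ℂ) ^ 2 + ((2 * Real.pi * (n + 1) : ℝ) : ℂ) ^ 2 ≠ 0 := by
      norm_cast; positivity
    have h2 : x - (n + 1) ≠ 0 := by
      intro h; apply hxm; exact ⟨n + 1, by push_cast; linear_combination -h⟩
    have h3 : x + (n + 1) ≠ 0 := by
      intro h; apply hxm; exact ⟨-(n + 1), by push_cast; linear_combination -h⟩
    rw [div_add_div _ _ h2 h3, mul_div_assoc', div_eq_div_iff h1 (mul_ne_zero h2 h3), hx]
    push_cast
    field_simp
    ring_nf
    simp only [I_sq]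
    ring
  · have hs : (Real.pi : ℂ) * x = (l / 2) * I := by rw [hx]; field_simp
    rw [Complex.cot, hs, Complex.sin_mul_I, Complex.cos_mul_I, Complex.sinh, Complex.cosh]
    have hxx : Complex.exp (-l) = Complex.exp (-(l/2)) * Complex.exp (-(l/2)) := by
      rw [← Complex.exp_add]; congr 1; ring
    have hy : Complex.exp (l/2) * Complex.exp (-(l/2)) = 1 := by
      rw [← Complex.exp_add]; simp
    have hne : (1 : ℂ) - Complex.exp (-l) ≠ 0 := by
      rw [sub_ne_zero]
      norm_cast
      intro h'
      exact hl (by simpa using h'.symm)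
    rw [hxx, ← sq] at hne ⊢
    rw [hx]
    set a := Complex.exp (l/2)
    set b := Complex.exp (-(l/2))
    have hne2 : a - b ≠ 0 := by
      intro h'; apply hne
      have : a = b := sub_eq_zero.1 h'
      rw [← hy, this]; ring
    field_simp
    linear_combination (2 * (l : ℂ) * b) * hy

theorem integral_one_sub_cos (a : ℝ) (ha : 0 < a) (l : ℝ) :
    IntegrableOn (fun t : ℝ => Complex.exp (-a * t) *
      (1 - (Complex.exp (l * t * I) + Complex.exp (-(l * t * I))) / 2)) (Set.Ioi 0) ∧
    ∫ t in Set.Ioi (0 : ℝ), Complex.exp (-a * t) *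
      (1 - (Complex.exp (l * t * I) + Complex.exp (-(l * t * I))) / 2) =
      (l : ℂ) ^ 2 / (l ^ 2 + (a : ℂ) ^ 2) / a := by
  have e : (fun t : ℝ => Complex.exp (-a * t) *
      (1 - (Complex.exp (l * t * I) + Complex.exp (-(l * t * I))) / 2)) =
      fun t : ℝ => Complex.exp (-a * t) - (Complex.exp ((-a + l * I) * t) / 2 +
        Complex.exp ((-a - l * I) * t) / 2) := by
    ext t
    rw [mul_sub, mul_one, mul_div_assoc', mul_add, ← Complex.exp_add, ← Complex.exp_add, add_div]
    ring_nf
  have r0 : (-(a : ℂ)).re < 0 := by simpa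
  have r1 : (-a + l * I : ℂ).re < 0 := by simpa
  have r2 : (-a - l * I : ℂ).re < 0 := by simpa
  have i0 := integrableOn_exp_mul_complex_Ioi r0 0
  have i1 := (integrableOn_exp_mul_complex_Ioi r1 0).div_const 2
  have i2 := (integrableOn_exp_mul_complex_Ioi r2 0).div_const 2
  rw [e]
  have i12 : IntegrableOn (fun t : ℝ => Complex.exp ((-a + l * I) * t) / 2 +
        Complex.exp ((-a - l * I) * t) / 2) (Set.Ioi 0) := i1.add i2
  refine ⟨i0.sub i12, ?_⟩
  have hne1 : (-a + l * I : ℂ) ≠ 0 := fun h => by rw [h] at r1; simp at r1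
  have hne2 : (-a - l * I : ℂ) ≠ 0 := fun h => by rw [h] at r2; simp at r2
  have hac : (a : ℂ) ≠ 0 := by exact_mod_cast ha.ne'
  have hne3 : (l : ℂ) ^ 2 + (a : ℂ) ^ 2 ≠ 0 := by norm_cast; positivity
  rw [integral_sub i0 i12, integral_add i1 i2, integral_div, integral_div,
    integral_exp_mul_complex_Ioi r0, integral_exp_mul_complex_Ioi r1,
    integral_exp_mul_complex_Ioi r2]
  simp only [ofReal_zero, mul_zero, Complex.exp_zero]
  rw [div_div, div_div, div_add_div _ _ (by simpa) (by simpa),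
    div_sub_div _ _ (by simpa using ha.ne') (by simp [hne1, hne2]), div_div,
    div_eq_div_iff (by simp [hac, hne1, hne2]) (mul_ne_zero hne3 hac)]
  ring_nf
  simp only [I_sq]
  ring

theorem integrable_beta0_mul_exp (l : ℝ) :
    Integrable fun t : ℝ => (beta0 t : ℂ) * Complex.exp (l * (1 / 2 - t * I)) := by
  refine Integrable.mono' (g := fun t => beta0 t * Real.exp (l / 2))
    (beta0_integrable.mul_const _) ?_ (.of_forall fun t => ?_)
  · have := beta0_continuous
    exact Continuous.aestronglyMeasurable (by fun_prop)
  · rw [norm_mul, Complex.norm_exp, Complex.norm_real, Real.norm_of_nonneg (beta0_nonneg t)]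
    simp [div_eq_mul_inv]

/-- A function of the form `z ↦ ∑ₖ exp (lₖ z) • cₖ` with finitely many real exponents `lₖ`. -/
def IsExpSum {E : Type*} [AddCommGroup E] [Module ℂ E] (F : ℂ → E) : Prop :=
  ∃ (ι : Type) (_ : Fintype ι) (l : ι → ℝ) (c : ι → E), ∀ z, F z = ∑ k, Complex.exp (l k * z) • c k

namespace IsExpSum

section
variable {E E' A : Type*} [AddCommGroup E] [Module ℂ E] [AddCommGroup E'] [Module ℂ E']
  [Ring A] [Algebra ℂ A]

theorem const (c : E) : IsExpSum fun _ => c :=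
  ⟨Unit, inferInstance, fun _ => 0, fun _ => c, fun z => by simp⟩

theorem map {F : ℂ → E} (hF : IsExpSum F) (L : E →ₗ[ℂ] E') : IsExpSum fun z => L (F z) := by
  obtain ⟨ι, _, l, c, h⟩ := hF
  exact ⟨ι, inferInstance, l, fun k => L (c k), fun z => by simp [h]⟩

theorem mul {F G : ℂ → A} (hF : IsExpSum F) (hG : IsExpSum G) : IsExpSum fun z => F z * G z := by
  obtain ⟨ι, _, l, c, h⟩ := hF
  obtain ⟨κ, _, m, d, h'⟩ := hG
  refine ⟨ι × κ, inferInstance, fun p => l p.1 + m p.2, fun p => c p.1 * d p.2, fun z => ?_⟩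
  simp only [h, h', Finset.sum_mul_sum, Fintype.sum_prod_type, smul_mul_smul_comm,
    ← Complex.exp_add, ofReal_add, add_mul]

/-- Exponential sums are stable under substituting a real affine function. -/
theorem comp_affine {F : ℂ → E} (hF : IsExpSum F) (a b : ℝ) :
    IsExpSum fun z => F (a * z + b) := by
  obtain ⟨ι, _, l, c, h⟩ := hF
  refine ⟨ι, inferInstance, fun k => l k * a, fun k => Complex.exp (l k * b) • c k, fun z => ?_⟩
  simp only [h, smul_smul, ← Complex.exp_add]
  refine Finset.sum_congr rfl fun k _ => ?_
  congr 2; push_cast; ring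

end

theorem integrable_beta0_mul {f : ℂ → ℂ} (hf : IsExpSum f) :
    Integrable fun t : ℝ => (beta0 t : ℂ) * f (1 / 2 - t * I) := by
  obtain ⟨ι, _, l, c, h⟩ := hf
  have := integrable_finsetSum Finset.univ fun k _ =>
    (integrable_beta0_mul_exp (l k)).const_mul (c k)
  refine this.congr (.of_forall fun t => ?_)
  simp only
  rw [h, Finset.mul_sum]
  refine Finset.sum_congr rfl fun k _ => ?_
  simp only [smul_eq_mul]; ring

theorem sub_one_le_integral {f : ℂ → ℂ} (hf : IsExpSum f) (h0 : f 0 = 1)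
    (hre : ∀ t : ℝ, (f (t * I)).re ≤ 1) {f' : ℂ} (hd : HasDerivAt f f' 0) :
    f'.re ≤ 2 * (∫ t : ℝ, beta0 t * (f (1 / 2 - t * I)).re) - 2 := by
  have hIint := hf.integrable_beta0_mul
  obtain ⟨ι, _, l, c, h⟩ := hf
  have hf' : f' = ∑ k, l k * c k := by
    have : HasDerivAt f (∑ k, l k * c k) 0 := by
      rw [show f = fun z => ∑ k, Complex.exp (l k * z) • c k from funext h]
      refine HasDerivAt.fun_sum fun k _ => ?_
      have := (((hasDerivAt_id (0 : ℂ)).const_mul (l k : ℂ)).cexp).mul_const (c k)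
      simpa using this
    exact hd.unique this
  have hc : ∑ k, c k = 1 := by
    rw [← h0, h]; simp
  have hI : ∫ t : ℝ, (beta0 t : ℂ) * f (1 / 2 - t * I) =
      ∑ k, c k * ∫ t : ℝ, (beta0 t : ℂ) * Complex.exp (l k * (1 / 2 - t * I)) := by
    simp_rw [← integral_const_mul]
    rw [← integral_finsetSum _ fun k _ => (integrable_beta0_mul_exp (l k)).const_mul _]
    congr 1; ext t
    rw [h, Finset.mul_sum]
    refine Finset.sum_congr rfl fun k _ => ?_
    simp only [smul_eq_mul]; ring
  have hIre : ∫ t : ℝ, beta0 t * (f (1 / 2 - t * I)).re =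
      (∫ t : ℝ, (beta0 t : ℂ) * f (1 / 2 - t * I)).re := by
    have := integral_re hIint
    simp only [RCLike.re_to_complex] at this
    rw [← this]
    congr 1; ext t; simp
  have hS := hasSum_sum (s := Finset.univ) fun k _ =>
    (hasSum_integral_beta0_mul_exp (l k)).mul_left (c k)
  have hval : ∑ k, c k * (2 * (∫ t, (beta0 t : ℂ) * Complex.exp (l k * (1 / 2 - t * I))) - 2 - l k)
      = 2 * (∫ t : ℝ, (beta0 t : ℂ) * f (1 / 2 - t * I)) - 2 - f' := by
    have hK : ∀ K : ι → ℂ, ∑ k, c k * (2 * K k - 2 - l k) =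
        2 * ∑ k, c k * K k - 2 - ∑ k, l k * c k := by
      intro K
      simp only [mul_sub, Finset.sum_sub_distrib]
      rw [← Finset.sum_mul, hc, Finset.mul_sum, one_mul]
      refine congrArg₂ _ (congrArg₂ _ (Finset.sum_congr rfl fun k _ => ?_) rfl)
        (Finset.sum_congr rfl fun k _ => ?_) <;> ring
    rw [hI, hf']
    exact hK _
  rw [hval] at hS
  have hnn : 0 ≤ (2 * (∫ t : ℝ, (beta0 t : ℂ) * f (1 / 2 - t * I)) - 2 - f').re := by
    refine (Complex.hasSum_re hS).nonneg fun n => ?_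
    set a : ℝ := 2 * Real.pi * (n + 1) with ha
    have hapos : 0 < a := by positivity
    have hac : (a : ℂ) ≠ 0 := by exact_mod_cast hapos.ne'
    have key : ∑ k, c k * (4 * (l k : ℂ) ^ 2 / (l k ^ 2 + (a : ℂ) ^ 2)) =
        ((4 * a : ℝ) : ℂ) * ∫ t in Set.Ioi (0 : ℝ), Complex.exp (-a * t) *
          (1 - (f (t * I) + f ((-t : ℝ) * I)) / 2) := by
      have : ∀ t : ℝ, Complex.exp (-a * t) * (1 - (f (t * I) + f ((-t : ℝ) * I)) / 2) =
          ∑ k, c k * (Complex.exp (-a * t) *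
            (1 - (Complex.exp (l k * t * I) + Complex.exp (-(l k * t * I))) / 2)) := by
        intro t
        rw [h, h, ← hc, ← Finset.sum_add_distrib, Finset.sum_div, ← Finset.sum_sub_distrib,
          Finset.mul_sum]
        refine Finset.sum_congr rfl fun k _ => ?_
        rw [hc]
        simp only [smul_eq_mul, ofReal_neg]
        ring_nf
      simp_rw [this]
      rw [integral_finsetSum _ fun k _ => ((integral_one_sub_cos a hapos (l k)).1).const_mul _,
        Finset.mul_sum]
      refine Finset.sum_congr rfl fun k _ => ?_
      rw [integral_const_mul, (integral_one_sub_cos a hapos (l k)).2]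
      push_cast
      field_simp
    rw [key, Complex.re_ofReal_mul]
    refine mul_nonneg (by positivity) ?_
    by_cases hi : IntegrableOn (fun t : ℝ => Complex.exp (-a * t) *
          (1 - (f (t * I) + f ((-t : ℝ) * I)) / 2)) (Set.Ioi 0)
    · have := integral_re hi
      simp only [RCLike.re_to_complex] at this
      rw [← this]
      refine integral_nonneg fun t => ?_
      have e : Complex.exp (-a * t) = ((Real.exp (-a * t) : ℝ) : ℂ) := by push_cast; rfl
      simp only [e, Complex.re_ofReal_mul, Pi.zero_apply]
      refine mul_nonneg (Real.exp_pos _).le ?_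
      have h1 := hre t
      have h2 := hre (-t)
      rw [show (f (t * I) + f ((-t : ℝ) * I)) / 2 = (f (t * I) + f ((-t : ℝ) * I)) / ((2 : ℝ) : ℂ)
        by norm_num]
      rw [Complex.sub_re, Complex.div_ofReal_re, Complex.add_re, Complex.one_re]
      linarith
    · rw [integral_undef hi]; simp
  rw [hIre]
  simp only [Complex.sub_re, Complex.mul_re, Complex.re_ofNat, Complex.im_ofNat, zero_mul,
    sub_zero] at hnn
  linarith

/-- A Hirschman type estimate for the derivative at a boundary point of the strip. -/
theorem re_deriv_le_integral {g : ℂ → ℂ} (hg : IsExpSum g) (h0 : g 0 = 1)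
    (hle : ∀ t : ℝ, ‖g (t * I)‖ ≤ 1) {g' : ℂ} (hd : HasDerivAt g g' 0) {u : ℝ → ℝ}
    (hu : Integrable fun t => beta0 t * u t) (hgu : ∀ t : ℝ, ‖g (1 / 2 - t * I)‖ ^ 2 ≤ u t) :
    g'.re ≤ (∫ t, beta0 t * u t) - 1 := by
  have hgg := hg.mul hg
  have h1 := hgg.sub_one_le_integral (f' := 2 * g') (by simp [h0]) (fun t => ?_) ?_
  · have h2 : ∫ t : ℝ, beta0 t * (g (1 / 2 - t * I) * g (1 / 2 - t * I)).re ≤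
        ∫ t, beta0 t * u t := by
      refine integral_mono ?_ hu fun t => ?_
      · have := hgg.integrable_beta0_mul.re
        refine this.congr (.of_forall fun t => ?_)
        simp
      · refine mul_le_mul_of_nonneg_left (le_trans ?_ (hgu t)) (beta0_nonneg t)
        refine (Complex.re_le_norm _).trans ?_
        rw [norm_mul, sq]
    simp only [Complex.mul_re, Complex.re_ofNat, Complex.im_ofNat, zero_mul, sub_zero] at h1 h2
    linarith
  · refine (Complex.re_le_norm _).trans ?_
    rw [norm_mul]
    exact mul_le_one₀ (hle t) (norm_nonneg _) (hle t)
  · refine (hd.mul hd).congr_deriv ?_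
    rw [h0]; ring

end IsExpSum

/-- Spectral functional calculus of a Hermitian matrix for complex valued functions. -/
noncomputable def Matrix.IsHermitian.fcalc {n : ℕ} {A : Matrix (Fin n) (Fin n) ℂ}
    (hA : A.IsHermitian) (f : ℝ → ℂ) : Matrix (Fin n) (Fin n) ℂ :=
  (hA.eigenvectorUnitary : Matrix (Fin n) (Fin n) ℂ) *
    Matrix.diagonal (fun i => f (hA.eigenvalues i)) *
    (hA.eigenvectorUnitary : Matrix (Fin n) (Fin n) ℂ)ᴴ

namespace Matrix.IsHermitian

variable {n : ℕ} {A : Matrix (Fin n) (Fin n) ℂ} (hA : A.IsHermitian)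
include hA

theorem eigU_mul : (hA.eigenvectorUnitary : Matrix (Fin n) (Fin n) ℂ) *
    (hA.eigenvectorUnitary : Matrix (Fin n) (Fin n) ℂ)ᴴ = 1 :=
  Unitary.coe_mul_star_self hA.eigenvectorUnitary

theorem mul_eigU : (hA.eigenvectorUnitary : Matrix (Fin n) (Fin n) ℂ)ᴴ *
    (hA.eigenvectorUnitary : Matrix (Fin n) (Fin n) ℂ) = 1 :=
  Unitary.coe_star_mul_self hA.eigenvectorUnitary

theorem fcalc_mul (f g : ℝ → ℂ) : hA.fcalc f * hA.fcalc g = hA.fcalc (fun x => f x * g x) := by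
  unfold fcalc
  calc _ = (hA.eigenvectorUnitary : Matrix (Fin n) (Fin n) ℂ) *
      (Matrix.diagonal (fun i => f (hA.eigenvalues i)) *
      ((hA.eigenvectorUnitary : Matrix (Fin n) (Fin n) ℂ)ᴴ *
        (hA.eigenvectorUnitary : Matrix (Fin n) (Fin n) ℂ)) *
      Matrix.diagonal (fun i => g (hA.eigenvalues i))) *
      (hA.eigenvectorUnitary : Matrix (Fin n) (Fin n) ℂ)ᴴ := by simp only [Matrix.mul_assoc]
    _ = _ := by rw [hA.mul_eigU, Matrix.mul_one, Matrix.diagonal_mul_diagonal]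

theorem fcalc_conjTranspose (f : ℝ → ℂ) : (hA.fcalc f)ᴴ = hA.fcalc (fun x => star (f x)) := by
  simp [fcalc, Matrix.conjTranspose_mul, Matrix.diagonal_conjTranspose, Matrix.mul_assoc, Pi.star_def]

theorem fcalc_congr {f g : ℝ → ℂ} (h : ∀ i, f (hA.eigenvalues i) = g (hA.eigenvalues i)) :
    hA.fcalc f = hA.fcalc g := by
  unfold fcalc; congr 3; ext i; exact h i

theorem fcalc_one : hA.fcalc (fun _ => 1) = 1 := by
  simp [fcalc, hA.eigU_mul]

theorem fcalc_id : hA.fcalc (fun x => x) = A := by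
  conv_rhs => rw [hA.spectral_theorem]
  rfl

theorem fcalc_ofReal (f : ℝ → ℝ) : hA.fcalc (fun x => (f x : ℂ)) = cfc f A := by
  rw [hA.cfc_eq]; rfl

theorem fcalc_eq_sum (f : ℝ → ℂ) : hA.fcalc f = ∑ i, f (hA.eigenvalues i) •
    ((hA.eigenvectorUnitary : Matrix (Fin n) (Fin n) ℂ) * Matrix.single i i 1 *
    (hA.eigenvectorUnitary : Matrix (Fin n) (Fin n) ℂ)ᴴ) := by
  have h : Matrix.diagonal (fun i => f (hA.eigenvalues i)) =
      ∑ i, f (hA.eigenvalues i) • Matrix.single i i (1 : ℂ) := by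
    rw [← Matrix.sum_single_eq_diagonal]
    simp [Matrix.smul_single]
  rw [fcalc, h, Finset.mul_sum, Finset.sum_mul]
  simp only [Matrix.mul_smul, Matrix.smul_mul]

theorem trace_mul_fcalc (B : Matrix (Fin n) (Fin n) ℂ) (f : ℝ → ℂ) :
    (B * hA.fcalc f).trace = ∑ i, f (hA.eigenvalues i) *
      ((hA.eigenvectorUnitary : Matrix (Fin n) (Fin n) ℂ)ᴴ * B *
      (hA.eigenvectorUnitary : Matrix (Fin n) (Fin n) ℂ)) i i := by
  rw [fcalc, ← Matrix.mul_assoc, Matrix.trace_mul_comm, ← Matrix.mul_assoc, ← Matrix.mul_assoc,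
    Matrix.trace]
  simp [Matrix.mul_diagonal, mul_comm]

theorem fcalc_posSemidef {f : ℝ → ℂ} (h : ∀ i, 0 ≤ f (hA.eigenvalues i)) :
    (hA.fcalc f).PosSemidef :=
  (Matrix.PosSemidef.diagonal h).mul_mul_conjTranspose_same _

theorem mcpow_eq (z : ℂ) : mcpow A z = hA.fcalc (fun x => (x : ℂ) ^ z) := by
  simp [mcpow, hA, fcalc]

theorem mlog_eq : mlog A = hA.fcalc (fun x => (Real.log x : ℂ)) := by
  simp [mlog, hA, fcalc]

end Matrix.IsHermitian

namespace Matrix.PosSemidef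

variable {n : ℕ} {A : Matrix (Fin n) (Fin n) ℂ} (hA : A.PosSemidef)
include hA

theorem mcpow_ofReal (r : ℝ) : mcpow A (r : ℂ) = cfc (fun x : ℝ => x ^ r) A := by
  rw [hA.isHermitian.mcpow_eq, ← hA.isHermitian.fcalc_ofReal]
  refine hA.isHermitian.fcalc_congr fun i => ?_
  rw [Complex.ofReal_cpow (hA.eigenvalues_nonneg i)]

theorem mcpow_posSemidef (r : ℝ) : (mcpow A (r : ℂ)).PosSemidef := by
  rw [hA.isHermitian.mcpow_eq]
  refine hA.isHermitian.fcalc_posSemidef fun i => ?_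
  rw [← Complex.ofReal_cpow (hA.eigenvalues_nonneg i)]
  exact_mod_cast Real.rpow_nonneg (hA.eigenvalues_nonneg i) _

theorem mcpow_half_mul_self : mcpow A ((1 / 2 : ℝ) : ℂ) * mcpow A ((1 / 2 : ℝ) : ℂ) = A := by
  rw [hA.isHermitian.mcpow_eq, hA.isHermitian.fcalc_mul]
  conv_rhs => rw [← hA.isHermitian.fcalc_id]
  refine hA.isHermitian.fcalc_congr fun i => ?_
  rw [← Complex.ofReal_cpow (hA.eigenvalues_nonneg i), ← Complex.ofReal_mul,
    ← Real.sqrt_eq_rpow, Real.mul_self_sqrt (hA.eigenvalues_nonneg i)]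

end Matrix.PosSemidef

namespace Matrix.PosDef

variable {n : ℕ} {A : Matrix (Fin n) (Fin n) ℂ} (hA : A.PosDef)
include hA

theorem mcpow_eq_exp (z : ℂ) :
    mcpow A z = hA.isHermitian.fcalc (fun x => Complex.exp (Real.log x * z)) := by
  rw [hA.isHermitian.mcpow_eq]
  refine hA.isHermitian.fcalc_congr fun i => ?_
  rw [Complex.cpow_def_of_ne_zero (by exact_mod_cast (hA.eigenvalues_pos i).ne'),
    Complex.ofReal_log (hA.eigenvalues_pos i).le]

theorem mcpow_zero : mcpow A 0 = 1 := by
  rw [hA.mcpow_eq_exp]; simpa using hA.isHermitian.fcalc_one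

theorem mcpow_one : mcpow A 1 = A := by
  rw [hA.isHermitian.mcpow_eq]; simpa using hA.isHermitian.fcalc_id

theorem mcpow_mul (z w : ℂ) : mcpow A z * mcpow A w = mcpow A (z + w) := by
  simp only [hA.mcpow_eq_exp, hA.isHermitian.fcalc_mul, ← Complex.exp_add, mul_add]

theorem mcpow_conjTranspose (z : ℂ) : (mcpow A z)ᴴ = mcpow A (star z) := by
  simp only [hA.mcpow_eq_exp, hA.isHermitian.fcalc_conjTranspose, Complex.star_def,
    ← Complex.exp_conj, map_mul, Complex.conj_ofReal]

theorem isExpSum_mcpow : IsExpSum (mcpow A) :=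
  ⟨Fin n, inferInstance, _, _, fun z => by
    rw [hA.mcpow_eq_exp, hA.isHermitian.fcalc_eq_sum]⟩

theorem isUnit_mcpow (z : ℂ) : IsUnit (mcpow A z) :=
  IsUnit.of_mul_eq_one (mcpow A (-z)) (by rw [hA.mcpow_mul, add_neg_cancel, hA.mcpow_zero])

theorem mcpow_posDef (r : ℝ) : (mcpow A (r : ℂ)).PosDef :=
  (hA.posSemidef.mcpow_posSemidef r).posDef_iff_isUnit.2 (hA.isUnit_mcpow _)

section
open scoped Matrix.Norms.L2Operator

theorem hasDerivAt_mcpow : HasDerivAt (mcpow A) (mlog A) 0 := by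
  rw [hA.isHermitian.mlog_eq, hA.isHermitian.fcalc_eq_sum]
  have e : mcpow A = fun z => ∑ i, Complex.exp (Real.log (hA.isHermitian.eigenvalues i) * z) •
    ((hA.isHermitian.eigenvectorUnitary : Matrix (Fin n) (Fin n) ℂ) * Matrix.single i i 1 *
    (hA.isHermitian.eigenvectorUnitary : Matrix (Fin n) (Fin n) ℂ)ᴴ) := by
    ext1 z
    rw [hA.mcpow_eq_exp, hA.isHermitian.fcalc_eq_sum]
  rw [e]
  refine HasDerivAt.fun_sum fun i _ => ?_
  refine HasDerivAt.smul_const ?_ _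
  have := ((hasDerivAt_id (0 : ℂ)).const_mul
    (Real.log (hA.isHermitian.eigenvalues i) : ℂ)).cexp
  simpa using this

end

end Matrix.PosDef

/-- Cauchy-Schwarz inequality for the Hilbert-Schmidt inner product. -/
theorem Matrix.norm_trace_mul_sq_le {n : ℕ} (A B : Matrix (Fin n) (Fin n) ℂ) :
    ‖(A * B).trace‖ ^ 2 ≤ (A * Aᴴ).trace.re * (Bᴴ * B).trace.re := by
  let x : EuclideanSpace ℂ (Fin n × Fin n) := WithLp.toLp 2 fun p => star (A p.1 p.2)
  let y : EuclideanSpace ℂ (Fin n × Fin n) := WithLp.toLp 2 fun p => B p.2 p.1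
  have h := norm_inner_le_norm (𝕜 := ℂ) x y
  have hxy : inner ℂ x y = (A * B).trace := by
    simp [x, y, PiLp.inner_apply, Matrix.trace, Matrix.mul_apply, Fintype.sum_prod_type, mul_comm]
  have hx : ‖x‖ ^ 2 = (A * Aᴴ).trace.re := by
    simp [x, EuclideanSpace.norm_sq_eq, Matrix.trace, Matrix.mul_apply, Fintype.sum_prod_type,
      Complex.mul_conj, Complex.normSq_eq_norm_sq, -Complex.ofReal_pow]
  have hy : ‖y‖ ^ 2 = (Bᴴ * B).trace.re := by
    simp only [y, EuclideanSpace.norm_sq_eq, Matrix.trace, Matrix.mul_apply,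
      Fintype.sum_prod_type, Matrix.diag_apply, Matrix.conjTranspose_apply, Complex.re_sum]
    refine Finset.sum_congr rfl fun i _ => Finset.sum_congr rfl fun j _ => ?_
    rw [Complex.star_def, Complex.conj_mul', ← Complex.ofReal_pow, Complex.ofReal_re]
  rw [← hxy, ← hx, ← hy, ← mul_pow]
  gcongr

/-- The trace pairing separates matrices. -/
theorem Matrix.eq_of_trace_mul_eq {n : ℕ} {A B : Matrix (Fin n) (Fin n) ℂ}
    (h : ∀ X : Matrix (Fin n) (Fin n) ℂ, (X * A).trace = (X * B).trace) : A = B := by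
  ext i j
  have := h (Matrix.single j i 1)
  simpa [Matrix.trace_single_mul] using this

/-- The trace-preserving, 2-positive map `Tt` with Heisenberg dual `T`. -/
structure IsTwoPositiveDual {n m : ℕ}
    (Tt : Matrix (Fin n) (Fin n) ℂ →ₗ[ℂ] Matrix (Fin m) (Fin m) ℂ)
    (T : Matrix (Fin m) (Fin m) ℂ →ₗ[ℂ] Matrix (Fin n) (Fin n) ℂ) : Prop where
  trace_map : ∀ X, (Tt X).trace = X.trace
  posSemidef_fromBlocks : ∀ A B C D, (Matrix.fromBlocks A B C D).PosSemidef →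
    (Matrix.fromBlocks (Tt A) (Tt B) (Tt C) (Tt D)).PosSemidef
  trace_map_mul : ∀ X Y, (Tt X * Y).trace = (X * T Y).trace

namespace IsTwoPositiveDual

variable {n m : ℕ} {Tt : Matrix (Fin n) (Fin n) ℂ →ₗ[ℂ] Matrix (Fin m) (Fin m) ℂ}
  {T : Matrix (Fin m) (Fin m) ℂ →ₗ[ℂ] Matrix (Fin n) (Fin n) ℂ} (h : IsTwoPositiveDual Tt T)
include h

theorem dual_one : T 1 = 1 :=
  Matrix.eq_of_trace_mul_eq fun X => by
    rw [← h.trace_map_mul, Matrix.mul_one, Matrix.mul_one, h.trace_map]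

theorem fromBlocks_gram (K L : Matrix (Fin n) (Fin n) ℂ) :
    (Matrix.fromBlocks (Tt (K * Kᴴ)) (Tt (K * Lᴴ)) (Tt (L * Kᴴ)) (Tt (L * Lᴴ))).PosSemidef := by
  refine h.posSemidef_fromBlocks _ _ _ _ ?_
  have := Matrix.posSemidef_self_mul_conjTranspose (Matrix.fromBlocks K (0 : Matrix (Fin n) (Fin n) ℂ) L 0)
  simpa [Matrix.fromBlocks_conjTranspose, Matrix.fromBlocks_multiply] using this

theorem map_conjTranspose (X : Matrix (Fin n) (Fin n) ℂ) : Tt Xᴴ = (Tt X)ᴴ := by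
  have := (Matrix.isHermitian_fromBlocks_iff.1 (h.fromBlocks_gram X 1).isHermitian).2.1
  simpa using this.symm

theorem map_posSemidef {X : Matrix (Fin n) (Fin n) ℂ} (hX : X.PosSemidef) :
    (Tt X).PosSemidef := by
  have := (h.fromBlocks_gram (mcpow X ((1 / 2 : ℝ) : ℂ)) 0).submatrix Sum.inl
  rw [(hX.mcpow_posSemidef _).isHermitian.eq, hX.mcpow_half_mul_self] at this
  exact this

theorem dual_conjTranspose (Y : Matrix (Fin m) (Fin m) ℂ) : T Yᴴ = (T Y)ᴴ :=
  Matrix.eq_of_trace_mul_eq fun X => by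
    have h1 := h.trace_map_mul Xᴴ Y
    rw [← h.trace_map_mul, ← star_inj, ← Matrix.trace_conjTranspose, ← Matrix.trace_conjTranspose,
      Matrix.conjTranspose_mul, Matrix.conjTranspose_mul, Matrix.conjTranspose_conjTranspose,
      Matrix.conjTranspose_conjTranspose, ← h.map_conjTranspose, Matrix.trace_mul_comm, h1,
      Matrix.trace_mul_comm]

/-- Trace form of the Kadison-Schwarz inequality for the dual map. -/
theorem trace_schwarz (x : Matrix (Fin m) (Fin m) ℂ) (K : Matrix (Fin n) (Fin n) ℂ) :
    (Kᴴ * (T x * (T x)ᴴ) * K).trace.re ≤ (Kᴴ * T (x * xᴴ) * K).trace.re := by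
  have h0 := h.fromBlocks_gram (-((T x)ᴴ * K)) K
  have h1 := ((h0.conjTranspose_mul_mul_same
    (Matrix.fromBlocks 1 (0 : Matrix _ (Fin m) ℂ) x 0)).submatrix Sum.inl).trace_nonneg
  rw [Matrix.fromBlocks_conjTranspose, Matrix.fromBlocks_multiply, Matrix.fromBlocks_multiply] at h1
  change (0 : ℂ) ≤ Matrix.trace (n := Fin m) (_ + _) at h1
  simp only [Matrix.conjTranspose_one, Matrix.one_mul, Matrix.mul_one, Matrix.trace_add,
    Matrix.add_mul] at h1
  rw [← Matrix.mul_one (Tt (-_ * _)), h.trace_map_mul, h.dual_one, Matrix.trace_mul_comm xᴴ,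
    h.trace_map_mul, h.trace_map_mul, Matrix.mul_assoc xᴴ, Matrix.trace_mul_comm xᴴ,
    Matrix.mul_assoc (Tt (K * Kᴴ)), h.trace_map_mul, h.dual_conjTranspose] at h1
  have e2 : (K * Kᴴ * T (x * xᴴ)).trace = (Kᴴ * T (x * xᴴ) * K).trace := by
    rw [Matrix.trace_mul_comm, ← Matrix.mul_assoc, Matrix.trace_mul_comm, ← Matrix.mul_assoc]
  have e1 : ∀ P : Matrix (Fin n) (Fin n) ℂ, (P * K).trace = (K * P).trace := fun P =>
    Matrix.trace_mul_comm _ _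
  have h2 := (Complex.nonneg_iff.1 h1).1
  rw [e2] at h2
  simp only [Matrix.conjTranspose_neg, Matrix.conjTranspose_mul, Matrix.conjTranspose_conjTranspose,
    Matrix.neg_mul, Matrix.mul_neg, neg_neg, Matrix.mul_one, Matrix.trace_neg, Complex.add_re,
    Complex.neg_re, e1] at h2 ⊢
  have e3 : ((T x)ᴴ * K * (Kᴴ * T x)).trace = (K * (Kᴴ * (T x * (T x)ᴴ))).trace := by
    rw [Matrix.mul_assoc, Matrix.trace_mul_comm]; simp only [Matrix.mul_assoc]
  have e4 : (K * (Kᴴ * T x) * (T x)ᴴ).trace = (K * (Kᴴ * (T x * (T x)ᴴ))).trace := by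
    simp only [Matrix.mul_assoc]
  have e5 : ((T x)ᴴ * K * Kᴴ * (T x)).trace = (K * (Kᴴ * (T x * (T x)ᴴ))).trace := by
    rw [← e3]; simp only [Matrix.mul_assoc]
  rw [e3, e4, e5] at h2
  linarith

end IsTwoPositiveDual

namespace IsTwoPositiveDual

variable {n m : ℕ} {Tt : Matrix (Fin n) (Fin n) ℂ →ₗ[ℂ] Matrix (Fin m) (Fin m) ℂ}
  {T : Matrix (Fin m) (Fin m) ℂ →ₗ[ℂ] Matrix (Fin n) (Fin n) ℂ} (h : IsTwoPositiveDual Tt T)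
include h

theorem dual_posSemidef (x : Matrix (Fin m) (Fin m) ℂ) : (T (x * xᴴ)).PosSemidef := by
  refine .of_dotProduct_mulVec_nonneg ?_ fun v => ?_
  · rw [Matrix.IsHermitian, ← h.dual_conjTranspose, Matrix.conjTranspose_mul,
      Matrix.conjTranspose_conjTranspose]
  · have e : star v ⬝ᵥ (T (x * xᴴ) *ᵥ v) = (Matrix.vecMulVec v (star v) * T (x * xᴴ)).trace := by
      rw [Matrix.trace_mul_comm, Matrix.mul_vecMulVec, Matrix.trace_vecMulVec, dotProduct_comm]
    rw [e, ← h.trace_map_mul, ← Matrix.mul_assoc, Matrix.trace_mul_comm, ← Matrix.mul_assoc]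
    exact ((h.map_posSemidef
      (Matrix.posSemidef_vecMulVec_self_star v)).conjTranspose_mul_mul_same x).trace_nonneg

end IsTwoPositiveDual

/-- The integrand of the rotated Petz recovery map at `z = 1/2 - it`. -/
noncomputable def petzKernel {n m : ℕ} (T : Matrix (Fin m) (Fin m) ℂ →ₗ[ℂ] Matrix (Fin n) (Fin n) ℂ)
    (σ : Matrix (Fin n) (Fin n) ℂ) (σB Y : Matrix (Fin m) (Fin m) ℂ) (z : ℂ) :
    Matrix (Fin n) (Fin n) ℂ :=
  mcpow σ z * T (mcpow σB (-z) * Y * mcpow σB (z - 1)) * mcpow σ (1 - z)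

section Petz

variable {n m : ℕ} {T : Matrix (Fin m) (Fin m) ℂ →ₗ[ℂ] Matrix (Fin n) (Fin n) ℂ}
    {σ : Matrix (Fin n) (Fin n) ℂ} {σB : Matrix (Fin m) (Fin m) ℂ}

theorem petzRecovery_apply (Y : Matrix (Fin m) (Fin m) ℂ) (i j : Fin n) :
    petzRecovery (fun Y => T Y) σ σB Y i j =
      ∫ t : ℝ, (beta0 t : ℂ) * petzKernel T σ σB Y (1 / 2 - t * Complex.I) i j := by
  have e1 : ∀ x : ℂ, 1 / 2 - x - 1 = -(1 / 2) - x := fun x => by ring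
  have e2 : ∀ x : ℂ, -(1 / 2 - x) = -(1 / 2) + x := fun x => by ring
  have e3 : ∀ x : ℂ, 1 - (1 / 2 - x) = 1 / 2 + x := fun x => by ring
  simp only [petzRecovery, Matrix.of_apply, petzKernel, e1, e2, e3]

theorem isExpSum_petzKernel (hσ : σ.PosDef) (hσB : σB.PosDef) (Y : Matrix (Fin m) (Fin m) ℂ) :
    IsExpSum (petzKernel T σ σB Y) := by
  have h1 := hσB.isExpSum_mcpow.comp_affine (-1) 0
  have h2 := hσB.isExpSum_mcpow.comp_affine 1 (-1)
  have h3 := hσ.isExpSum_mcpow.comp_affine (-1) 1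
  have := (hσ.isExpSum_mcpow.mul (((h1.mul (.const Y)).mul h2).map T)).mul h3
  have e : petzKernel T σ σB Y = fun z => mcpow σ z *
      T (mcpow σB (((-1 : ℝ) : ℂ) * z + ((0 : ℝ) : ℂ)) * Y *
        mcpow σB (((1 : ℝ) : ℂ) * z + ((-1 : ℝ) : ℂ))) *
      mcpow σ (((-1 : ℝ) : ℂ) * z + ((1 : ℝ) : ℂ)) := by
    ext1 z
    have e1 : ((-1 : ℝ) : ℂ) * z + ((0 : ℝ) : ℂ) = -z := by simp
    have e2 : ((1 : ℝ) : ℂ) * z + ((-1 : ℝ) : ℂ) = z - 1 := by push_cast; ring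
    have e3 : ((-1 : ℝ) : ℂ) * z + ((1 : ℝ) : ℂ) = 1 - z := by push_cast; ring
    rw [e1, e2, e3, petzKernel]
  rw [e]
  exact this

theorem map_petzRecovery (hσ : σ.PosDef) (hσB : σB.PosDef) (Y : Matrix (Fin m) (Fin m) ℂ)
    (L : Matrix (Fin n) (Fin n) ℂ →ₗ[ℂ] ℂ) :
    L (petzRecovery (fun Y => T Y) σ σB Y) =
      ∫ t : ℝ, (beta0 t : ℂ) * L (petzKernel T σ σB Y (1 / 2 - t * Complex.I)) := by
  have hL : ∀ M, L M = ∑ i, ∑ j, M i j * L (Matrix.single i j 1) := fun M => by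
    conv_lhs => rw [Matrix.matrix_eq_sum_single M]
    simp only [map_sum]
    refine Finset.sum_congr rfl fun i _ => Finset.sum_congr rfl fun j _ => ?_
    rw [← smul_eq_mul, ← map_smul, Matrix.smul_single, smul_eq_mul, mul_one]
  have hint : ∀ i j, Integrable fun t : ℝ =>
      (beta0 t : ℂ) * petzKernel T σ σB Y (1 / 2 - t * Complex.I) i j := fun i j =>
    ((isExpSum_petzKernel hσ hσB Y).map (Matrix.entryLinearMap ℂ ℂ i j)).integrable_beta0_mul
  rw [hL]
  have hL' : ∀ t : ℝ, (beta0 t : ℂ) * L (petzKernel T σ σB Y (1 / 2 - t * Complex.I)) =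
      ∑ i, ∑ j, (beta0 t : ℂ) * petzKernel T σ σB Y (1 / 2 - t * Complex.I) i j *
        L (Matrix.single i j 1) := fun t => by
    rw [hL]; simp only [Finset.mul_sum, ← mul_assoc]
  simp only [hL', petzRecovery_apply]
  rw [integral_finsetSum _ fun i _ => integrable_finsetSum _ fun j _ => (hint i j).mul_const _]
  refine Finset.sum_congr rfl fun i _ => ?_
  rw [integral_finsetSum _ fun j _ => (hint i j).mul_const _]
  exact Finset.sum_congr rfl fun j _ => (integral_mul_const _ _).symm

theorem petzRecovery_add_smul (hσ : σ.PosDef) (hσB : σB.PosDef) (a b : ℂ)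
    (Y Z : Matrix (Fin m) (Fin m) ℂ) :
    petzRecovery (fun Y => T Y) σ σB (a • Y + b • Z) =
      a • petzRecovery (fun Y => T Y) σ σB Y + b • petzRecovery (fun Y => T Y) σ σB Z := by
  have hint : ∀ Y i j, Integrable fun t : ℝ =>
      (beta0 t : ℂ) * petzKernel T σ σB Y (1 / 2 - t * Complex.I) i j := fun Y i j =>
    ((isExpSum_petzKernel hσ hσB Y).map (Matrix.entryLinearMap ℂ ℂ i j)).integrable_beta0_mul
  ext i j
  simp only [Matrix.add_apply, Matrix.smul_apply, petzRecovery_apply, smul_eq_mul]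
  rw [← integral_const_mul, ← integral_const_mul, ← integral_add ((hint Y i j).const_mul a)
    ((hint Z i j).const_mul b)]
  congr 1 with t
  simp only [petzKernel, Matrix.mul_add, Matrix.add_mul, Matrix.mul_smul, Matrix.smul_mul,
    map_add, map_smul, Matrix.add_apply, Matrix.smul_apply, smul_eq_mul]
  ring

theorem petzRecovery_self (hT : T 1 = 1) (hσ : σ.PosDef) (hσB : σB.PosDef) :
    petzRecovery (fun Y => T Y) σ σB σB = σ := by
  have hk : ∀ z, petzKernel T σ σB σB z = σ := fun z => by
    have e : mcpow σB (-z) * σB * mcpow σB (z - 1) = 1 := by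
      nth_rewrite 2 [← hσB.mcpow_one]
      rw [hσB.mcpow_mul, hσB.mcpow_mul, neg_add_eq_sub, sub_add_sub_cancel, sub_self,
        hσB.mcpow_zero]
    rw [petzKernel, e, hT, Matrix.mul_one, hσ.mcpow_mul]
    simpa using hσ.mcpow_one
  ext i j
  simp only [petzRecovery_apply, hk]
  rw [integral_mul_const, integral_complex_ofReal, integral_beta0, Complex.ofReal_one, one_mul]

end Petz

theorem star_half_sub (t : ℝ) : star (1 / 2 - t * Complex.I : ℂ) = 1 - (1 / 2 - t * Complex.I) := by
  apply Complex.ext <;> norm_num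

namespace IsTwoPositiveDual

variable {n m : ℕ} {Tt : Matrix (Fin n) (Fin n) ℂ →ₗ[ℂ] Matrix (Fin m) (Fin m) ℂ}
  {T : Matrix (Fin m) (Fin m) ℂ →ₗ[ℂ] Matrix (Fin n) (Fin n) ℂ} (h : IsTwoPositiveDual Tt T)
  {σ : Matrix (Fin n) (Fin n) ℂ} {σB : Matrix (Fin m) (Fin m) ℂ}
include h

theorem petzKernel_posSemidef (hσ : σ.PosDef) (hσB : σB.PosDef) {Y : Matrix (Fin m) (Fin m) ℂ}
    (hY : Y.PosSemidef) (t : ℝ) : (petzKernel T σ σB Y (1 / 2 - t * Complex.I)).PosSemidef := by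
  have e1 : mcpow σ (1 - (1 / 2 - t * Complex.I)) = (mcpow σ (1 / 2 - t * Complex.I))ᴴ := by
    rw [hσ.mcpow_conjTranspose, star_half_sub]
  have e2 : mcpow σB ((1 / 2 - t * Complex.I) - 1) = (mcpow σB (-(1 / 2 - t * Complex.I)))ᴴ := by
    rw [hσB.mcpow_conjTranspose, star_neg, star_half_sub, neg_sub]
  have e3 : ∀ C : Matrix (Fin m) (Fin m) ℂ, C * Y * Cᴴ =
      (C * mcpow Y ((1 / 2 : ℝ) : ℂ)) * (C * mcpow Y ((1 / 2 : ℝ) : ℂ))ᴴ := fun C => by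
    conv_lhs => rw [← hY.mcpow_half_mul_self]
    rw [Matrix.conjTranspose_mul, (hY.mcpow_posSemidef _).isHermitian.eq]
    simp only [Matrix.mul_assoc]
  rw [petzKernel, e1, e2, e3]
  exact (h.dual_posSemidef _).mul_mul_conjTranspose_same _

theorem petzRecovery_posSemidef (hσ : σ.PosDef) (hσB : σB.PosDef) {Y : Matrix (Fin m) (Fin m) ℂ}
    (hY : Y.PosSemidef) : (petzRecovery (fun Y => T Y) σ σB Y).PosSemidef := by
  refine .of_dotProduct_mulVec_nonneg ?_ fun v => ?_
  · ext i j
    rw [Matrix.conjTranspose_apply, petzRecovery_apply, petzRecovery_apply, Complex.star_def,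
      ← integral_conj]
    congr 1 with t
    rw [map_mul, Complex.conj_ofReal, ← Complex.star_def, ← Matrix.conjTranspose_apply,
      (h.petzKernel_posSemidef hσ hσB hY t).isHermitian.eq]
  · have hL := map_petzRecovery (T := T) hσ hσB Y
      (Matrix.traceLinearMap (Fin n) ℂ ℂ ∘ₗ LinearMap.mulLeft ℂ (Matrix.vecMulVec v (star v)))
    have e : ∀ M : Matrix (Fin n) (Fin n) ℂ, (Matrix.traceLinearMap (Fin n) ℂ ℂ ∘ₗ
        LinearMap.mulLeft ℂ (Matrix.vecMulVec v (star v))) M = star v ⬝ᵥ (M *ᵥ v) := fun M => by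
      simp only [LinearMap.comp_apply, LinearMap.mulLeft_apply, Matrix.traceLinearMap_apply]
      rw [Matrix.trace_mul_comm, Matrix.mul_vecMulVec, Matrix.trace_vecMulVec, dotProduct_comm]
    simp only [e] at hL
    rw [hL]
    have e2 : ∀ t : ℝ, (beta0 t : ℂ) *
        (star v ⬝ᵥ (petzKernel T σ σB Y (1 / 2 - t * Complex.I) *ᵥ v)) =
        ((beta0 t * (star v ⬝ᵥ (petzKernel T σ σB Y (1 / 2 - t * Complex.I) *ᵥ v)).re : ℝ) : ℂ) := by
      intro t
      have := Complex.nonneg_iff.1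
        ((h.petzKernel_posSemidef hσ hσB hY t).dotProduct_mulVec_nonneg v)
      rw [Complex.ofReal_mul]
      congr 1
      exact Complex.ext (by simp) (by simpa using this.2.symm)
    simp only [e2]
    rw [integral_complex_ofReal]
    have : 0 ≤ ∫ t : ℝ, beta0 t *
        (star v ⬝ᵥ (petzKernel T σ σB Y (1 / 2 - t * Complex.I) *ᵥ v)).re :=
      integral_nonneg fun t => mul_nonneg (beta0_nonneg t) (Complex.nonneg_iff.1
        ((h.petzKernel_posSemidef hσ hσB hY t).dotProduct_mulVec_nonneg v)).1
    exact_mod_cast this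

end IsTwoPositiveDual

section
open scoped Matrix.Norms.L2Operator

theorem Matrix.PosDef.hasDerivAt_mcpow_neg {n : ℕ} {A : Matrix (Fin n) (Fin n) ℂ}
    (hA : A.PosDef) : HasDerivAt (fun z => mcpow A (-z)) (-mlog A) 0 := by
  have h : HasDerivAt (mcpow A) (mlog A) (-0 : ℂ) := by simpa using hA.hasDerivAt_mcpow
  simpa [Function.comp_def] using h.scomp (0 : ℂ) (hasDerivAt_neg (0 : ℂ))

/-- Derivative at zero of the exponential sum behind the data processing inequality. -/
theorem hasDerivAt_trace_mcpow {n m : ℕ} (T : Matrix (Fin m) (Fin m) ℂ →ₗ[ℂ] Matrix (Fin n) (Fin n) ℂ)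
    (hT : T 1 = 1) {ω σ ρ : Matrix (Fin n) (Fin n) ℂ} {σB ρB : Matrix (Fin m) (Fin m) ℂ}
    (hω : ω.PosDef) (hσ : σ.PosDef) (hρ : ρ.PosDef) (hσB : σB.PosDef) (hρB : ρB.PosDef)
    (s : Matrix (Fin n) (Fin n) ℂ) :
    HasDerivAt (fun z => (s * (mcpow ω z * mcpow σ z * T (mcpow σB (-z) * mcpow ρB z) *
      mcpow ρ (-z) * s)).trace)
      (s * (mlog ω + mlog σ + T (mlog ρB - mlog σB) - mlog ρ) * s).trace 0 := by
  have hTd : HasDerivAt (fun z => T (mcpow σB (-z) * mcpow ρB z)) (T (mlog ρB - mlog σB)) 0 := by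
    have h1 := hσB.hasDerivAt_mcpow_neg.mul hρB.hasDerivAt_mcpow
    have h2 := T.toContinuousLinearMap.hasFDerivAt.comp_hasDerivAt (0 : ℂ) h1
    refine h2.congr_deriv ?_
    simp [hσB.mcpow_zero, hρB.mcpow_zero, sub_eq_neg_add]
  have h3 := ((((hω.hasDerivAt_mcpow.mul hσ.hasDerivAt_mcpow).mul hTd).mul
    hρ.hasDerivAt_mcpow_neg).mul_const s).const_mul s
  have h4 := (Matrix.traceLinearMap (Fin n) ℂ ℂ).toContinuousLinearMap.hasFDerivAt.comp_hasDerivAt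
    (0 : ℂ) h3
  refine h4.congr_deriv ?_
  simp [hσB.mcpow_zero, hρB.mcpow_zero, hω.mcpow_zero, hσ.mcpow_zero, hρ.mcpow_zero, hT,
    sub_eq_add_neg, Matrix.mul_assoc]

end

namespace IsTwoPositiveDual

variable {n m : ℕ} {Tt : Matrix (Fin n) (Fin n) ℂ →ₗ[ℂ] Matrix (Fin m) (Fin m) ℂ}
  {T : Matrix (Fin m) (Fin m) ℂ →ₗ[ℂ] Matrix (Fin n) (Fin n) ℂ} (h : IsTwoPositiveDual Tt T)
include h

/-- Variational form of the data processing inequality with a recovery term. -/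
theorem variational_le {σ ρ ω : Matrix (Fin n) (Fin n) ℂ} (hσ : σ.PosDef) (hσB : (Tt σ).PosDef)
    (hρ : ρ.PosDef) (hρB : (Tt ρ).PosDef) (hω : ω.PosDef) (hρtr : ρ.trace = 1) :
    (ρ * mlog ω).trace.re + 1 - (ω * petzRecovery (fun Y => T Y) σ (Tt σ) (Tt ρ)).trace.re ≤
      Srel ρ σ - Srel (Tt ρ) (Tt σ) := by
  set s := mcpow ρ ((1 / 2 : ℝ) : ℂ) with hs
  have hss : s * s = ρ := hρ.posSemidef.mcpow_half_mul_self
  have hsH : sᴴ = s := (hρ.posSemidef.mcpow_posSemidef _).isHermitian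
  set w := mcpow ω ((1 / 2 : ℝ) : ℂ) with hw
  have hww : w * w = ω := hω.posSemidef.mcpow_half_mul_self
  have hwH : wᴴ = w := (hω.posSemidef.mcpow_posSemidef _).isHermitian
  let x : ℂ → Matrix (Fin m) (Fin m) ℂ := fun z => mcpow (Tt σ) (-z) * mcpow (Tt ρ) z
  let g : ℂ → ℂ := fun z => (s * (mcpow ω z * mcpow σ z * T (x z) * mcpow ρ (-z) * s)).trace
  have hg : IsExpSum g := by
    have hneg : ∀ {k : ℕ} {A : Matrix (Fin k) (Fin k) ℂ}, A.PosDef →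
        IsExpSum fun z => mcpow A (-z) := fun hA => by
      have := hA.isExpSum_mcpow.comp_affine (-1) 0
      simpa using this
    exact ((IsExpSum.const s).mul ((((hω.isExpSum_mcpow.mul hσ.isExpSum_mcpow).mul
      (((hneg hσB).mul hρB.isExpSum_mcpow).map T)).mul (hneg hρ)).mul (.const s))).map
      (Matrix.traceLinearMap (Fin n) ℂ ℂ)
  have hg0 : g 0 = 1 := by
    simp only [g, x, neg_zero, hω.mcpow_zero, hσ.mcpow_zero, hρ.mcpow_zero, hσB.mcpow_zero,
      hρB.mcpow_zero, Matrix.one_mul, h.dual_one, hss, hρtr]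
  have hcancel : ∀ {k : ℕ} {A : Matrix (Fin k) (Fin k) ℂ}, A.PosDef → ∀ (t : ℝ)
      (B : Matrix (Fin k) (Fin k) ℂ), (mcpow A (t * I))ᴴ * (mcpow A (t * I) * B) = B :=
    fun hA t B => by
      rw [hA.mcpow_conjTranspose, ← Matrix.mul_assoc, hA.mcpow_mul]
      have : star (t * I : ℂ) + t * I = 0 := by simp
      rw [this, hA.mcpow_zero, Matrix.one_mul]
  have hcancel' : ∀ {k : ℕ} {A : Matrix (Fin k) (Fin k) ℂ}, A.PosDef → ∀ (t : ℝ)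
      (B : Matrix (Fin k) (Fin k) ℂ), (mcpow A (-(t * I)))ᴴ * (mcpow A (-(t * I)) * B) = B :=
    fun hA t B => by
      have := hcancel hA (-t) B
      simpa using this
  have hle : ∀ t : ℝ, ‖g (t * I)‖ ≤ 1 := fun t => by
    have hcs := Matrix.norm_trace_mul_sq_le s
      (mcpow ω (t * I) * mcpow σ (t * I) * T (x (t * I)) * mcpow ρ (-(t * I)) * s)
    have hsch := h.trace_schwarz (x (t * I))ᴴ (mcpow ρ (-(t * I)) * s)
    rw [h.dual_conjTranspose, Matrix.conjTranspose_conjTranspose,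
      Matrix.conjTranspose_conjTranspose] at hsch
    have hx : (x (t * I))ᴴ * x (t * I) = 1 := by
      simp only [x, Matrix.conjTranspose_mul, Matrix.mul_assoc, hcancel' hσB]
      simpa using hcancel hρB t 1
    simp only [hx, h.dual_one, Matrix.conjTranspose_mul, Matrix.mul_assoc,
      hcancel' hρ, hcancel hω, hcancel hσ, hsH, hss, hρtr, Complex.one_re, one_mul] at hcs hsch
    have : ‖g (t * I)‖ ^ 2 ≤ 1 := by
      simp only [g, Matrix.mul_assoc]
      exact hcs.trans hsch
    exact (sq_le_one_iff₀ (norm_nonneg _)).1 this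
  have hexp := isExpSum_petzKernel (T := T) hσ hσB (Tt ρ)
  let L : Matrix (Fin n) (Fin n) ℂ →ₗ[ℂ] ℂ :=
    Matrix.traceLinearMap (Fin n) ℂ ℂ ∘ₗ LinearMap.mulLeft ℂ ω
  let u : ℝ → ℝ := fun t => (L (petzKernel T σ (Tt σ) (Tt ρ) (1 / 2 - t * I))).re
  have hint := (hexp.map L).integrable_beta0_mul
  have hu : Integrable fun t => beta0 t * u t :=
    hint.re.congr (.of_forall fun t => by simp [u])
  have hgu : ∀ t : ℝ, ‖g (1 / 2 - t * I)‖ ^ 2 ≤ u t := fun t => by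
    set z : ℂ := 1 / 2 - t * I with hz
    have hzz : z + star z = 1 := by rw [star_half_sub]; ring
    have hzs : star z = 1 - z := star_half_sub t
    have e1 : mcpow σ (1 - z) = (mcpow σ z)ᴴ := by rw [hσ.mcpow_conjTranspose, hzs]
    have e2 : mcpow (Tt σ) (z - 1) = (mcpow (Tt σ) (-z))ᴴ := by
      rw [hσB.mcpow_conjTranspose, star_neg, hzs, neg_sub]
    have e3 : mcpow (Tt ρ) z * (mcpow (Tt ρ) z)ᴴ = Tt ρ := by
      rw [hρB.mcpow_conjTranspose, hρB.mcpow_mul, hzz, hρB.mcpow_one]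
    have e4 : (mcpow ω z)ᴴ * mcpow ω z = ω := by
      rw [hω.mcpow_conjTranspose, hω.mcpow_mul, add_comm, hzz, hω.mcpow_one]
    have hV : mcpow ρ (-z) * s * s * (mcpow ρ (-z))ᴴ = 1 := by
      rw [Matrix.mul_assoc (mcpow ρ (-z)), hss]
      nth_rewrite 2 [← hρ.mcpow_one]
      rw [hρ.mcpow_conjTranspose, hρ.mcpow_mul, hρ.mcpow_mul, star_neg, hzs]
      have : -z + 1 + -(1 - z) = 0 := by ring
      rw [this, hρ.mcpow_zero]
    have hV' : (mcpow ρ (-z) * s) * (mcpow ρ (-z) * s)ᴴ = 1 := by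
      rw [Matrix.conjTranspose_mul, hsH, ← Matrix.mul_assoc, hV]
    have hcs := Matrix.norm_trace_mul_sq_le (mcpow ρ (-z) * s * s)
      (mcpow ω z * mcpow σ z * T (x z))
    have hA : (mcpow ρ (-z) * s * s * (mcpow ρ (-z) * s * s)ᴴ).trace = 1 := by
      rw [Matrix.conjTranspose_mul, hsH, Matrix.trace_mul_comm, Matrix.mul_assoc,
        ← Matrix.mul_assoc (mcpow ρ (-z) * s)ᴴ, mul_eq_one_comm.1 hV', Matrix.one_mul, hss,
        hρtr]
    have hgz : g z = (mcpow ρ (-z) * s * s * (mcpow ω z * mcpow σ z * T (x z))).trace := by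
      simp only [g]
      rw [Matrix.mul_assoc (mcpow ω z * mcpow σ z * T (x z)), ← Matrix.mul_assoc s,
        Matrix.trace_mul_comm, ← Matrix.mul_assoc]
    rw [hA, Complex.one_re, one_mul, ← hgz] at hcs
    refine hcs.trans ?_
    have hsch := h.trace_schwarz (x z) ((mcpow σ z)ᴴ * w)
    have hxx : x z * (x z)ᴴ = mcpow (Tt σ) (-z) * Tt ρ * mcpow (Tt σ) (z - 1) := by
      simp only [x, Matrix.conjTranspose_mul, e2]
      rw [Matrix.mul_assoc, ← Matrix.mul_assoc _ (mcpow (Tt ρ) z)ᴴ, e3, Matrix.mul_assoc]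
    have hr : (((mcpow σ z)ᴴ * w)ᴴ * T (x z * (x z)ᴴ) * ((mcpow σ z)ᴴ * w)).trace =
        L (petzKernel T σ (Tt σ) (Tt ρ) z) := by
      simp only [L, LinearMap.comp_apply, LinearMap.mulLeft_apply, Matrix.traceLinearMap_apply,
        petzKernel, ← hxx, e1]
      rw [Matrix.conjTranspose_mul, Matrix.conjTranspose_conjTranspose, hwH, ← Matrix.mul_assoc,
        Matrix.trace_mul_comm, ← hww]
      simp only [Matrix.mul_assoc]
    have hl : (((mcpow σ z)ᴴ * w)ᴴ * (T (x z) * (T (x z))ᴴ) * ((mcpow σ z)ᴴ * w)).trace =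
        ((mcpow ω z * mcpow σ z * T (x z))ᴴ * (mcpow ω z * mcpow σ z * T (x z))).trace := by
      have e5 : (mcpow ω z * mcpow σ z * T (x z))ᴴ * (mcpow ω z * mcpow σ z * T (x z)) =
          (T (x z))ᴴ * ((mcpow σ z)ᴴ * w * (w * (mcpow σ z * T (x z)))) := by
        simp only [Matrix.conjTranspose_mul, Matrix.mul_assoc]
        rw [← Matrix.mul_assoc _ (mcpow ω z), e4, ← Matrix.mul_assoc w, hww]
      rw [e5, Matrix.conjTranspose_mul, Matrix.conjTranspose_conjTranspose, hwH,
        ← Matrix.mul_assoc (T (x z))ᴴ, Matrix.trace_mul_comm ((T (x z))ᴴ * _)]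
      simp only [Matrix.mul_assoc]
    rw [hr, hl] at hsch
    exact hsch
  have hmain := hg.re_deriv_le_integral hg0 hle
    (hasDerivAt_trace_mcpow T h.dual_one hω hσ hρ hσB hρB s) hu hgu
  have hI : ∫ t, beta0 t * u t =
      (ω * petzRecovery (fun Y => T Y) σ (Tt σ) (Tt ρ)).trace.re := by
    have hL := map_petzRecovery (T := T) hσ hσB (Tt ρ) L
    have : (L (petzRecovery (fun Y => T Y) σ (Tt σ) (Tt ρ))).re = ∫ t, beta0 t * u t := by
      rw [hL, ← RCLike.re_eq_complex_re, ← integral_re hint]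
      simp [u]
    exact this.symm
  have hD : (s * (mlog ω + mlog σ + T (mlog (Tt ρ) - mlog (Tt σ)) - mlog ρ) * s).trace.re =
      (ρ * mlog ω).trace.re - (Srel ρ σ - Srel (Tt ρ) (Tt σ)) := by
    rw [Matrix.mul_assoc, Matrix.trace_mul_comm, Matrix.mul_assoc, Matrix.trace_mul_comm, hss]
    simp only [Matrix.mul_add, Matrix.mul_sub, Matrix.trace_add, Matrix.trace_sub,
      ← h.trace_map_mul, Srel, Complex.add_re, Complex.sub_re]
    ring
  rw [hI, hD] at hmain
  linarith

end IsTwoPositiveDual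

namespace Matrix.PosDef

variable {n : ℕ} {ω τ ρ : Matrix (Fin n) (Fin n) ℂ}

theorem mul_mcpow_neg_one (hω : ω.PosDef) : ω * mcpow ω (-1) = 1 := by
  nth_rewrite 1 [← hω.mcpow_one]
  rw [hω.mcpow_mul, add_neg_cancel, hω.mcpow_zero]

/-- A Gibbs type lower bound for `Tr ρ log ω`. -/
theorem le_trace_mul_mlog (hω : ω.PosDef) (hρ : ρ.PosSemidef) (hρtr : ρ.trace = 1) {s : ℝ}
    (hs : 0 < s) :
    1 - (ρ * mcpow ω (-1)).trace.re / s - Real.log s ≤ (ρ * mlog ω).trace.re := by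
  have hH := hω.isHermitian
  set p : Fin n → ℂ := fun i => ((hH.eigenvectorUnitary : Matrix (Fin n) (Fin n) ℂ)ᴴ * ρ *
      (hH.eigenvectorUnitary : Matrix (Fin n) (Fin n) ℂ)) i i with hp
  have hp0 : ∀ i, 0 ≤ (p i).re := fun i =>
    (Complex.nonneg_iff.1 (hρ.conjTranspose_mul_mul_same _).diag_nonneg).1
  have hp1 : ∑ i, (p i).re = 1 := by
    have := hH.trace_mul_fcalc ρ (fun _ => 1)
    rw [hH.fcalc_one, Matrix.mul_one, hρtr] at this
    simpa using (congrArg Complex.re this).symm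
  have h1 : (ρ * mlog ω).trace.re = ∑ i, Real.log (hH.eigenvalues i) * (p i).re := by
    rw [hH.mlog_eq, hH.trace_mul_fcalc, Complex.re_sum]
    exact Finset.sum_congr rfl fun i _ => Complex.re_ofReal_mul _ _
  have h2 : (ρ * mcpow ω (-1)).trace.re =
      ∑ i, Real.exp (-Real.log (hH.eigenvalues i)) * (p i).re := by
    rw [hω.mcpow_eq_exp, hH.trace_mul_fcalc, Complex.re_sum]
    refine Finset.sum_congr rfl fun i _ => ?_
    rw [← Complex.re_ofReal_mul]
    simp [hp]
  rw [h1, h2, Finset.sum_div]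
  have : 1 - Real.log s = ∑ i, (1 - Real.log s) * (p i).re := by
    rw [← Finset.mul_sum, hp1, mul_one]
  rw [sub_right_comm, this, ← Finset.sum_sub_distrib]
  refine Finset.sum_le_sum fun i _ => ?_
  rw [mul_div_right_comm, ← sub_mul]
  refine mul_le_mul_of_nonneg_right ?_ (hp0 i)
  have he := Real.add_one_le_exp (-Real.log (hH.eigenvalues i) - Real.log s)
  rw [Real.exp_sub, Real.exp_log hs] at he
  linarith

/-- The optimal test operator for the fidelity. -/
theorem exists_fidelity_test (hρ : ρ.PosDef) (hτ : τ.PosDef) (hn : 0 < n) :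
    0 < fidelity ρ τ ∧ ∃ ω : Matrix (Fin n) (Fin n) ℂ, ω.PosDef ∧ (ω * τ).trace.re = 1 ∧
      (ρ * mcpow ω (-1)).trace.re = fidelity ρ τ ^ 2 := by
  have : Nonempty (Fin n) := ⟨⟨0, hn⟩⟩
  set r := mcpow τ ((1 / 2 : ℝ) : ℂ) with hr
  have hrP : r.PosDef := hτ.mcpow_posDef _
  have hrr : r * r = τ := hτ.posSemidef.mcpow_half_mul_self
  set q := mcpow τ ((-(1 / 2) : ℝ) : ℂ) with hq
  have hqP : q.PosDef := hτ.mcpow_posDef _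
  have hqr : q * r = 1 := by
    rw [hq, hr, hτ.mcpow_mul, ← hτ.mcpow_zero]; congr 1; push_cast; ring
  have hrq : r * q = 1 := mul_eq_one_comm.1 hqr
  have hsH : (mcpow ρ ((1 / 2 : ℝ) : ℂ))ᴴ = mcpow ρ ((1 / 2 : ℝ) : ℂ) :=
    (hρ.mcpow_posDef _).isHermitian
  have hG : (mcpow ρ ((1 / 2 : ℝ) : ℂ) * r)ᴴ * (mcpow ρ ((1 / 2 : ℝ) : ℂ) * r) = rᴴ * ρ * r := by
    conv_rhs => rw [← hρ.posSemidef.mcpow_half_mul_self]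
    rw [Matrix.conjTranspose_mul, hsH]
    simp only [Matrix.mul_assoc]
  have hGP : (rᴴ * ρ * r).PosDef := 
    (Matrix.IsUnit.posDef_star_left_conjugate_iff hrP.isUnit).2 hρ
  set N := mcpow (rᴴ * ρ * r) ((1 / 2 : ℝ) : ℂ) with hN
  have hNP : N.PosDef := hGP.mcpow_posDef _
  have hNN : N * N = r * ρ * r := by
    rw [hGP.posSemidef.mcpow_half_mul_self, hrP.isHermitian.eq]
  have hF : fidelity ρ τ = N.trace.re := by
    rw [fidelity, trAbs, ← hr, hG]
  have hF0 : 0 < fidelity ρ τ := by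
    rw [hF]; exact (Complex.pos_iff.1 hNP.trace_pos).1
  refine ⟨hF0, ?_⟩
  set F := fidelity ρ τ
  have hFne : (F : ℂ) ≠ 0 := by exact_mod_cast hF0.ne'
  have hP : (((F⁻¹ : ℝ) : ℂ) • (q * N * q)).PosDef := by
    refine PosDef.smul ?_ (by exact_mod_cast inv_pos.2 hF0)
    have := (Matrix.IsUnit.posDef_star_left_conjugate_iff hqP.isUnit).2 hNP
    rwa [Matrix.star_eq_conjTranspose, hqP.isHermitian.eq] at this
  refine ⟨_, hP, ?_, ?_⟩
  · have e : (q * N * q * τ).trace = N.trace := by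
      rw [← hrr, Matrix.mul_assoc, ← Matrix.mul_assoc q r, hqr, Matrix.one_mul, Matrix.mul_assoc,
        Matrix.trace_mul_comm, Matrix.mul_assoc, hrq, Matrix.mul_one]
    rw [Matrix.smul_mul, Matrix.trace_smul, e, smul_eq_mul, Complex.re_ofReal_mul, ← hF,
      inv_mul_cancel₀ hF0.ne']
  · set W := mcpow N (-1)
    have hNW : N * W = 1 := hNP.mul_mcpow_neg_one
    have hinv : mcpow (((F⁻¹ : ℝ) : ℂ) • (q * N * q)) (-1) = (F : ℂ) • (r * W * r) := by
      have h1 : ((F : ℂ) • (r * W * r)) * (((F⁻¹ : ℝ) : ℂ) • (q * N * q)) = 1 := by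
        rw [Matrix.smul_mul, Matrix.mul_smul, smul_smul, Complex.ofReal_inv, mul_inv_cancel₀ hFne,
          one_smul]
        have : r * W * r * (q * N * q) = r * (W * ((r * q) * N)) * q := by
          simp only [Matrix.mul_assoc]
        rw [this, hrq, Matrix.one_mul, mul_eq_one_comm.1 hNW, Matrix.mul_one, hrq]
      exact (left_inv_eq_right_inv h1 hP.mul_mcpow_neg_one).symm
    have e : (ρ * (r * W * r)).trace = N.trace := by
      have : (ρ * (r * W * r)).trace = (r * ρ * r * W).trace := by
        rw [← Matrix.mul_assoc, Matrix.trace_mul_comm]; simp only [Matrix.mul_assoc]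
      rw [this, ← hNN, Matrix.mul_assoc, hNW, Matrix.mul_one]
    rw [hinv, Matrix.mul_smul, Matrix.trace_smul, e, smul_eq_mul, Complex.re_ofReal_mul, ← hF, sq]

end Matrix.PosDef

namespace IsTwoPositiveDual

variable {n m : ℕ} {Tt : Matrix (Fin n) (Fin n) ℂ →ₗ[ℂ] Matrix (Fin m) (Fin m) ℂ}
  {T : Matrix (Fin m) (Fin m) ℂ →ₗ[ℂ] Matrix (Fin n) (Fin n) ℂ} (h : IsTwoPositiveDual Tt T)
include h

/-- The improved data processing inequality for positive definite states, in exponential form. -/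
theorem exp_le_fidelity {σ ρ : Matrix (Fin n) (Fin n) ℂ} (hσ : σ.PosDef) (hσB : (Tt σ).PosDef)
    (hρ : ρ.PosDef) (hρB : (Tt ρ).PosDef) (hρtr : ρ.trace = 1)
    (hτ : (petzRecovery (fun Y => T Y) σ (Tt σ) (Tt ρ)).PosDef) :
    Real.exp (-(Srel ρ σ - Srel (Tt ρ) (Tt σ)) / 2) ≤
      fidelity ρ (petzRecovery (fun Y => T Y) σ (Tt σ) (Tt ρ)) := by
  have hn : 0 < n := by
    rcases Nat.eq_zero_or_pos n with rfl | hn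
    · simp [Matrix.trace] at hρtr
    · exact hn
  obtain ⟨hF, ω, hω, h1, h2⟩ := hρ.exists_fidelity_test hτ hn
  have h3 := h.variational_le hσ hσB hρ hρB hω hρtr
  have h4 := hω.le_trace_mul_mlog hρ.posSemidef hρtr (pow_pos hF 2)
  rw [h2, div_self (pow_pos hF 2).ne', Real.log_pow] at h4
  rw [h1] at h3
  rw [← Real.le_log_iff_exp_le hF]
  push_cast at h4
  linarith

end IsTwoPositiveDual

theorem Matrix.IsHermitian.mul_mlog {n : ℕ} {A : Matrix (Fin n) (Fin n) ℂ} (hA : A.IsHermitian) :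
    A * mlog A = cfc (fun x : ℝ => x * Real.log x) A := by
  rw [hA.mlog_eq, ← hA.fcalc_ofReal]
  nth_rewrite 1 [← hA.fcalc_id]
  rw [hA.fcalc_mul]
  simp

section Continuity

open scoped Matrix.Norms.L2Operator

variable {X : Type*} [TopologicalSpace X] {n : ℕ} {A B : X → Matrix (Fin n) (Fin n) ℂ}

theorem Continuous.matrix_cfc (hA : Continuous A) (hH : ∀ x, (A x).IsHermitian) {f : ℝ → ℝ}
    (hf : Continuous f) : Continuous fun x => cfc f (A x) :=
  hA.cfc_of_mem_nhdsSet f Filter.univ_mem hH hf.continuousOn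

theorem Continuous.mcpow_half (hA : Continuous A) (hp : ∀ x, (A x).PosSemidef) :
    Continuous fun x => mcpow (A x) ((1 / 2 : ℝ) : ℂ) := by
  simp only [fun x => (hp x).mcpow_ofReal (1 / 2)]
  exact hA.matrix_cfc (fun x => (hp x).isHermitian)
    (Real.continuous_rpow_const (by norm_num))

theorem Continuous.srel_left (hA : Continuous A) (hH : ∀ x, (A x).IsHermitian)
    (σ : Matrix (Fin n) (Fin n) ℂ) : Continuous fun x => Srel (A x) σ := by
  simp only [Srel, fun x => (hH x).mul_mlog]
  exact Complex.continuous_re.comp (((hA.matrix_cfc hH Real.continuous_mul_log).sub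
    (hA.mul continuous_const)).matrix_trace)

theorem Continuous.fidelity (hA : Continuous A) (hB : Continuous B)
    (hpA : ∀ x, (A x).PosSemidef) (hpB : ∀ x, (B x).PosSemidef) :
    Continuous fun x => fidelity (A x) (B x) := by
  have h := (hA.mcpow_half hpA).mul (hB.mcpow_half hpB)
  exact Complex.continuous_re.comp (Continuous.matrix_trace
    ((h.matrix_conjTranspose.mul h).mcpow_half fun x =>
      Matrix.posSemidef_conjTranspose_mul_self _))

end Continuity

section Mixture

variable {n : ℕ}

/-- The convex combination `(1 - ε) ρ + ε σ`. -/
noncomputable def mixture (ρ σ : Matrix (Fin n) (Fin n) ℂ) (ε : unitInterval) :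
    Matrix (Fin n) (Fin n) ℂ :=
  ((1 - (ε : ℝ) : ℝ) : ℂ) • ρ + ((ε : ℝ) : ℂ) • σ

variable {ρ σ : Matrix (Fin n) (Fin n) ℂ}

theorem continuous_mixture : Continuous (mixture ρ σ) := by
  unfold mixture
  fun_prop

theorem mixture_zero : mixture ρ σ 0 = ρ := by
  simp [mixture]

theorem mixture_posSemidef (hρ : ρ.PosSemidef) (hσ : σ.PosSemidef) (ε : unitInterval) :
    (mixture ρ σ ε).PosSemidef :=
  (hρ.smul (by exact_mod_cast sub_nonneg.2 ε.2.2)).add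
    (hσ.smul (by exact_mod_cast ε.2.1))

theorem mixture_posDef (hρ : ρ.PosSemidef) (hσ : σ.PosDef) {ε : unitInterval} (hε : 0 < (ε : ℝ)) :
    (mixture ρ σ ε).PosDef :=
  Matrix.PosDef.posSemidef_add (hρ.smul (by exact_mod_cast sub_nonneg.2 ε.2.2))
    (hσ.smul (by exact_mod_cast hε))

theorem trace_mixture (hρ : ρ.trace = 1) (hσ : σ.trace = 1) (ε : unitInterval) :
    (mixture ρ σ ε).trace = 1 := by
  simp [mixture, hρ, hσ]

theorem map_mixture {m : ℕ} (Φ : Matrix (Fin n) (Fin n) ℂ →ₗ[ℂ] Matrix (Fin m) (Fin m) ℂ)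
    (ε : unitInterval) : Φ (mixture ρ σ ε) = mixture (Φ ρ) (Φ σ) ε := by
  simp [mixture]

end Mixture

theorem IsTwoPositiveDual.exp_le_fidelity_of_posSemidef {n m : ℕ}
    {Tt : Matrix (Fin n) (Fin n) ℂ →ₗ[ℂ] Matrix (Fin m) (Fin m) ℂ}
    {T : Matrix (Fin m) (Fin m) ℂ →ₗ[ℂ] Matrix (Fin n) (Fin n) ℂ} (h : IsTwoPositiveDual Tt T)
    {σ ρ : Matrix (Fin n) (Fin n) ℂ} (hσ : σ.PosDef) (hσtr : σ.trace = 1) (hσB : (Tt σ).PosDef)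
    (hρ : ρ.PosSemidef) (hρtr : ρ.trace = 1) :
    Real.exp (-(Srel ρ σ - Srel (Tt ρ) (Tt σ)) / 2) ≤
      fidelity ρ (petzRecovery (fun Y => T Y) σ (Tt σ) (Tt ρ)) := by
  set τ := petzRecovery (fun Y => T Y) σ (Tt σ) (Tt ρ) with hτ_def
  have hτ : τ.PosSemidef := h.petzRecovery_posSemidef hσ hσB (h.map_posSemidef hρ)
  have hB := h.map_posSemidef hρ
  have hpos : ∀ ε : unitInterval, 0 < (ε : ℝ) →
      Real.exp (-(Srel (mixture ρ σ ε) σ - Srel (mixture (Tt ρ) (Tt σ) ε) (Tt σ)) / 2) ≤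
        fidelity (mixture ρ σ ε) (mixture τ σ ε) := by
    intro ε hε
    have e : petzRecovery (fun Y => T Y) σ (Tt σ) (Tt (mixture ρ σ ε)) = mixture τ σ ε := by
      rw [map_mixture, mixture, petzRecovery_add_smul hσ hσB,
        petzRecovery_self h.dual_one hσ hσB]
      rfl
    have := h.exp_le_fidelity hσ hσB (mixture_posDef hρ hσ hε)
      (by rw [map_mixture]; exact mixture_posDef hB hσB hε) (trace_mixture hρtr hσtr ε)
      (by rw [e]; exact mixture_posDef hτ hσ hε)
    rwa [e, map_mixture] at this
  have hc₁ : Continuous fun ε : unitInterval =>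
      Real.exp (-(Srel (mixture ρ σ ε) σ - Srel (mixture (Tt ρ) (Tt σ) ε) (Tt σ)) / 2) :=
    Real.continuous_exp.comp (((continuous_mixture.srel_left
      (fun ε => (mixture_posSemidef hρ hσ.posSemidef ε).isHermitian) σ).sub
      (continuous_mixture.srel_left
      (fun ε => (mixture_posSemidef hB hσB.posSemidef ε).isHermitian) (Tt σ))).neg.div_const 2)
  have hc₂ : Continuous fun ε : unitInterval => fidelity (mixture ρ σ ε) (mixture τ σ ε) :=
    continuous_mixture.fidelity continuous_mixture (mixture_posSemidef hρ hσ.posSemidef)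
      (mixture_posSemidef hτ hσ.posSemidef)
  let u : ℕ → unitInterval := fun k => ⟨1 / ((k : ℝ) + 1), by positivity,
    div_le_one_of_le₀ (by linarith [k.cast_nonneg (α := ℝ)]) (by positivity)⟩
  have hu : Filter.Tendsto u Filter.atTop (nhds 0) :=
    tendsto_subtype_rng.2 tendsto_one_div_add_atTop_nhds_zero_nat
  have key := le_of_tendsto_of_tendsto' ((hc₁.tendsto 0).comp hu) ((hc₂.tendsto 0).comp hu)
    fun k => hpos (u k) (by positivity)
  simpa only [mixture_zero] using key

/-- **Improved data-processing inequality with fidelity bound.** -/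
theorem improved_DPI_fidelity {n m : ℕ}
    (Tt : Matrix (Fin n) (Fin n) ℂ →ₗ[ℂ] Matrix (Fin m) (Fin m) ℂ)
    (T : Matrix (Fin m) (Fin m) ℂ →ₗ[ℂ] Matrix (Fin n) (Fin n) ℂ)
    (htrace : ∀ X : Matrix (Fin n) (Fin n) ℂ, (Tt X).trace = X.trace)
    (h2pos : ∀ A B C D : Matrix (Fin n) (Fin n) ℂ,
      (Matrix.fromBlocks A B C D).PosSemidef →
      (Matrix.fromBlocks (Tt A) (Tt B) (Tt C) (Tt D)).PosSemidef)
    (hdual : ∀ (X : Matrix (Fin n) (Fin n) ℂ) (Y : Matrix (Fin m) (Fin m) ℂ),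
      (Tt X * Y).trace = (X * T Y).trace)
    (σ : Matrix (Fin n) (Fin n) ℂ) (hσ : σ.PosDef) (hσtr : σ.trace = 1)
    (hσB : (Tt σ).PosDef)
    (ρ : Matrix (Fin n) (Fin n) ℂ) (hρ : ρ.PosSemidef) (hρtr : ρ.trace = 1) :
    - 2 * Real.log (fidelity ρ (petzRecovery (fun Y => T Y) σ (Tt σ) (Tt ρ)))
      ≤ Srel ρ σ - Srel (Tt ρ) (Tt σ) := by
  have h : IsTwoPositiveDual Tt T := ⟨htrace, h2pos, hdual⟩
  have key := h.exp_le_fidelity_of_posSemidef hσ hσtr hσB hρ hρtr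
  have hlog := (Real.le_log_iff_exp_le ((Real.exp_pos _).trans_le key)).2 key
  linarith
end
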